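/- There are universal constants C and c such that: in every directed polymatroidal network on n ≥ 2 nodes, for any multicommodity flow instance with k source-sink pairs and demands D_1,…,D_k, if β is the value of the maximum concurrent flow, then there exists an edge set F whose sparsity ν(F)/D(F) is at most C·n^{11/23}·(log n)^c·β. -/

import Mathlib

open Finset MeasureTheory
open scoped ENNReal Classical

/-- A directed polymatroidal network: a finite directed graph together with,
for each node `v`, polymatroids `rhoM v` on the edges entering `v` and
`rhoP v` on the edges leaving `v`. -/
structure DirPolyNet (V E : Type) [Fintype V] [Fintype E] [DecidableEq V] [DecidableEq E] where
  tail : E → V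
  head : E → V
  rhoM : V → Finset E → ℝ
  rhoP : V → Finset E → ℝ
  rhoM_empty : ∀ v, rhoM v ∅ = 0
  rhoP_empty : ∀ v, rhoP v ∅ = 0
  rhoM_nonneg : ∀ v A, A ⊆ Finset.univ.filter (fun e => head e = v) → 0 ≤ rhoM v A
  rhoP_nonneg : ∀ v A, A ⊆ Finset.univ.filter (fun e => tail e = v) → 0 ≤ rhoP v A
  rhoM_mono : ∀ v A B, A ⊆ B → B ⊆ Finset.univ.filter (fun e => head e = v) →
    rhoM v A ≤ rhoM v B
  rhoP_mono : ∀ v A B, A ⊆ B → B ⊆ Finset.univ.filter (fun e => tail e = v) →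
    rhoP v A ≤ rhoP v B
  rhoM_submod : ∀ v A B, A ⊆ Finset.univ.filter (fun e => head e = v) →
    B ⊆ Finset.univ.filter (fun e => head e = v) →
    rhoM v (A ∪ B) + rhoM v (A ∩ B) ≤ rhoM v A + rhoM v B
  rhoP_submod : ∀ v A B, A ⊆ Finset.univ.filter (fun e => tail e = v) →
    B ⊆ Finset.univ.filter (fun e => tail e = v) →
    rhoP v (A ∪ B) + rhoP v (A ∩ B) ≤ rhoP v A + rhoP v B

namespace DirPolyNet

variable {V E : Type} [Fintype V] [Fintype E] [DecidableEq V] [DecidableEq E]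

/-- The set of edges entering `v` (the ground set of `rhoM v`). -/
def inE (N : DirPolyNet V E) (v : V) : Finset E :=
  Finset.univ.filter (fun e => N.head e = v)

/-- The set of edges leaving `v` (the ground set of `rhoP v`). -/
def outE (N : DirPolyNet V E) (v : V) : Finset E :=
  Finset.univ.filter (fun e => N.tail e = v)

/-- `g` is a valid assignment of the edges of `F` to endpoints. -/
def Valid (N : DirPolyNet V E) (F : Finset E) (g : E → V) : Prop :=
  ∀ e ∈ F, g e = N.tail e ∨ g e = N.head e

/-- The cost `ν(F)` of the edge cut `F`: the minimum over valid assignments `g`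
of `Σ_v (ρ⁻_v(δ⁻(v) ∩ g⁻¹(v)) + ρ⁺_v(δ⁺(v) ∩ g⁻¹(v)))`. -/
noncomputable def cutCost (N : DirPolyNet V E) (F : Finset E) : ℝ :=
  sInf { c : ℝ | ∃ g : E → V, N.Valid F g ∧
    c = ∑ v : V, (N.rhoM v ((N.inE v ∩ F).filter (fun e => g e = v)) +
                  N.rhoP v ((N.outE v ∩ F).filter (fun e => g e = v))) }

/-- `IsWalk N s t p`: the list of edges `p` forms a directed walk from `s` to `t`. -/
def IsWalk (N : DirPolyNet V E) : V → V → List E → Prop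
  | s, t, [] => s = t
  | s, t, e :: p => N.tail e = s ∧ IsWalk N (N.head e) t p

/-- The list of vertices visited by a walk starting at `s`. -/
def walkVerts (N : DirPolyNet V E) : V → List E → List V
  | s, [] => [s]
  | s, e :: p => s :: walkVerts N (N.head e) p

/-- A simple directed path from `s` to `t`. -/
def IsPath (N : DirPolyNet V E) (s t : V) (p : List E) : Prop :=
  N.IsWalk s t p ∧ (N.walkVerts s p).Nodup

/-- `F` separates the ordered pair `(s,t)`: there is no `s→t` path avoiding `F`. -/
def Separates (N : DirPolyNet V E) (F : Finset E) (s t : V) : Prop :=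
  ¬ ∃ p : List E, N.IsWalk s t p ∧ ∀ e ∈ p, e ∉ F

/-- Total flow on an edge `e`. -/
noncomputable def edgeFlow (N : DirPolyNet V E) {ι : Type} [Fintype ι]
    (f : ι → List E → ℝ) (e : E) : ℝ :=
  ∑ i : ι, ∑ᶠ p ∈ {p : List E | e ∈ p}, f i p

/-- The rate of commodity `i`. -/
noncomputable def rate {ι : Type} (f : ι → List E → ℝ) (i : ι) : ℝ :=
  ∑ᶠ p : List E, f i p

/-- A feasible multicommodity flow for the source-sink pairs `(s i, t i)`. -/
structure IsFlow (N : DirPolyNet V E) {ι : Type} [Fintype ι] (s t : ι → V)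
    (f : ι → List E → ℝ) : Prop where
  nonneg : ∀ i p, 0 ≤ f i p
  supp : ∀ i p, f i p ≠ 0 → N.IsPath (s i) (t i) p
  fin : ∀ i, (Function.support (f i)).Finite
  capM : ∀ v, ∀ S ⊆ N.inE v, ∑ e ∈ S, N.edgeFlow f e ≤ N.rhoM v S
  capP : ∀ v, ∀ S ⊆ N.outE v, ∑ e ∈ S, N.edgeFlow f e ≤ N.rhoP v S

/-- `D(F)`: the total demand of the pairs separated by `F`. -/
noncomputable def sepDemand (N : DirPolyNet V E) {ι : Type} [Fintype ι]
    (s t : ι → V) (D : ι → ℝ) (F : Finset E) : ℝ :=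
  ∑ i : ι, if N.Separates F (s i) (t i) then D i else 0

/-- The value of the maximum throughput multicommodity flow. -/
noncomputable def maxThroughput (N : DirPolyNet V E) {ι : Type} [Fintype ι]
    (s t : ι → V) : ℝ :=
  sSup { r : ℝ | ∃ f : ι → List E → ℝ, N.IsFlow s t f ∧ r = ∑ i : ι, rate f i }

/-- The value of the maximum concurrent multicommodity flow for demands `D`. -/
noncomputable def maxConcurrent (N : DirPolyNet V E) {ι : Type} [Fintype ι]
    (s t : ι → V) (D : ι → ℝ) : ℝ :=
  sSup { lam : ℝ | ∃ f : ι → List E → ℝ, N.IsFlow s t f ∧ ∀ i, rate f i = lam * D i }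

end DirPolyNet

open DirPolyNet

/-- Farkas' lemma for finitely many linear functionals on a real vector space. -/
theorem farkas_functionals {ι W : Type*} [AddCommGroup W] [Module ℝ W] (s : Finset ι) :
    ∀ (a : ι → W →ₗ[ℝ] ℝ) (b : W →ₗ[ℝ] ℝ), (∀ x, (∀ i ∈ s, a i x ≤ 0) → b x ≤ 0) →
      ∃ c : ι → ℝ, (∀ i, 0 ≤ c i) ∧ b = ∑ i ∈ s, c i • a i := by
  induction s using Finset.induction_on with
  | empty =>
    intro a b h
    refine ⟨0, fun _ => le_rfl, ?_⟩
    ext x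
    have h1 := h x (by simp)
    have h2 := h (-x) (by simp)
    simp only [map_neg] at h2
    simp only [Finset.sum_empty, LinearMap.zero_apply]
    linarith
  | insert j s hj ih =>
    intro a b h
    by_cases hs : ∀ x, (∀ i ∈ s, a i x ≤ 0) → b x ≤ 0
    · obtain ⟨c, hc, hb⟩ := ih a b hs
      refine ⟨Function.update c j 0, fun i => ?_, ?_⟩
      · by_cases hij : i = j
        · subst hij; simp
        · simp [hij, hc i]
      · rw [Finset.sum_insert hj, hb]
        simp only [Function.update_self, zero_smul, zero_add]
        refine Finset.sum_congr rfl fun i hi => ?_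
        have : i ≠ j := fun e => hj (e ▸ hi)
        simp [this]
    · push Not at hs
      obtain ⟨x₁, hx₁, hbx₁⟩ := hs
      have hpos : 0 < a j x₁ := by
        by_contra hcon
        push Not at hcon
        have := h x₁ (by
          intro i hi
          rcases Finset.mem_insert.1 hi with rfl | hi
          · exact hcon
          · exact hx₁ i hi)
        linarith
      obtain ⟨x₀, hx₀, hbx₀, hj₀⟩ : ∃ x₀, (∀ i ∈ s, a i x₀ ≤ 0) ∧ 0 < b x₀ ∧ a j x₀ = 1 := by
        refine ⟨(a j x₁)⁻¹ • x₁, fun i hi => ?_, ?_, ?_⟩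
        · simp only [map_smul, smul_eq_mul]
          exact mul_nonpos_of_nonneg_of_nonpos (by positivity) (hx₁ i hi)
        · simp only [map_smul, smul_eq_mul]; positivity
        · simp only [map_smul, smul_eq_mul]; exact inv_mul_cancel₀ hpos.ne'
      obtain ⟨c, hc, hb⟩ := ih (fun i => a i - (a i x₀) • a j) (b - (b x₀) • a j) (by
        intro y hy
        have := h (y - (a j y) • x₀) (by
          intro i hi
          rcases Finset.mem_insert.1 hi with rfl | hi
          · simp [hj₀]
          · have := hy i hi
            simp only [LinearMap.sub_apply, LinearMap.smul_apply, smul_eq_mul, map_sub,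
              map_smul] at this ⊢
            linarith)
        simp only [LinearMap.sub_apply, LinearMap.smul_apply, smul_eq_mul, map_sub,
              map_smul] at this ⊢
        linarith)
      have hcoef : 0 ≤ b x₀ - ∑ i ∈ s, c i * a i x₀ := by
        have : ∑ i ∈ s, c i * a i x₀ ≤ 0 :=
          Finset.sum_nonpos fun i hi => mul_nonpos_of_nonneg_of_nonpos (hc i) (hx₀ i hi)
        linarith
      refine ⟨Function.update c j (b x₀ - ∑ i ∈ s, c i * a i x₀), fun i => ?_, ?_⟩
      · by_cases hij : i = j
        · subst hij; simpa using hcoef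
        · simp [hij, hc i]
      · rw [Finset.sum_insert hj]
        have e : ∑ i ∈ s, Function.update c j (b x₀ - ∑ i ∈ s, c i * a i x₀) i • a i
            = ∑ i ∈ s, c i • a i := by
          refine Finset.sum_congr rfl fun i hi => ?_
          have : i ≠ j := fun e => hj (e ▸ hi)
          simp [this]
        rw [e]
        ext y
        have hy := congrArg (fun f => f y) hb
        simp only [LinearMap.sub_apply, LinearMap.smul_apply, smul_eq_mul, LinearMap.sum_apply,
          LinearMap.add_apply, Function.update_self, mul_sub, Finset.sum_sub_distrib] at hy ⊢
        have : ∑ x ∈ s, c x * (a x x₀ * a j y) = (∑ x ∈ s, c x * a x x₀) * a j y := by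
          rw [Finset.sum_mul]; exact Finset.sum_congr rfl fun _ _ => by ring
        rw [this] at hy
        linarith

/-- Linear programming duality with an attained dual solution. -/
theorem exists_dual_of_bounded {I J : Type*} [Fintype I] [Fintype J] (A : I → J → ℝ) (b : I → ℝ)
    (c : J → ℝ) (M : ℝ) (u₀ : J → ℝ) (hu₀ : ∀ j, 0 ≤ u₀ j) (hu₀b : ∀ i, ∑ j, A i j * u₀ j ≤ b i)
    (hM : ∀ u : J → ℝ, (∀ j, 0 ≤ u j) → (∀ i, ∑ j, A i j * u j ≤ b i) → ∑ j, c j * u j ≤ M) :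
    ∃ z : I → ℝ, (∀ i, 0 ≤ z i) ∧ (∀ j, c j ≤ ∑ i, z i * A i j) ∧ ∑ i, z i * b i ≤ M := by
  have hlin : ∀ w : J → ℝ, ∃ φ : ((J → ℝ) × ℝ) →ₗ[ℝ] ℝ, ∀ u t, φ (u, t) = ∑ j, w j * u j := by
    intro w
    refine ⟨(∑ j, w j • LinearMap.proj j) ∘ₗ LinearMap.fst ℝ (J → ℝ) ℝ, fun u t => ?_⟩
    simp
  choose lin hlin using hlin
  let sn : ((J → ℝ) × ℝ) →ₗ[ℝ] ℝ := LinearMap.snd ℝ (J → ℝ) ℝ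
  have hsn : ∀ u t, sn (u, t) = t := fun u t => rfl
  let a : I ⊕ J ⊕ Unit → ((J → ℝ) × ℝ) →ₗ[ℝ] ℝ := fun k =>
    match k with
    | Sum.inl i => lin (A i) - b i • sn
    | Sum.inr (Sum.inl j) => - lin (Pi.single j 1)
    | Sum.inr (Sum.inr _) => - sn
  obtain ⟨l, hl, hle⟩ := farkas_functionals Finset.univ a (lin c - M • sn) (by
    rintro ⟨u, t⟩ h
    have h1 : ∀ i, ∑ j, A i j * u j ≤ t * b i := fun i => by
      have := h (Sum.inl i) (Finset.mem_univ _)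
      simp only [a, LinearMap.sub_apply, LinearMap.smul_apply, hlin, hsn, smul_eq_mul] at this
      linarith
    have h2 : ∀ j, 0 ≤ u j := fun j => by
      have := h (Sum.inr (Sum.inl j)) (Finset.mem_univ _)
      simp only [a, LinearMap.neg_apply, hlin, Pi.single_apply, ite_mul, one_mul, zero_mul,
        Finset.sum_ite_eq', Finset.mem_univ, if_true] at this
      linarith
    have h3 : 0 ≤ t := by
      have := h (Sum.inr (Sum.inr ())) (Finset.mem_univ _)
      simp only [a, LinearMap.neg_apply, hsn] at this
      linarith
    simp only [LinearMap.sub_apply, LinearMap.smul_apply, hlin, hsn, smul_eq_mul]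
    rcases h3.eq_or_lt with h0 | hpos
    · subst h0
      by_contra hcon
      simp only [mul_zero, sub_zero, not_le] at hcon
      set g := ∑ j, c j * u j with hg
      set q := (M + 1 - ∑ j, c j * u₀ j) / g with hq
      have hq0 : 0 ≤ q := by
        have := hM u₀ hu₀ hu₀b
        apply div_nonneg _ hcon.le
        linarith
      have := hM (fun j => u₀ j + q * u j) (fun j => add_nonneg (hu₀ j) (mul_nonneg hq0 (h2 j)))
        (fun i => by
          have e : ∑ j, A i j * (u₀ j + q * u j) = ∑ j, A i j * u₀ j + q * ∑ j, A i j * u j := by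
            rw [Finset.mul_sum, ← Finset.sum_add_distrib]
            exact Finset.sum_congr rfl fun _ _ => by ring
          rw [e]
          have := h1 i
          rw [zero_mul] at this
          have := mul_nonpos_of_nonneg_of_nonpos hq0 this
          linarith [hu₀b i])
      have e : ∑ j, c j * (u₀ j + q * u j) = ∑ j, c j * u₀ j + q * g := by
        rw [hg, Finset.mul_sum, ← Finset.sum_add_distrib]
        exact Finset.sum_congr rfl fun _ _ => by ring
      rw [e, hq, div_mul_cancel₀ _ hcon.ne'] at this
      linarith
    · have := hM (fun j => u j / t) (fun j => div_nonneg (h2 j) hpos.le) (fun i => by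
        have e : ∑ j, A i j * (u j / t) = (∑ j, A i j * u j) / t := by
          rw [Finset.sum_div]; exact Finset.sum_congr rfl fun _ _ => by ring
        rw [e, div_le_iff₀ hpos]
        linarith [h1 i])
      have e : ∑ j, c j * (u j / t) = (∑ j, c j * u j) / t := by
        rw [Finset.sum_div]; exact Finset.sum_congr rfl fun _ _ => by ring
      rw [e, div_le_iff₀ hpos] at this
      linarith)
  have key : ∀ (u : J → ℝ) (t : ℝ), ∑ j, c j * u j - M * t = ∑ i, l (Sum.inl i) * (∑ j, A i j * u j - b i * t)
      + (∑ j, l (Sum.inr (Sum.inl j)) * (-u j) + l (Sum.inr (Sum.inr ())) * (-t)) := by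
    intro u t
    have := congrArg (fun f => f (u, t)) hle
    simpa [a, hlin, hsn, Fintype.sum_sum_type, LinearMap.sum_apply, Pi.single_apply] using this
  refine ⟨fun i => l (Sum.inl i), fun i => hl _, fun j => ?_, ?_⟩
  · have := key (Pi.single j 1) 0
    simp only [Pi.single_apply, mul_ite, mul_one, mul_zero, Finset.sum_ite_eq',
      Finset.mem_univ, if_true, sub_zero, neg_zero, add_zero] at this
    rw [this]
    have h2 : ∑ x, l (Sum.inr (Sum.inl x)) * -(if x = j then (1:ℝ) else 0)
        = - l (Sum.inr (Sum.inl j)) := by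
      simp
    rw [h2]
    linarith [hl (Sum.inr (Sum.inl j))]
  · have := key 0 1
    simp only [Pi.zero_apply, mul_zero, Finset.sum_const_zero, mul_one, zero_sub, neg_zero,
      mul_neg, Finset.sum_neg_distrib, zero_add] at this
    linarith [hl (Sum.inr (Sum.inr ()))]

/-- Normalised monotone submodular set functions. -/
structure IsPolymatroid {H : Type*} (c : Finset H → ℝ) : Prop where
  empty : c ∅ = 0
  mono : ∀ A B, A ⊆ B → c A ≤ c B
  submod : ∀ A B, c (A ∪ B) + c (A ∩ B) ≤ c A + c B

theorem IsPolymatroid.nonneg {H : Type*} {c : Finset H → ℝ} (hc : IsPolymatroid c) (A : Finset H) :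
    0 ≤ c A := by
  have := hc.mono ∅ A (Finset.empty_subset _)
  rwa [hc.empty] at this

theorem IsPolymatroid.union_le {H : Type*} {c : Finset H → ℝ} (hc : IsPolymatroid c)
    (A B : Finset H) : c (A ∪ B) ≤ c A + c B := by
  linarith [hc.submod A B, hc.nonneg (A ∩ B)]

theorem IsPolymatroid.inter_right {H : Type*} {c : Finset H → ℝ} (hc : IsPolymatroid c)
    (S : Finset H) : IsPolymatroid fun A => c (S ∩ A) where
  empty := by simp [hc.empty]
  mono A B h := hc.mono _ _ (Finset.inter_subset_inter_left h)
  submod A B := by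
    have := hc.submod (S ∩ A) (S ∩ B)
    rwa [← Finset.inter_union_distrib_left, ← Finset.inter_inter_distrib_left] at this

theorem IsPolymatroid.sum {H B : Type*} (s : Finset B) {c : B → Finset H → ℝ}
    (hc : ∀ b ∈ s, IsPolymatroid (c b)) : IsPolymatroid fun A => ∑ b ∈ s, c b A where
  empty := Finset.sum_eq_zero fun b hb => (hc b hb).empty
  mono A B h := Finset.sum_le_sum fun b hb => (hc b hb).mono A B h
  submod A B := by
    rw [← Finset.sum_add_distrib, ← Finset.sum_add_distrib]
    exact Finset.sum_le_sum fun b hb => (hc b hb).submod A B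

section Lov
variable {H : Type*} [Fintype H]

/-- Superlevel sets of a function on a finite type. -/
noncomputable def lev (y : H → ℝ) (θ : ℝ) : Finset H := Finset.univ.filter fun h => θ ≤ y h

theorem mem_lev {y : H → ℝ} {θ : ℝ} {h : H} : h ∈ lev y θ ↔ θ ≤ y h := by simp [lev]

theorem lev_anti (y : H → ℝ) {θ θ' : ℝ} (h : θ ≤ θ') : lev y θ' ⊆ lev y θ := fun _ ha =>
  mem_lev.2 (h.trans (mem_lev.1 ha))

theorem lev_mono {y y' : H → ℝ} (h : ∀ a, y a ≤ y' a) (θ : ℝ) : lev y θ ⊆ lev y' θ := fun a ha =>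
  mem_lev.2 ((mem_lev.1 ha).trans (h a))

theorem lev_eq_empty {y : H → ℝ} {θ : ℝ} (h : ∀ a, y a < θ) : lev y θ = ∅ := by
  ext b; simp [mem_lev, h b]

theorem lev_eq_univ {y : H → ℝ} {θ : ℝ} (h : ∀ a, θ ≤ y a) : lev y θ = Finset.univ := by
  ext a; simp [mem_lev, h a]

theorem antitone_lev {c : Finset H → ℝ} (hc : IsPolymatroid c) (y : H → ℝ) :
    Antitone fun θ => c (lev y θ) := fun _ _ h => hc.mono _ _ (lev_anti y h)

/-- The Lovász extension of a set function, by the layer-cake formula. -/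
noncomputable def lov (c : Finset H → ℝ) (y : H → ℝ) : ℝ :=
  ∫ θ in (0 : ℝ)..(∑ h, |y h|), c (lev y θ)

theorem le_sum_abs (y : H → ℝ) (h : H) : y h ≤ ∑ h, |y h| :=
  (le_abs_self _).trans
    (Finset.single_le_sum (f := fun h => |y h|) (fun _ _ => abs_nonneg _) (Finset.mem_univ h))

theorem integral_lev_tail {c : Finset H → ℝ} (hc : IsPolymatroid c) {y : H → ℝ} {T T' : ℝ}
    (hT : ∀ h, y h ≤ T) (hTT : T ≤ T') : ∫ θ in T..T', c (lev y θ) = 0 := by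
  rw [intervalIntegral.integral_of_le hTT]
  refine MeasureTheory.setIntegral_eq_zero_of_forall_eq_zero fun θ hθ => ?_
  rw [lev_eq_empty fun a => (hT a).trans_lt hθ.1, hc.empty]

theorem intervalIntegrable_lev {c : Finset H → ℝ} (hc : IsPolymatroid c) (y : H → ℝ) (a b : ℝ) :
    IntervalIntegrable (fun θ => c (lev y θ)) volume a b :=
  (antitone_lev hc y).intervalIntegrable

theorem lov_eq {c : Finset H → ℝ} (hc : IsPolymatroid c) {y : H → ℝ} {T : ℝ}
    (hT : ∀ h, y h ≤ T) : lov c y = ∫ θ in (0 : ℝ)..T, c (lev y θ) := by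
  unfold lov
  set S := ∑ h, |y h|
  have hS : ∀ h, y h ≤ S := le_sum_abs y
  rcases le_total T S with h | h
  · rw [← intervalIntegral.integral_add_adjacent_intervals (intervalIntegrable_lev hc y 0 T)
      (intervalIntegrable_lev hc y T S), integral_lev_tail hc hT h, add_zero]
  · rw [← intervalIntegral.integral_add_adjacent_intervals (intervalIntegrable_lev hc y 0 S)
      (intervalIntegrable_lev hc y S T), integral_lev_tail hc hS h, add_zero]

theorem integral_lev_le_lov {c : Finset H → ℝ} (hc : IsPolymatroid c) (y : H → ℝ) (T : ℝ)
    : ∫ θ in (0 : ℝ)..T, c (lev y θ) ≤ lov c y := by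
  rw [lov_eq hc (T := max T (∑ h, |y h|)) fun h => (le_sum_abs y h).trans (le_max_right _ _),
    ← intervalIntegral.integral_add_adjacent_intervals (intervalIntegrable_lev hc y 0 T)
      (intervalIntegrable_lev hc y T (max T (∑ h, |y h|)))]
  have := intervalIntegral.integral_nonneg (le_max_left T (∑ h, |y h|))
    (f := fun θ => c (lev y θ)) (μ := volume) fun _ _ => hc.nonneg _
  linarith

theorem lov_nonneg {c : Finset H → ℝ} (hc : IsPolymatroid c) (y : H → ℝ) : 0 ≤ lov c y :=
  intervalIntegral.integral_nonneg (Finset.sum_nonneg fun _ _ => abs_nonneg _)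
    fun _ _ => hc.nonneg _

theorem lov_mono {c : Finset H → ℝ} (hc : IsPolymatroid c) {y y' : H → ℝ}
    (h : ∀ a, y a ≤ y' a) : lov c y ≤ lov c y' := by
  have h0 : (0:ℝ) ≤ ∑ h, |y h| := Finset.sum_nonneg fun _ _ => abs_nonneg _
  refine le_trans ?_ (integral_lev_le_lov hc y' (∑ h, |y h|))
  exact intervalIntegral.integral_mono_on h0 (intervalIntegrable_lev hc y _ _)
    (intervalIntegrable_lev hc y' _ _) fun θ _ => hc.mono _ _ (lev_mono h θ)

theorem mul_lev_le_lov {c : Finset H → ℝ} (hc : IsPolymatroid c) (y : H → ℝ) {τ : ℝ}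
    (hτ : 0 ≤ τ) : τ * c (lev y τ) ≤ lov c y := by
  refine le_trans ?_ (integral_lev_le_lov hc y τ)
  have := intervalIntegral.integral_mono_on hτ (f := fun _ => c (lev y τ))
    intervalIntegrable_const (intervalIntegrable_lev hc y 0 τ)
    fun θ hθ => hc.mono _ _ (lev_anti y hθ.2)
  simpa using this

theorem lov_zero {c : Finset H → ℝ} : lov c 0 = 0 := by
  simp [lov]

theorem lov_sum {B : Type*} (s : Finset B) {c : B → Finset H → ℝ}
    (hc : ∀ b ∈ s, IsPolymatroid (c b)) (y : H → ℝ) :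
    lov (fun A => ∑ b ∈ s, c b A) y = ∑ b ∈ s, lov (c b) y := by
  unfold lov
  rw [intervalIntegral.integral_finsetSum]
  exact fun b hb => intervalIntegrable_lev (hc b hb) y _ _

theorem lov_smul {c : Finset H → ℝ} (y : H → ℝ) {a : ℝ} (ha : 0 < a) :
    lov c (fun h => a * y h) = a * lov c y := by
  unfold lov
  have e : ∑ h, |a * y h| = a * ∑ h, |y h| := by
    rw [Finset.mul_sum]; exact Finset.sum_congr rfl fun h _ => by rw [abs_mul, abs_of_pos ha]
  have e2 : ∀ θ, lev (fun h => a * y h) θ = lev y (θ / a) := fun θ => by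
    ext h; simp only [mem_lev]; rw [div_le_iff₀ ha, mul_comm]
  simp only [e, e2]
  rw [intervalIntegral.integral_comp_div (fun θ => c (lev y θ)) ha.ne']
  simp [ha.ne']

theorem integral_indicator_le (b : ℝ) {T : ℝ} (hb : 0 ≤ b) (hT : b ≤ T) :
    ∫ θ in (0 : ℝ)..T, (if θ ≤ b then (1:ℝ) else 0) = b := by
  have hi : ∀ p q : ℝ, IntervalIntegrable (fun θ => if θ ≤ b then (1:ℝ) else 0) volume p q := by
    intro p q
    refine Antitone.intervalIntegrable fun x y hxy => ?_
    split_ifs <;> linarith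
  rw [← intervalIntegral.integral_add_adjacent_intervals (hi 0 b) (hi b T)]
  rw [intervalIntegral.integral_of_le hb, intervalIntegral.integral_of_le hT]
  rw [MeasureTheory.setIntegral_congr_fun measurableSet_Ioc (g := fun _ => (1:ℝ))
      (fun θ hθ => if_pos hθ.2),
    MeasureTheory.setIntegral_eq_zero_of_forall_eq_zero fun θ hθ => if_neg (not_le.2 hθ.1)]
  simp [hb]

theorem intervalIntegrable_indicator_le (b p q : ℝ) :
    IntervalIntegrable (fun θ => if θ ≤ b then (1:ℝ) else 0) volume p q := by
  refine Antitone.intervalIntegrable fun x y hxy => ?_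
  split_ifs <;> linarith

/-- Vectors dominated by a polymatroid are dominated by its Lovász extension. -/
theorem sum_mul_le_lov {c : Finset H → ℝ} (hc : IsPolymatroid c) {g y : H → ℝ}
    (hg : ∀ S, ∑ h ∈ S, g h ≤ c S) (hy : ∀ h, 0 ≤ y h) : ∑ h, g h * y h ≤ lov c y := by
  have h1 : ∑ h, g h * y h = ∫ θ in (0 : ℝ)..(∑ h, |y h|), ∑ h ∈ lev y θ, g h := by
    have e : ∀ θ, ∑ h ∈ lev y θ, g h = ∑ h, g h * (if θ ≤ y h then (1:ℝ) else 0) := fun θ => by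
      simp [lev, Finset.sum_filter]
    simp only [e]
    rw [intervalIntegral.integral_finsetSum]
    · refine Finset.sum_congr rfl fun h _ => ?_
      rw [intervalIntegral.integral_const_mul, integral_indicator_le _ (hy h) (le_sum_abs y h)]
    · exact fun h _ => (intervalIntegrable_indicator_le _ _ _).const_mul _
  rw [h1]
  refine intervalIntegral.integral_mono_on (Finset.sum_nonneg fun _ _ => abs_nonneg _) ?_
    (intervalIntegrable_lev hc y _ _) fun θ _ => hg _
  have e : (fun θ => ∑ h ∈ lev y θ, g h)
      = fun θ => ∑ h, g h * (if θ ≤ y h then (1:ℝ) else 0) := by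
    funext θ; simp [lev, Finset.sum_filter]
  rw [e]
  have h2 := IntervalIntegrable.sum Finset.univ
    (fun h _ => (intervalIntegrable_indicator_le (y h) 0 (∑ h, |y h|)).const_mul (g h))
  have e3 : (fun θ => ∑ h, g h * (if θ ≤ y h then (1:ℝ) else 0))
      = ∑ h, fun θ => g h * (if θ ≤ y h then (1:ℝ) else 0) := by
    funext θ
    rw [Finset.sum_apply]
  rw [e3]
  exact h2

theorem lov_add_indicator_le {c : Finset H → ℝ} (hc : IsPolymatroid c) {y : H → ℝ}
    (hy : ∀ h, 0 ≤ y h) {t : ℝ} (ht : 0 ≤ t) (S : Finset H) :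
    lov c (fun h => y h + t * (if h ∈ S then 1 else 0)) ≤ lov c y + t * c S := by
  set y' : H → ℝ := fun h => y h + t * (if h ∈ S then 1 else 0) with hy'
  set T := (∑ h, |y h|) + t with hT
  have hT0 : 0 ≤ T := add_nonneg (Finset.sum_nonneg fun _ _ => abs_nonneg _) ht
  have hyT : ∀ h, y h ≤ T := fun h => (le_sum_abs y h).trans (by linarith)
  have hy'T : ∀ h, y' h ≤ T := fun h => by
    have := le_sum_abs y h
    simp only [hy', hT]
    split_ifs <;> simp <;> linarith
  rw [lov_eq hc hy'T, lov_eq hc hyT]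
  have hψ := hc.inter_right S
  set ψ : ℝ → ℝ := fun θ => c (S ∩ lev y θ) with hψd
  have hψi : ∀ a b, IntervalIntegrable ψ volume a b := fun a b => intervalIntegrable_lev hψ y a b
  have hψi' : IntervalIntegrable (fun θ => ψ (θ - t)) volume 0 T := by
    refine Antitone.intervalIntegrable fun a b hab => ?_
    exact antitone_lev hψ y (by linarith)
  have key : ∀ θ, c (lev y' θ) ≤ c (lev y θ) + (ψ (θ - t) - ψ θ) := by
    intro θ
    have e1 : lev y' θ = lev y θ ∪ (S ∩ lev y (θ - t)) := by
      ext h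
      simp only [mem_lev, Finset.mem_union, Finset.mem_inter, hy']
      by_cases hS : h ∈ S
      · simp only [hS, if_true, mul_one, true_and]
        constructor
        · intro h1; right; linarith
        · rintro (h1 | h1) <;> linarith
      · simp [hS]
    have e2 : lev y θ ∩ (S ∩ lev y (θ - t)) = S ∩ lev y θ := by
      ext h
      simp only [mem_lev, Finset.mem_inter]
      constructor
      · rintro ⟨h1, h2, h3⟩; exact ⟨h2, h1⟩
      · rintro ⟨h1, h2⟩; exact ⟨h2, h1, by linarith⟩
    have := hc.submod (lev y θ) (S ∩ lev y (θ - t))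
    rw [← e1, e2] at this
    simp only [hψd]
    linarith
  have h1 := intervalIntegral.integral_mono_on hT0 (intervalIntegrable_lev hc y' 0 T)
    ((intervalIntegrable_lev hc y 0 T).add (hψi'.sub (hψi 0 T))) fun θ _ => key θ
  refine h1.trans ?_
  rw [intervalIntegral.integral_add (intervalIntegrable_lev hc y 0 T) (hψi'.sub (hψi 0 T)),
    intervalIntegral.integral_sub hψi' (hψi 0 T),
    intervalIntegral.integral_comp_sub_right ψ t, zero_sub]
  have h2 : ∫ θ in (-t)..(T - t), ψ θ = (∫ θ in (-t)..0, ψ θ) + ∫ θ in (0:ℝ)..(T-t), ψ θ :=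
    (intervalIntegral.integral_add_adjacent_intervals (hψi _ _) (hψi _ _)).symm
  have h3 : ∫ θ in (0:ℝ)..(T-t), ψ θ ≤ ∫ θ in (0:ℝ)..T, ψ θ := by
    rw [← intervalIntegral.integral_add_adjacent_intervals (hψi 0 (T-t)) (hψi (T-t) T)]
    have := intervalIntegral.integral_nonneg (show T - t ≤ T by linarith)
      (f := ψ) (μ := volume) fun _ _ => hc.nonneg _
    linarith
  have h4 : ∫ θ in (-t)..0, ψ θ = t * c S := by
    rw [intervalIntegral.integral_of_le (by linarith),
      MeasureTheory.setIntegral_congr_fun measurableSet_Ioc (g := fun _ => c S) (fun θ hθ => by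
        simp only [hψd]
        rw [lev_eq_univ fun a => hθ.2.trans (hy a), Finset.inter_univ])]
    simp [ht]
  linarith

/-- The Lovász extension is at most the cost of any conic decomposition into indicators. -/
theorem lov_sum_indicator_le {c : Finset H → ℝ} (hc : IsPolymatroid c) {z : Finset H → ℝ}
    (hz : ∀ S, 0 ≤ z S) (s : Finset (Finset H)) :
    lov c (fun h => ∑ S ∈ s, z S * (if h ∈ S then 1 else 0)) ≤ ∑ S ∈ s, z S * c S := by
  induction s using Finset.induction_on with
  | empty =>
    simp only [Finset.sum_empty]
    exact (lov_zero (c := c)).le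
  | insert S s hS ih =>
    rw [Finset.sum_insert hS]
    have := lov_add_indicator_le hc (y := fun h => ∑ S ∈ s, z S * (if h ∈ S then 1 else 0))
      (fun h => Finset.sum_nonneg fun S _ => mul_nonneg (hz S) (by split_ifs <;> norm_num)) (hz S) S
    simp only [Finset.sum_insert hS]
    refine le_trans (le_of_eq ?_) (this.trans (by linarith))
    congr 1; funext h; ring

end Lov

/-- A record of finitely many rounds `k : K` of routing: each round has a potential `pot k`, a
relation `alive k`, a value `val k` and finitely many weighted profiles `ψ q` on the blocks. -/
structure ThinSystem (B K Q : Type*) [Fintype B] [Fintype K] [Fintype Q] where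
  w : B → ℝ
  reach : B → B → Prop
  pot : K → B → ℝ
  alive : K → B → B → Prop
  val : K → ℝ
  rd : Q → K
  f : Q → ℝ
  ψ : Q → B → ℝ
  ε : ℝ
  h : ℝ
  A : ℝ
  Θ : ℝ
  L : ℝ
  ε_pos : 0 < ε
  h_pos : 0 < h
  one_le_A : 1 ≤ A
  Θ_pos : 0 < Θ
  L_pos : 0 < L
  w_nonneg : ∀ a, 0 ≤ w a
  w_sum : ∑ a, w a ≤ 1
  reach_trans : ∀ a b c, reach a b → reach b c → reach a c
  alive_reach : ∀ k a b, alive k a b → reach a b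
  val_nonneg : ∀ k, 0 ≤ val k
  f_nonneg : ∀ q, 0 ≤ f q
  ψ_nonneg : ∀ q a, 0 ≤ ψ q a
  ordered : ∀ q a b, 0 < ψ q a → 0 < ψ q b → ε < pot (rd q) b - pot (rd q) a →
    alive (rd q) a b
  window : ∀ q x τ, 0 ≤ τ →
    ∑ a, (if x ≤ pot (rd q) a ∧ pot (rd q) a ≤ x + τ then ψ q a else 0) ≤ τ + 3 * ε
  ψ_sum : ∀ q, ∑ a, ψ q a ≤ 1
  load : ∀ k a, ∑ q, (if rd q = k then f q * ψ q a else 0) ≤ h * w a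
  mass : (∑ k, val k) / 2 ≤ ∑ q, f q * ∑ a, ψ q a
  flow : ∑ q, f q ≤ 3 * A * ∑ k, val k
  thin : ∀ k, ∑ a, ∑ b, (if reach a b then w a * w b * max (pot k b - pot k a) 0 else 0)
    ≤ 2 * Θ * val k
  life : ∀ a b, ∑ k, (if alive k a b then max (pot k b - pot k a) 0 else 0) ≤ L

namespace ThinSystem
variable {B K Q : Type*} [Fintype B] [Fintype K] [Fintype Q] (S : ThinSystem B K Q)

theorem A_pos : 0 < S.A := lt_of_lt_of_le one_pos S.one_le_A

theorem ψ_le (q : Q) (a : B) : S.ψ q a ≤ 3 * S.ε := by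
  have h1 := S.window q (S.pot (S.rd q) a) 0 le_rfl
  have h2 : S.ψ q a ≤ ∑ b, (if S.pot (S.rd q) a ≤ S.pot (S.rd q) b ∧
      S.pot (S.rd q) b ≤ S.pot (S.rd q) a + 0 then S.ψ q b else 0) := by
    refine le_trans ?_ (Finset.single_le_sum (f := fun b => if S.pot (S.rd q) a ≤ S.pot (S.rd q) b ∧
      S.pot (S.rd q) b ≤ S.pot (S.rd q) a + 0 then S.ψ q b else 0) (fun b _ => ?_)
      (Finset.mem_univ a))
    · simp
    · split_ifs
      · exact S.ψ_nonneg q b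
      · exact le_rfl
  linarith

theorem sum_rounds_le (a b c : B) {η : ℝ} (hη : S.ε < η) :
    ∑ q, (if S.alive (S.rd q) a b ∧ η ≤ S.pot (S.rd q) b - S.pot (S.rd q) a then
      S.f q * S.ψ q c else 0) ≤ S.h * S.w c * (S.L / η) := by
  have hη0 : 0 < η := S.ε_pos.trans hη
  have hw : 0 ≤ S.h * S.w c := mul_nonneg S.h_pos.le (S.w_nonneg c)
  calc ∑ q, (if S.alive (S.rd q) a b ∧ η ≤ S.pot (S.rd q) b - S.pot (S.rd q) a then
      S.f q * S.ψ q c else 0)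
      = ∑ q, ∑ k, (if S.alive k a b ∧ η ≤ S.pot k b - S.pot k a then
          (if S.rd q = k then S.f q * S.ψ q c else 0) else 0) := by
        refine Finset.sum_congr rfl fun q _ => ?_
        rw [Finset.sum_eq_single (S.rd q)]
        · simp
        · intro k _ hk
          simp [hk.symm]
        · simp
    _ = ∑ k, (if S.alive k a b ∧ η ≤ S.pot k b - S.pot k a then
          (∑ q, if S.rd q = k then S.f q * S.ψ q c else 0) else 0) := by
        rw [Finset.sum_comm]
        refine Finset.sum_congr rfl fun k _ => ?_
        split_ifs <;> simp
    _ ≤ ∑ k, (S.h * S.w c / η) * (if S.alive k a b then max (S.pot k b - S.pot k a) 0 else 0) := by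
        refine Finset.sum_le_sum fun k _ => ?_
        by_cases hal : S.alive k a b
        · by_cases hg : η ≤ S.pot k b - S.pot k a
          · simp only [hal, hg, and_self, if_true]
            refine (S.load k c).trans ?_
            rw [div_mul_eq_mul_div, le_div_iff₀ hη0]
            exact mul_le_mul_of_nonneg_left (hg.trans (le_max_left _ _)) hw
          · simp only [hal, hg, and_false, if_true, if_false]
            exact mul_nonneg (div_nonneg hw hη0.le) (le_max_right _ _)
        · simp [hal]
    _ ≤ S.h * S.w c * (S.L / η) := by
        rw [← Finset.mul_sum]
        refine (mul_le_mul_of_nonneg_left (S.life a b) (div_nonneg hw hη0.le)).trans (le_of_eq ?_)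
        ring

theorem sum_far_le (a b : B) {η : ℝ} (hη : S.ε < η) :
    ∑ q, (if η ≤ S.pot (S.rd q) b - S.pot (S.rd q) a then
      S.f q * S.ψ q a * S.ψ q b else 0) ≤ 3 * S.ε * S.h * (S.L / η) * min (S.w a) (S.w b) := by
  have hη0 : 0 < η := S.ε_pos.trans hη
  have main : ∀ c, (c = a ∨ c = b) → ∑ q, (if η ≤ S.pot (S.rd q) b - S.pot (S.rd q) a then
      S.f q * S.ψ q a * S.ψ q b else 0) ≤ 3 * S.ε * S.h * (S.L / η) * S.w c := by
    intro c hc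
    calc _ ≤ ∑ q, 3 * S.ε * (if S.alive (S.rd q) a b ∧ η ≤ S.pot (S.rd q) b - S.pot (S.rd q) a then
      S.f q * S.ψ q c else 0) := by
          refine Finset.sum_le_sum fun q _ => ?_
          by_cases hg : η ≤ S.pot (S.rd q) b - S.pot (S.rd q) a
          · by_cases ha : 0 < S.ψ q a
            · by_cases hb : 0 < S.ψ q b
              · have hal := S.ordered q a b ha hb (hη.trans_le hg)
                simp only [hg, hal, and_self, if_true]
                have hf := S.f_nonneg q
                rcases hc with rfl | rfl
                · have := mul_le_mul_of_nonneg_left (S.ψ_le q b) (mul_nonneg hf ha.le)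
                  linarith
                · have := mul_le_mul_of_nonneg_left (S.ψ_le q a) (mul_nonneg hf hb.le)
                  linarith
              · have : S.ψ q b = 0 := le_antisymm (not_lt.1 hb) (S.ψ_nonneg q b)
                simp only [this, mul_zero, ite_self]
                refine mul_nonneg (by linarith [S.ε_pos]) ?_
                split_ifs
                · exact mul_nonneg (S.f_nonneg q) (S.ψ_nonneg q c)
                · exact le_rfl
            · have : S.ψ q a = 0 := le_antisymm (not_lt.1 ha) (S.ψ_nonneg q a)
              simp only [this, mul_zero, zero_mul, ite_self]
              refine mul_nonneg (by linarith [S.ε_pos]) ?_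
              split_ifs
              · exact mul_nonneg (S.f_nonneg q) (S.ψ_nonneg q c)
              · exact le_rfl
          · simp [hg]
      _ ≤ _ := by
          rw [← Finset.mul_sum]
          refine (mul_le_mul_of_nonneg_left (S.sum_rounds_le a b c hη)
            (by linarith [S.ε_pos])).trans (le_of_eq ?_)
          ring
  rcases le_total (S.w a) (S.w b) with h | h
  · rw [min_eq_left h]; exact main a (Or.inl rfl)
  · rw [min_eq_right h]; exact main b (Or.inr rfl)

/-- The threshold separating the middle part of a profile from its two ends. -/
noncomputable def ζ : ℝ := 1 / (128 * S.A)

theorem ζ_pos : 0 < S.ζ := by have := S.A_pos; unfold ζ; positivity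

noncomputable def lowMass (q : Q) (a : B) : ℝ :=
  ∑ b, if S.pot (S.rd q) b ≤ S.pot (S.rd q) a - S.ζ then S.ψ q b else 0

noncomputable def highMass (q : Q) (a : B) : ℝ :=
  ∑ b, if S.pot (S.rd q) a + S.ζ ≤ S.pot (S.rd q) b then S.ψ q b else 0

/-- Blocks in the support of a profile with enough mass far below and far above. -/
def Mid (q : Q) (a : B) : Prop := 0 < S.ψ q a ∧ S.ζ ≤ S.lowMass q a ∧ S.ζ ≤ S.highMass q a

theorem sum_lowMass_lt (q : Q) :
    ∑ a, (if S.lowMass q a < S.ζ then S.ψ q a else 0) ≤ 2 * S.ζ + 3 * S.ε := by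
  by_cases hne : (Finset.univ.filter fun a => S.lowMass q a < S.ζ).Nonempty
  · obtain ⟨m, hm, hmax⟩ := Finset.exists_max_image _ (S.pot (S.rd q)) hne
    simp only [Finset.mem_filter, Finset.mem_univ, true_and] at hm hmax
    have hw := S.window q (S.pot (S.rd q) m - S.ζ) S.ζ S.ζ_pos.le
    have : ∑ a, (if S.lowMass q a < S.ζ then S.ψ q a else 0) ≤ S.lowMass q m +
        ∑ a, (if S.pot (S.rd q) m - S.ζ ≤ S.pot (S.rd q) a ∧
          S.pot (S.rd q) a ≤ S.pot (S.rd q) m - S.ζ + S.ζ then S.ψ q a else 0) := by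
      rw [lowMass, ← Finset.sum_add_distrib]
      refine Finset.sum_le_sum fun a _ => ?_
      have hψ := S.ψ_nonneg q a
      by_cases ha : S.lowMass q a < S.ζ
      · have h1 := hmax a ha
        rcases le_total (S.pot (S.rd q) a) (S.pot (S.rd q) m - S.ζ) with h2 | h2
        · simp only [ha, h2, if_true]
          split_ifs <;> linarith
        · have h3 : S.pot (S.rd q) a ≤ S.pot (S.rd q) m - S.ζ + S.ζ := by linarith
          simp only [ha, h2, h3, and_self, if_true]
          split_ifs <;> linarith
      · simp only [ha, if_false]
        split_ifs <;> linarith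
    linarith
  · rw [Finset.not_nonempty_iff_eq_empty, Finset.filter_eq_empty_iff] at hne
    rw [Finset.sum_eq_zero fun a ha => if_neg (hne ha)]
    linarith [S.ζ_pos, S.ε_pos]

theorem sum_highMass_lt (q : Q) :
    ∑ a, (if S.highMass q a < S.ζ then S.ψ q a else 0) ≤ 2 * S.ζ + 3 * S.ε := by
  by_cases hne : (Finset.univ.filter fun a => S.highMass q a < S.ζ).Nonempty
  · obtain ⟨m, hm, hmin⟩ := Finset.exists_min_image _ (S.pot (S.rd q)) hne
    simp only [Finset.mem_filter, Finset.mem_univ, true_and] at hm hmin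
    have hw := S.window q (S.pot (S.rd q) m) S.ζ S.ζ_pos.le
    have : ∑ a, (if S.highMass q a < S.ζ then S.ψ q a else 0) ≤ S.highMass q m +
        ∑ a, (if S.pot (S.rd q) m ≤ S.pot (S.rd q) a ∧
          S.pot (S.rd q) a ≤ S.pot (S.rd q) m + S.ζ then S.ψ q a else 0) := by
      rw [highMass, ← Finset.sum_add_distrib]
      refine Finset.sum_le_sum fun a _ => ?_
      have hψ := S.ψ_nonneg q a
      by_cases ha : S.highMass q a < S.ζ
      · have h1 := hmin a ha
        rcases le_total (S.pot (S.rd q) m + S.ζ) (S.pot (S.rd q) a) with h2 | h2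
        · simp only [ha, h2, if_true]
          split_ifs <;> linarith
        · simp only [ha, h1, h2, and_self, if_true]
          split_ifs <;> linarith
      · simp only [ha, if_false]
        split_ifs <;> linarith
    linarith
  · rw [Finset.not_nonempty_iff_eq_empty, Finset.filter_eq_empty_iff] at hne
    rw [Finset.sum_eq_zero fun a ha => if_neg (hne ha)]
    linarith [S.ζ_pos, S.ε_pos]

theorem sum_le_sum_mid (q : Q) :
    ∑ a, S.ψ q a ≤ ∑ a, (if S.Mid q a then S.ψ q a else 0) + (4 * S.ζ + 6 * S.ε) := by
  have : ∑ a, S.ψ q a ≤ ∑ a, (if S.Mid q a then S.ψ q a else 0) +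
      (∑ a, (if S.lowMass q a < S.ζ then S.ψ q a else 0) +
       ∑ a, (if S.highMass q a < S.ζ then S.ψ q a else 0)) := by
    rw [← Finset.sum_add_distrib, ← Finset.sum_add_distrib]
    refine Finset.sum_le_sum fun a _ => ?_
    have hψ := S.ψ_nonneg q a
    by_cases h1 : S.lowMass q a < S.ζ
    · simp only [h1, if_true]; split_ifs <;> linarith
    · by_cases h2 : S.highMass q a < S.ζ
      · simp only [h2, if_true]; split_ifs <;> linarith
      · rcases hψ.eq_or_lt with h0 | h0
        · simp [← h0]
        · have : S.Mid q a := ⟨h0, not_lt.1 h1, not_lt.1 h2⟩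
          simp [this, h1, h2]
  linarith [S.sum_lowMass_lt q, S.sum_highMass_lt q]

/-- Blocks lying between two middle blocks of a profile. -/
def Btw (q : Q) (v : B) : Prop :=
  ∃ a b, S.Mid q a ∧ S.Mid q b ∧ S.pot (S.rd q) a ≤ S.pot (S.rd q) b ∧ S.reach a v ∧ S.reach v b

noncomputable def btwWeight (q : Q) : ℝ := ∑ v, if S.Btw q v then S.w v else 0

theorem btw_stretch (hεζ : S.ε < S.ζ) {q : Q} {v : B} (hv : S.Btw q v) :
    S.ζ * S.ζ ≤ ∑ a, (if S.reach a v then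
        S.ψ q a * max (S.pot (S.rd q) v - S.pot (S.rd q) a) 0 else 0) +
      ∑ b, (if S.reach v b then
        S.ψ q b * max (S.pot (S.rd q) b - S.pot (S.rd q) v) 0 else 0) := by
  obtain ⟨a, b, ha, hb, hab, hav, hvb⟩ := hv
  have hζ := S.ζ_pos
  have n1 : 0 ≤ ∑ a, (if S.reach a v then
        S.ψ q a * max (S.pot (S.rd q) v - S.pot (S.rd q) a) 0 else 0) :=
    Finset.sum_nonneg fun c _ => by
      split_ifs
      · exact mul_nonneg (S.ψ_nonneg q c) (le_max_right _ _)
      · exact le_rfl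
  have n2 : 0 ≤ ∑ b, (if S.reach v b then
        S.ψ q b * max (S.pot (S.rd q) b - S.pot (S.rd q) v) 0 else 0) :=
    Finset.sum_nonneg fun c _ => by
      split_ifs
      · exact mul_nonneg (S.ψ_nonneg q c) (le_max_right _ _)
      · exact le_rfl
  rcases le_total (S.pot (S.rd q) a) (S.pot (S.rd q) v) with hle | hle
  · have : S.ζ * S.lowMass q a ≤ ∑ a, (if S.reach a v then
        S.ψ q a * max (S.pot (S.rd q) v - S.pot (S.rd q) a) 0 else 0) := by
      rw [lowMass, Finset.mul_sum]
      refine Finset.sum_le_sum fun c _ => ?_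
      by_cases hc : S.pot (S.rd q) c ≤ S.pot (S.rd q) a - S.ζ
      · rcases (S.ψ_nonneg q c).eq_or_lt with h0 | h0
        · simp [← h0]
        · have hca := S.alive_reach _ _ _ (S.ordered q c a h0 ha.1 (by linarith))
          have hcv := S.reach_trans _ _ _ hca hav
          simp only [hc, hcv, if_true]
          rw [mul_comm]
          refine mul_le_mul_of_nonneg_left (le_trans ?_ (le_max_left _ _)) h0.le
          linarith
      · simp only [hc, if_false, mul_zero]
        split_ifs
        · exact mul_nonneg (S.ψ_nonneg q c) (le_max_right _ _)
        · exact le_rfl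
    have := mul_le_mul_of_nonneg_left ha.2.1 hζ.le
    linarith
  · have : S.ζ * S.highMass q b ≤ ∑ b, (if S.reach v b then
        S.ψ q b * max (S.pot (S.rd q) b - S.pot (S.rd q) v) 0 else 0) := by
      rw [highMass, Finset.mul_sum]
      refine Finset.sum_le_sum fun c _ => ?_
      by_cases hc : S.pot (S.rd q) b + S.ζ ≤ S.pot (S.rd q) c
      · rcases (S.ψ_nonneg q c).eq_or_lt with h0 | h0
        · simp [← h0]
        · have hbc := S.alive_reach _ _ _ (S.ordered q b c hb.1 h0 (by linarith))
          have hvc := S.reach_trans _ _ _ hvb hbc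
          simp only [hc, hvc, if_true]
          rw [mul_comm]
          refine mul_le_mul_of_nonneg_left (le_trans ?_ (le_max_left _ _)) h0.le
          linarith
      · simp only [hc, if_false, mul_zero]
        split_ifs
        · exact mul_nonneg (S.ψ_nonneg q c) (le_max_right _ _)
        · exact le_rfl
    have := mul_le_mul_of_nonneg_left hb.2.2 hζ.le
    linarith

theorem sum_load_mul_le (g : K → B → ℝ) (hg : ∀ k a, 0 ≤ g k a) :
    ∑ q, S.f q * ∑ a, S.ψ q a * g (S.rd q) a ≤ S.h * ∑ k, ∑ a, S.w a * g k a := by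
  calc ∑ q, S.f q * ∑ a, S.ψ q a * g (S.rd q) a
      = ∑ k, ∑ a, (∑ q, if S.rd q = k then S.f q * S.ψ q a else 0) * g k a := by
        have e : ∀ q, S.f q * ∑ a, S.ψ q a * g (S.rd q) a
            = ∑ k, ∑ a, (if S.rd q = k then S.f q * S.ψ q a else 0) * g k a := by
          intro q
          rw [Finset.sum_eq_single (S.rd q)]
          · simp [Finset.mul_sum, mul_assoc]
          · intro k _ hk
            simp [hk.symm]
          · simp
        simp only [e, Finset.sum_mul]
        rw [Finset.sum_comm]
        refine Finset.sum_congr rfl fun k _ => ?_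
        rw [Finset.sum_comm]
    _ ≤ ∑ k, ∑ a, (S.h * S.w a) * g k a :=
        Finset.sum_le_sum fun k _ => Finset.sum_le_sum fun a _ =>
          mul_le_mul_of_nonneg_right (S.load k a) (hg k a)
    _ = _ := by simp only [Finset.mul_sum, mul_assoc]

theorem sum_btwWeight_le (hεζ : S.ε < S.ζ) :
    S.ζ * S.ζ * ∑ q, S.f q * S.btwWeight q ≤ 4 * S.h * S.Θ * ∑ k, S.val k := by
  set g₁ : K → B → ℝ := fun k a => ∑ v, S.w v *
    (if S.reach a v then max (S.pot k v - S.pot k a) 0 else 0) with hg₁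
  set g₂ : K → B → ℝ := fun k b => ∑ v, S.w v *
    (if S.reach v b then max (S.pot k b - S.pot k v) 0 else 0) with hg₂
  have nn : ∀ (P : Prop) (x : ℝ), 0 ≤ (if P then max x 0 else 0) := fun P x => by
    split_ifs
    · exact le_max_right _ _
    · exact le_rfl
  have h₁ := S.sum_load_mul_le g₁ fun k a => Finset.sum_nonneg fun v _ =>
    mul_nonneg (S.w_nonneg v) (nn _ _)
  have h₂ := S.sum_load_mul_le g₂ fun k a => Finset.sum_nonneg fun v _ =>
    mul_nonneg (S.w_nonneg v) (nn _ _)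
  have b₁ : ∀ k, ∑ a, S.w a * g₁ k a ≤ 2 * S.Θ * S.val k := fun k => by
    refine le_trans (le_of_eq ?_) (S.thin k)
    simp only [hg₁, Finset.mul_sum]
    refine Finset.sum_congr rfl fun a _ => Finset.sum_congr rfl fun v _ => ?_
    split_ifs <;> ring
  have b₂ : ∀ k, ∑ a, S.w a * g₂ k a ≤ 2 * S.Θ * S.val k := fun k => by
    refine le_trans (le_of_eq ?_) (S.thin k)
    simp only [hg₂, Finset.mul_sum]
    rw [Finset.sum_comm]
    refine Finset.sum_congr rfl fun a _ => Finset.sum_congr rfl fun v _ => ?_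
    split_ifs <;> ring
  have c₁ : ∑ k, ∑ a, S.w a * g₁ k a ≤ 2 * S.Θ * ∑ k, S.val k := by
    rw [Finset.mul_sum]; exact Finset.sum_le_sum fun k _ => b₁ k
  have c₂ : ∑ k, ∑ a, S.w a * g₂ k a ≤ 2 * S.Θ * ∑ k, S.val k := by
    rw [Finset.mul_sum]; exact Finset.sum_le_sum fun k _ => b₂ k
  have d₁ := mul_le_mul_of_nonneg_left c₁ S.h_pos.le
  have d₂ := mul_le_mul_of_nonneg_left c₂ S.h_pos.le
  have main : S.ζ * S.ζ * ∑ q, S.f q * S.btwWeight q ≤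
      ∑ q, S.f q * ∑ a, S.ψ q a * g₁ (S.rd q) a + ∑ q, S.f q * ∑ a, S.ψ q a * g₂ (S.rd q) a := by
    rw [← Finset.sum_add_distrib, Finset.mul_sum]
    refine Finset.sum_le_sum fun q _ => ?_
    rw [← mul_add, mul_left_comm]
    refine mul_le_mul_of_nonneg_left ?_ (S.f_nonneg q)
    have e₁ : ∑ a, S.ψ q a * g₁ (S.rd q) a = ∑ v, S.w v * ∑ a, (if S.reach a v then
        S.ψ q a * max (S.pot (S.rd q) v - S.pot (S.rd q) a) 0 else 0) := by
      simp only [hg₁, Finset.mul_sum]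
      rw [Finset.sum_comm]
      refine Finset.sum_congr rfl fun a _ => Finset.sum_congr rfl fun v _ => ?_
      split_ifs <;> ring
    have e₂ : ∑ a, S.ψ q a * g₂ (S.rd q) a = ∑ v, S.w v * ∑ b, (if S.reach v b then
        S.ψ q b * max (S.pot (S.rd q) b - S.pot (S.rd q) v) 0 else 0) := by
      simp only [hg₂, Finset.mul_sum]
      rw [Finset.sum_comm]
      refine Finset.sum_congr rfl fun a _ => Finset.sum_congr rfl fun v _ => ?_
      split_ifs <;> ring
    rw [e₁, e₂, ← Finset.sum_add_distrib, btwWeight, Finset.mul_sum]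
    refine Finset.sum_le_sum fun v _ => ?_
    rw [← mul_add]
    by_cases hv : S.Btw q v
    · simp only [hv, if_true]
      rw [mul_comm]
      exact mul_le_mul_of_nonneg_left (S.btw_stretch hεζ hv) (S.w_nonneg v)
    · simp only [hv, if_false, mul_zero]
      refine mul_nonneg (S.w_nonneg v) (add_nonneg ?_ ?_) <;>
      · refine Finset.sum_nonneg fun c _ => ?_
        split_ifs
        · exact mul_nonneg (S.ψ_nonneg q c) (le_max_right _ _)
        · exact le_rfl
  nlinarith [main, h₁, h₂, d₁, d₂]

end ThinSystem

namespace ThinSystem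
variable {B K Q : Type*} [Fintype B] [Fintype K] [Fintype Q] (S : ThinSystem B K Q)

/-- The total value of all rounds. -/
noncomputable def total : ℝ := ∑ k, S.val k

theorem total_nonneg : 0 ≤ S.total := Finset.sum_nonneg fun k _ => S.val_nonneg k

/-- The bound on the weight between two middle blocks of a good profile. -/
noncomputable def κ : ℝ := 64 * S.h * S.Θ / (S.ζ * S.ζ)

theorem κ_pos : 0 < S.κ := by
  have := S.ζ_pos; have := S.h_pos; have := S.Θ_pos
  unfold κ; positivity

def Good (q : Q) : Prop :=
  S.btwWeight q ≤ S.κ ∧ 1 / (48 * S.A) ≤ ∑ a, if S.Mid q a then S.ψ q a else 0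

/-- The middle part of a good profile. -/
noncomputable def core (q : Q) (a : B) : ℝ := if S.Good q ∧ S.Mid q a then S.ψ q a else 0

theorem core_nonneg (q : Q) (a : B) : 0 ≤ S.core q a := by
  unfold core; split_ifs
  · exact S.ψ_nonneg q a
  · exact le_rfl

theorem core_le (q : Q) (a : B) : S.core q a ≤ S.ψ q a := by
  unfold core; split_ifs
  · exact le_rfl
  · exact S.ψ_nonneg q a

theorem of_core_pos {q : Q} {a : B} (h : 0 < S.core q a) : S.Good q ∧ S.Mid q a := by
  unfold core at h; split_ifs at h with h'
  · exact h'
  · exact absurd h (lt_irrefl _)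

theorem sum_core_le_one (q : Q) : ∑ a, S.core q a ≤ 1 :=
  (Finset.sum_le_sum fun a _ => S.core_le q a).trans (S.ψ_sum q)

theorem btwWeight_nonneg (q : Q) : 0 ≤ S.btwWeight q := Finset.sum_nonneg fun v _ => by
  split_ifs
  · exact S.w_nonneg v
  · exact le_rfl

theorem ε_lt_ζ (hε : S.ε ≤ 1 / (600 * S.A)) : S.ε < S.ζ := by
  have := S.A_pos
  refine hε.trans_lt ?_
  unfold ζ
  exact one_div_lt_one_div_of_lt (by positivity) (by linarith)

theorem total_le_core (hε : S.ε ≤ 1 / (600 * S.A)) :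
    S.total / 8 ≤ ∑ q, S.f q * ∑ a, S.core q a := by
  have hA := S.A_pos
  have hκ := S.κ_pos
  have hζ := S.ζ_pos
  have hC := S.total_nonneg
  have pt : ∀ q, ∑ a, S.ψ q a ≤ ∑ a, S.core q a +
      (4 * S.ζ + 6 * S.ε + 1 / (48 * S.A)) + S.btwWeight q / S.κ := by
    intro q
    have h1 := S.sum_le_sum_mid q
    have h2 : 0 ≤ S.btwWeight q / S.κ := div_nonneg (S.btwWeight_nonneg q) hκ.le
    have h3 : 0 ≤ ∑ a, S.core q a := Finset.sum_nonneg fun a _ => S.core_nonneg q a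
    have h4 : 0 ≤ 1 / (48 * S.A) := by positivity
    have h5 := S.ε_pos
    by_cases hb : S.btwWeight q ≤ S.κ
    · by_cases hm : 1 / (48 * S.A) ≤ ∑ a, if S.Mid q a then S.ψ q a else 0
      · have : ∑ a, S.core q a = ∑ a, if S.Mid q a then S.ψ q a else 0 :=
          Finset.sum_congr rfl fun a _ => by simp [core, show S.Good q from ⟨hb, hm⟩]
        linarith
      · linarith
    · have : 1 ≤ S.btwWeight q / S.κ := (one_le_div hκ).2 (not_le.1 hb).le
      linarith [S.ψ_sum q]
  have h1 : S.total / 2 ≤ ∑ q, S.f q * ∑ a, S.core q a +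
      (4 * S.ζ + 6 * S.ε + 1 / (48 * S.A)) * ∑ q, S.f q +
      (∑ q, S.f q * S.btwWeight q) / S.κ := by
    refine S.mass.trans ?_
    rw [Finset.mul_sum, Finset.sum_div, ← Finset.sum_add_distrib, ← Finset.sum_add_distrib]
    refine Finset.sum_le_sum fun q _ => ?_
    refine (mul_le_mul_of_nonneg_left (pt q) (S.f_nonneg q)).trans (le_of_eq ?_)
    ring
  have h2 : (∑ q, S.f q * S.btwWeight q) / S.κ ≤ S.total / 16 := by
    have h := S.sum_btwWeight_le (S.ε_lt_ζ hε)
    change _ ≤ 4 * S.h * S.Θ * S.total at h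
    rw [div_le_iff₀ hκ]
    have e : S.total / 16 * S.κ = (4 * S.h * S.Θ * S.total) / (S.ζ * S.ζ) := by
      unfold κ; ring
    rw [e, le_div_iff₀ (by positivity)]
    linarith
  have h3 : (4 * S.ζ + 6 * S.ε + 1 / (48 * S.A)) * ∑ q, S.f q ≤ (3 / 16) * S.total := by
    have hb : 4 * S.ζ + 6 * S.ε + 1 / (48 * S.A) ≤ (1 / 16) / S.A := by
      have e1 : S.ζ = (1 / 128) * (1 / S.A) := by unfold ζ; field_simp
      have e2 : 1 / (600 * S.A) = (1 / 600) * (1 / S.A) := by field_simp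
      have e3 : 1 / (48 * S.A) = (1 / 48) * (1 / S.A) := by field_simp
      have e4 : (1 / 16) / S.A = (1 / 16) * (1 / S.A) := by ring
      have : 0 ≤ 1 / S.A := by positivity
      rw [e2] at hε
      rw [e1, e3, e4]
      linarith
    have hf : 0 ≤ ∑ q, S.f q := Finset.sum_nonneg fun q _ => S.f_nonneg q
    calc _ ≤ (1 / 16) / S.A * (3 * S.A * S.total) :=
          mul_le_mul hb S.flow hf (by positivity)
      _ = _ := by field_simp
  linarith

/-- The gap defining the relation `Link`. -/
noncomputable def η₀ : ℝ := 1 / (400 * S.A)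

theorem η₀_pos : 0 < S.η₀ := by have := S.A_pos; unfold η₀; positivity

theorem ε_lt_η₀ (hε : S.ε ≤ 1 / (600 * S.A)) : S.ε < S.η₀ := by
  have := S.A_pos
  refine hε.trans_lt ?_
  unfold η₀
  exact one_div_lt_one_div_of_lt (by positivity) (by linarith)

def Link (a b : B) : Prop :=
  ∃ q, S.Good q ∧ S.Mid q a ∧ S.Mid q b ∧ S.η₀ ≤ S.pot (S.rd q) b - S.pot (S.rd q) a

theorem Link.reach {S : ThinSystem B K Q} (hε : S.ε ≤ 1 / (600 * S.A)) {a b : B}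
    (h : S.Link a b) : S.reach a b := by
  obtain ⟨q, -, ha, hb, hab⟩ := h
  exact S.alive_reach _ _ _ (S.ordered q a b ha.1 hb.1 ((S.ε_lt_η₀ hε).trans_le hab))

theorem Link.between_le {S : ThinSystem B K Q} {a b : B} (h : S.Link a b) :
    ∑ v, (if S.reach a v ∧ S.reach v b then S.w v else 0) ≤ S.κ := by
  obtain ⟨q, hq, ha, hb, hab⟩ := h
  refine le_trans (Finset.sum_le_sum fun v _ => ?_) hq.1
  by_cases hv : S.reach a v ∧ S.reach v b
  · have : S.Btw q v := ⟨a, b, ha, hb, by linarith [S.η₀_pos], hv.1, hv.2⟩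
    simp [hv, this]
  · simp only [hv, if_false]
    split_ifs
    · exact S.w_nonneg v
    · exact le_rfl

def Adj (a b : B) : Prop := S.Link a b ∨ S.Link b a

noncomputable def nbr (a : B) : ℝ := ∑ v, if S.Adj a v then S.w v else 0

noncomputable def deg (a : B) : ℝ := ∑ q, S.f q * S.core q a

theorem deg_nonneg (a : B) : 0 ≤ S.deg a :=
  Finset.sum_nonneg fun q _ => mul_nonneg (S.f_nonneg q) (S.core_nonneg q a)

theorem far_core (hε : S.ε ≤ 1 / (600 * S.A)) {q : Q} {a : B} (ha : 0 < S.core q a) :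
    1 / (96 * S.A) ≤ ∑ b, ((if S.η₀ ≤ S.pot (S.rd q) b - S.pot (S.rd q) a then S.core q b else 0) +
      (if S.η₀ ≤ S.pot (S.rd q) a - S.pot (S.rd q) b then S.core q b else 0)) := by
  have hA := S.A_pos
  obtain ⟨hg, -⟩ := S.of_core_pos ha
  have h1 : 1 / (48 * S.A) ≤ ∑ b, S.core q b := by
    refine hg.2.trans (le_of_eq (Finset.sum_congr rfl fun b _ => ?_))
    simp [core, hg]
  have h2 := S.window q (S.pot (S.rd q) a - S.η₀) (2 * S.η₀) (by linarith [S.η₀_pos])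
  have h3 : ∑ b, S.core q b ≤ ∑ b, ((if S.η₀ ≤ S.pot (S.rd q) b - S.pot (S.rd q) a
        then S.core q b else 0) +
      (if S.η₀ ≤ S.pot (S.rd q) a - S.pot (S.rd q) b then S.core q b else 0)) +
      ∑ b, (if S.pot (S.rd q) a - S.η₀ ≤ S.pot (S.rd q) b ∧
        S.pot (S.rd q) b ≤ S.pot (S.rd q) a - S.η₀ + 2 * S.η₀ then S.ψ q b else 0) := by
    rw [← Finset.sum_add_distrib]
    refine Finset.sum_le_sum fun b _ => ?_
    have hc := S.core_nonneg q b
    have hcl := S.core_le q b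
    have hψ := S.ψ_nonneg q b
    rcases le_total (S.pot (S.rd q) a + S.η₀) (S.pot (S.rd q) b) with h | h
    · rw [if_pos (show S.η₀ ≤ S.pot (S.rd q) b - S.pot (S.rd q) a by linarith)]
      split_ifs <;> linarith
    · rcases le_total (S.pot (S.rd q) b) (S.pot (S.rd q) a - S.η₀) with h' | h'
      · rw [if_pos (show S.η₀ ≤ S.pot (S.rd q) a - S.pot (S.rd q) b by linarith)]
        split_ifs <;> linarith
      · rw [if_pos (show S.pot (S.rd q) a - S.η₀ ≤ S.pot (S.rd q) b ∧
          S.pot (S.rd q) b ≤ S.pot (S.rd q) a - S.η₀ + 2 * S.η₀ from ⟨h', by linarith⟩)]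
        split_ifs <;> linarith
  have h4 : 2 * S.η₀ + 3 * S.ε ≤ 1 / (96 * S.A) := by
    have e1 : S.η₀ = (1 / 400) * (1 / S.A) := by unfold η₀; field_simp
    have e2 : 1 / (600 * S.A) = (1 / 600) * (1 / S.A) := by field_simp
    have e3 : 1 / (96 * S.A) = (1 / 96) * (1 / S.A) := by field_simp
    rw [e1, e3]; rw [e2] at hε
    have : 0 ≤ 1 / S.A := by positivity
    linarith
  have h5 : 1 / (48 * S.A) = 2 * (1 / (96 * S.A)) := by field_simp; norm_num
  linarith

/-- The density of the adjacency relation. -/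
noncomputable def ϑ : ℝ := S.η₀ / (576 * S.A * S.ε * S.h * S.L)

theorem ϑ_pos : 0 < S.ϑ := by
  have := S.A_pos; have := S.η₀_pos; have := S.ε_pos; have := S.h_pos; have := S.L_pos
  unfold ϑ; positivity

theorem deg_le_nbr (hε : S.ε ≤ 1 / (600 * S.A)) (a : B) : S.ϑ * S.deg a ≤ S.nbr a := by
  have hA := S.A_pos; have hη := S.η₀_pos; have hε0 := S.ε_pos; have hh := S.h_pos
  have hL := S.L_pos
  have hfar := fun x y => S.sum_far_le x y (S.ε_lt_η₀ hε)
  have h1 : S.deg a * (1 / (96 * S.A)) ≤ ∑ q, S.f q * S.core q a *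
      ∑ b, ((if S.η₀ ≤ S.pot (S.rd q) b - S.pot (S.rd q) a then S.core q b else 0) +
      (if S.η₀ ≤ S.pot (S.rd q) a - S.pot (S.rd q) b then S.core q b else 0)) := by
    rw [deg, Finset.sum_mul]
    refine Finset.sum_le_sum fun q _ => ?_
    rcases (S.core_nonneg q a).eq_or_lt with h0 | h0
    · simp [← h0]
    · exact mul_le_mul_of_nonneg_left (S.far_core hε h0) (mul_nonneg (S.f_nonneg q) h0.le)
  have h2 : ∑ q, S.f q * S.core q a *
      ∑ b, ((if S.η₀ ≤ S.pot (S.rd q) b - S.pot (S.rd q) a then S.core q b else 0) +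
      (if S.η₀ ≤ S.pot (S.rd q) a - S.pot (S.rd q) b then S.core q b else 0)) ≤
      ∑ b, (6 * S.ε * S.h * (S.L / S.η₀)) * (if S.Adj a b then S.w b else 0) := by
    simp only [Finset.mul_sum]
    rw [Finset.sum_comm]
    refine Finset.sum_le_sum fun b _ => ?_
    by_cases hab : S.Adj a b
    · simp only [hab, if_true]
      have f1 := hfar a b
      have f2 := hfar b a
      have m1 : min (S.w a) (S.w b) ≤ S.w b := min_le_right _ _
      have m2 : min (S.w b) (S.w a) ≤ S.w b := min_le_left _ _
      have hc : 0 ≤ 3 * S.ε * S.h * (S.L / S.η₀) := by positivity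
      have g1 := mul_le_mul_of_nonneg_left m1 hc
      have g2 := mul_le_mul_of_nonneg_left m2 hc
      have : ∑ q, S.f q * S.core q a *
        ((if S.η₀ ≤ S.pot (S.rd q) b - S.pot (S.rd q) a then S.core q b else 0) +
        (if S.η₀ ≤ S.pot (S.rd q) a - S.pot (S.rd q) b then S.core q b else 0)) ≤
        ∑ q, (if S.η₀ ≤ S.pot (S.rd q) b - S.pot (S.rd q) a then
          S.f q * S.ψ q a * S.ψ q b else 0) +
        ∑ q, (if S.η₀ ≤ S.pot (S.rd q) a - S.pot (S.rd q) b then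
          S.f q * S.ψ q b * S.ψ q a else 0) := by
        rw [← Finset.sum_add_distrib]
        refine Finset.sum_le_sum fun q _ => ?_
        have e : S.f q * S.core q a * S.core q b ≤ S.f q * S.ψ q a * S.ψ q b := by
          rw [mul_assoc, mul_assoc]
          exact mul_le_mul_of_nonneg_left (mul_le_mul (S.core_le q a) (S.core_le q b)
            (S.core_nonneg q b) (S.ψ_nonneg q a)) (S.f_nonneg q)
        split_ifs <;> linarith
      linarith
    · simp only [hab, if_false, mul_zero]
      refine le_of_eq (Finset.sum_eq_zero fun q _ => ?_)
      by_contra hne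
      have ha : 0 < S.core q a := (S.core_nonneg q a).lt_of_ne (by
        rintro h0; apply hne; rw [← h0]; ring)
      have hb : 0 < S.core q b := (S.core_nonneg q b).lt_of_ne (by
        rintro h0; apply hne; rw [← h0]; simp)
      obtain ⟨hg, hma⟩ := S.of_core_pos ha
      obtain ⟨-, hmb⟩ := S.of_core_pos hb
      by_cases c1 : S.η₀ ≤ S.pot (S.rd q) b - S.pot (S.rd q) a
      · exact hab (Or.inl ⟨q, hg, hma, hmb, c1⟩)
      · by_cases c2 : S.η₀ ≤ S.pot (S.rd q) a - S.pot (S.rd q) b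
        · exact hab (Or.inr ⟨q, hg, hmb, hma, c2⟩)
        · simp [c1, c2] at hne
  rw [← Finset.mul_sum] at h2
  change _ ≤ _ * S.nbr a at h2
  have h3 := h1.trans h2
  unfold ϑ
  rw [div_mul_eq_mul_div, div_le_iff₀ (by positivity)]
  have e1 : 6 * S.ε * S.h * (S.L / S.η₀) * S.nbr a
      = (S.nbr a * (6 * S.ε * S.h * S.L)) / S.η₀ := by ring
  rw [e1, le_div_iff₀ hη, mul_one_div, div_mul_eq_mul_div, div_le_iff₀ (by positivity)] at h3
  linarith

noncomputable def adjMass (q : Q) (v : B) : ℝ := ∑ a, if S.Adj a v then S.core q a else 0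

noncomputable def firstMoment : ℝ := ∑ q, ∑ v, S.f q * S.w v * S.adjMass q v

noncomputable def secondMoment : ℝ := ∑ q, ∑ v, S.f q * S.w v * S.adjMass q v ^ 2

theorem firstMoment_eq : S.firstMoment = ∑ a, S.deg a * S.nbr a := by
  simp only [firstMoment, adjMass, deg, nbr, Finset.mul_sum, Finset.sum_mul]
  have : ∀ q, ∑ v, ∑ a, S.f q * S.w v * (if S.Adj a v then S.core q a else 0)
      = ∑ a, ∑ v, S.f q * S.core q a * (if S.Adj a v then S.w v else 0) := fun q => by
    rw [Finset.sum_comm]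
    refine Finset.sum_congr rfl fun a _ => Finset.sum_congr rfl fun v _ => ?_
    split_ifs <;> ring
  simp only [this]
  rw [Finset.sum_comm]
  refine Finset.sum_congr rfl fun a _ => ?_
  rw [Finset.sum_comm]

theorem le_firstMoment [Nonempty B] (hε : S.ε ≤ 1 / (600 * S.A)) :
    S.ϑ * S.total ^ 2 / (64 * Fintype.card B) ≤ S.firstMoment := by
  have hN : (0 : ℝ) < Fintype.card B := by exact_mod_cast Fintype.card_pos
  have h1 : S.total / 8 ≤ ∑ a, S.deg a := by
    refine (S.total_le_core hε).trans (le_of_eq ?_)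
    simp only [deg, Finset.mul_sum]
    rw [Finset.sum_comm]
  have h2 : (∑ a, S.deg a) ^ 2 ≤ Fintype.card B * ∑ a, S.deg a ^ 2 := sq_sum_le_card_mul_sum_sq
  have h3 : S.ϑ * ∑ a, S.deg a ^ 2 ≤ S.firstMoment := by
    rw [S.firstMoment_eq, Finset.mul_sum]
    refine Finset.sum_le_sum fun a _ => ?_
    have := mul_le_mul_of_nonneg_left (S.deg_le_nbr hε a) (S.deg_nonneg a)
    linarith
  have h4 : (S.total / 8) ^ 2 ≤ (∑ a, S.deg a) ^ 2 :=
    pow_le_pow_left₀ (by linarith [S.total_nonneg]) h1 2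
  have h5 : S.total ^ 2 / (64 * Fintype.card B) ≤ ∑ a, S.deg a ^ 2 := by
    rw [div_le_iff₀ (by positivity)]
    nlinarith
  have := mul_le_mul_of_nonneg_left h5 S.ϑ_pos.le
  calc _ = S.ϑ * (S.total ^ 2 / (64 * Fintype.card B)) := by ring
    _ ≤ _ := this.trans h3

theorem firstMoment_sq_le : S.firstMoment ^ 2 ≤ S.secondMoment * (3 * S.A * S.total) := by
  have hT2 : 0 ≤ S.secondMoment := Finset.sum_nonneg fun q _ => Finset.sum_nonneg fun v _ =>
    mul_nonneg (mul_nonneg (S.f_nonneg q) (S.w_nonneg v)) (sq_nonneg _)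
  have h1 : S.firstMoment ^ 2 ≤ S.secondMoment * ∑ q, ∑ v, S.f q * S.w v := by
    simp only [firstMoment, secondMoment, ← Finset.sum_product']
    refine Finset.sum_sq_le_sum_mul_sum_of_sq_le_mul _ (fun x _ => ?_) (fun x _ => ?_)
      (fun x _ => ?_)
    · exact mul_nonneg (mul_nonneg (S.f_nonneg _) (S.w_nonneg _)) (sq_nonneg _)
    · exact mul_nonneg (S.f_nonneg _) (S.w_nonneg _)
    · exact le_of_eq (by ring)
  refine h1.trans (mul_le_mul_of_nonneg_left (le_trans ?_ S.flow) hT2)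
  refine Finset.sum_le_sum fun q _ => ?_
  rw [← Finset.mul_sum]
  exact mul_le_of_le_one_right (S.f_nonneg q) S.w_sum

noncomputable def farPairs (η : ℝ) (q : Q) (v : B) : ℝ :=
  ∑ a, ∑ b, if S.Adj a v ∧ S.Adj b v ∧ η ≤ S.pot (S.rd q) b - S.pot (S.rd q) a then
    S.core q a * S.core q b else 0

theorem adjMass_sq_le {η : ℝ} (hη : 0 < η) (q : Q) (v : B) :
    S.adjMass q v ^ 2 ≤ (2 * η + 3 * S.ε) * S.adjMass q v + 2 * S.farPairs η q v := by
  have hsym : S.farPairs η q v = ∑ a, ∑ b, if S.Adj a v ∧ S.Adj b v ∧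
      η ≤ S.pot (S.rd q) a - S.pot (S.rd q) b then S.core q a * S.core q b else 0 := by
    rw [farPairs, Finset.sum_comm]
    refine Finset.sum_congr rfl fun a _ => Finset.sum_congr rfl fun b _ => ?_
    rw [mul_comm]
    congr 1
    simp only [eq_iff_iff]; tauto
  have hnear : ∀ a, ∑ b, (if S.pot (S.rd q) a - η ≤ S.pot (S.rd q) b ∧
        S.pot (S.rd q) b ≤ S.pot (S.rd q) a - η + 2 * η then S.ψ q b else 0) ≤ 2 * η + 3 * S.ε :=
    fun a => S.window q _ _ (by linarith)
  have h1 : S.adjMass q v ^ 2 ≤ ∑ a, (if S.Adj a v then S.core q a else 0) *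
      ∑ b, (if S.pot (S.rd q) a - η ≤ S.pot (S.rd q) b ∧
        S.pot (S.rd q) b ≤ S.pot (S.rd q) a - η + 2 * η then S.ψ q b else 0) +
      (S.farPairs η q v + S.farPairs η q v) := by
    nth_rw 2 [hsym]
    rw [sq, farPairs, adjMass, Finset.sum_mul_sum, ← Finset.sum_add_distrib,
      ← Finset.sum_add_distrib]
    refine Finset.sum_le_sum fun a _ => ?_
    rw [Finset.mul_sum, ← Finset.sum_add_distrib, ← Finset.sum_add_distrib]
    refine Finset.sum_le_sum fun b _ => ?_
    have ha := S.core_nonneg q a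
    have hb := S.core_nonneg q b
    have hbl := S.core_le q b
    have hp := mul_nonneg ha hb
    have hq := mul_nonneg ha (hb.trans hbl)
    by_cases hav : S.Adj a v
    · by_cases hbv : S.Adj b v
      · simp only [hav, hbv, if_true, true_and]
        rcases le_total (S.pot (S.rd q) a + η) (S.pot (S.rd q) b) with h | h
        · rw [if_pos (show η ≤ S.pot (S.rd q) b - S.pot (S.rd q) a by linarith)]
          split_ifs <;> linarith
        · rcases le_total (S.pot (S.rd q) b) (S.pot (S.rd q) a - η) with h' | h'
          · rw [if_pos (show η ≤ S.pot (S.rd q) a - S.pot (S.rd q) b by linarith)]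
            split_ifs <;> linarith
          · rw [if_pos (show S.pot (S.rd q) a - η ≤ S.pot (S.rd q) b ∧
              S.pot (S.rd q) b ≤ S.pot (S.rd q) a - η + 2 * η from ⟨h', by linarith⟩)]
            have := mul_le_mul_of_nonneg_left hbl ha
            split_ifs <;> linarith
      · simp only [hav, hbv, if_true, if_false, mul_zero, false_and, and_false, add_zero]
        split_ifs <;> linarith
    · simp [hav]
  have h2 : ∑ a, (if S.Adj a v then S.core q a else 0) *
      ∑ b, (if S.pot (S.rd q) a - η ≤ S.pot (S.rd q) b ∧
        S.pot (S.rd q) b ≤ S.pot (S.rd q) a - η + 2 * η then S.ψ q b else 0) ≤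
      (2 * η + 3 * S.ε) * S.adjMass q v := by
    rw [adjMass, mul_comm (2 * η + 3 * S.ε), Finset.sum_mul]
    refine Finset.sum_le_sum fun a _ => mul_le_mul_of_nonneg_left (hnear a) ?_
    split_ifs
    · exact S.core_nonneg q a
    · exact le_rfl
  linarith

theorem farPairs_le (hε : S.ε ≤ 1 / (600 * S.A)) {η : ℝ} (hη : S.ε < η) (q : Q) (v : B) :
    S.farPairs η q v ≤ (if S.Good q ∧ S.Btw q v then 1 else 0) +
      ∑ a, ∑ b, ((if S.Link v b ∧ S.reach v a ∧ S.reach a b then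
          (if η ≤ S.pot (S.rd q) b - S.pot (S.rd q) a then S.ψ q a * S.ψ q b else 0) else 0) +
        (if S.Link a v ∧ S.reach a b ∧ S.reach b v then
          (if η ≤ S.pot (S.rd q) b - S.pot (S.rd q) a then S.ψ q a * S.ψ q b else 0) else 0)) := by
  have h1 : S.farPairs η q v ≤ ∑ a, ∑ b, ((if S.Good q ∧ S.Btw q v then
        S.core q a * S.core q b else 0) +
      ((if S.Link v b ∧ S.reach v a ∧ S.reach a b then
          (if η ≤ S.pot (S.rd q) b - S.pot (S.rd q) a then S.ψ q a * S.ψ q b else 0) else 0) +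
        (if S.Link a v ∧ S.reach a b ∧ S.reach b v then
          (if η ≤ S.pot (S.rd q) b - S.pot (S.rd q) a then S.ψ q a * S.ψ q b else 0) else 0))) := by
    refine Finset.sum_le_sum fun a _ => Finset.sum_le_sum fun b _ => ?_
    have ha := S.core_nonneg q a
    have hb := S.core_nonneg q b
    have hp := mul_nonneg ha hb
    have hpq : S.core q a * S.core q b ≤ S.ψ q a * S.ψ q b :=
      mul_le_mul (S.core_le q a) (S.core_le q b) hb (S.ψ_nonneg q a)
    have hq := hp.trans hpq
    have nn : ∀ (P R : Prop) [Decidable P] [Decidable R],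
        0 ≤ (if P then (if R then S.ψ q a * S.ψ q b else 0) else 0) :=
      fun P R => by split_ifs <;> linarith
    have nn' : ∀ (P : Prop) [Decidable P], 0 ≤ (if P then S.core q a * S.core q b else 0) :=
      fun P => by split_ifs <;> linarith
    rcases hp.eq_or_lt with h0 | h0
    · rw [← h0]
      simp only [ite_self, zero_add]
      exact add_nonneg (nn _ _) (nn _ _)
    · have ha0 : 0 < S.core q a := ha.lt_of_ne (by rintro h; rw [← h] at h0; simp at h0)
      have hb0 : 0 < S.core q b := hb.lt_of_ne (by rintro h; rw [← h] at h0; simp at h0)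
      obtain ⟨hg, hma⟩ := S.of_core_pos ha0
      obtain ⟨-, hmb⟩ := S.of_core_pos hb0
      by_cases hc : S.Adj a v ∧ S.Adj b v ∧ η ≤ S.pot (S.rd q) b - S.pot (S.rd q) a
      · rw [if_pos hc]
        obtain ⟨hav, hbv, hgap⟩ := hc
        have hab : S.reach a b := S.alive_reach _ _ _ (S.ordered q a b hma.1 hmb.1
          (hη.trans_le hgap))
        have hle : S.pot (S.rd q) a ≤ S.pot (S.rd q) b := by linarith [S.ε_pos]
        have btw : S.reach a v → S.reach v b → S.core q a * S.core q b ≤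
            (if S.Good q ∧ S.Btw q v then S.core q a * S.core q b else 0) := fun h1 h2 => by
          rw [if_pos ⟨hg, a, b, hma, hmb, hle, h1, h2⟩]
        have n1 := nn' (S.Good q ∧ S.Btw q v)
        have n2 := nn (S.Link v b ∧ S.reach v a ∧ S.reach a b)
          (η ≤ S.pot (S.rd q) b - S.pot (S.rd q) a)
        have n3 := nn (S.Link a v ∧ S.reach a b ∧ S.reach b v)
          (η ≤ S.pot (S.rd q) b - S.pot (S.rd q) a)
        simp only [if_pos hgap] at n2 n3 ⊢
        rcases hav with e1 | e1 <;> rcases hbv with e2 | e2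
        · have r1 := e1.reach hε
          have r2 := e2.reach hε
          rw [if_pos (show S.Link a v ∧ S.reach a b ∧ S.reach b v from ⟨e1, hab, r2⟩)]
          linarith
        · have := btw (e1.reach hε) (e2.reach hε)
          linarith
        · have := btw (S.reach_trans _ _ _ hab (e2.reach hε))
            (S.reach_trans _ _ _ (e1.reach hε) hab)
          linarith
        · have r1 := e1.reach hε
          rw [if_pos (show S.Link v b ∧ S.reach v a ∧ S.reach a b from ⟨e2, r1, hab⟩)]
          linarith
      · rw [if_neg hc]
        exact add_nonneg (nn' _) (add_nonneg (nn _ _) (nn _ _))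
  refine h1.trans ?_
  simp only [Finset.sum_add_distrib]
  refine add_le_add ?_ le_rfl
  by_cases hg : S.Good q ∧ S.Btw q v
  · simp only [if_pos hg]
    rw [← Finset.sum_mul_sum]
    have h2 := S.sum_core_le_one q
    have h3 : 0 ≤ ∑ a, S.core q a := Finset.sum_nonneg fun a _ => S.core_nonneg q a
    nlinarith
  · simp only [if_neg hg, Finset.sum_const_zero, le_refl]

theorem sum_farPairs_le (hε : S.ε ≤ 1 / (600 * S.A)) {η : ℝ} (hη : S.ε < η) :
    ∑ q, ∑ v, S.f q * S.w v * S.farPairs η q v ≤ 3 * S.A * S.total * S.κ +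
      6 * Fintype.card B * S.κ * S.ε * S.h * (S.L / η) := by
  have hη0 : 0 < η := S.ε_pos.trans hη
  have hL := S.L_pos
  have hh := S.h_pos
  have hε0 := S.ε_pos
  have hκ := S.κ_pos
  have h1 : ∑ q, ∑ v, S.f q * S.w v * S.farPairs η q v ≤
      ∑ q, S.f q * ∑ v, (S.w v * if S.Good q ∧ S.Btw q v then 1 else 0) +
      (∑ v, S.w v * ∑ b, (if S.Link v b then ∑ a, (if S.reach v a ∧ S.reach a b then
          (∑ q, if η ≤ S.pot (S.rd q) b - S.pot (S.rd q) a then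
            S.f q * S.ψ q a * S.ψ q b else 0) else 0) else 0) +
       ∑ v, S.w v * ∑ a, (if S.Link a v then ∑ b, (if S.reach a b ∧ S.reach b v then
          (∑ q, if η ≤ S.pot (S.rd q) b - S.pot (S.rd q) a then
            S.f q * S.ψ q a * S.ψ q b else 0) else 0) else 0)) := by
    have e2 : ∀ v, ∑ b, (if S.Link v b then ∑ a, (if S.reach v a ∧ S.reach a b then
          (∑ q, if η ≤ S.pot (S.rd q) b - S.pot (S.rd q) a then
            S.f q * S.ψ q a * S.ψ q b else 0) else 0) else 0)
        = ∑ q, S.f q * ∑ a, ∑ b, (if S.Link v b ∧ S.reach v a ∧ S.reach a b then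
          (if η ≤ S.pot (S.rd q) b - S.pot (S.rd q) a then S.ψ q a * S.ψ q b else 0)
            else 0) := by
      intro v
      simp only [Finset.mul_sum]
      rw [Finset.sum_comm]
      have : ∀ b, (if S.Link v b then ∑ a, (if S.reach v a ∧ S.reach a b then
          (∑ q, if η ≤ S.pot (S.rd q) b - S.pot (S.rd q) a then
            S.f q * S.ψ q a * S.ψ q b else 0) else 0) else 0)
          = ∑ a, ∑ q, S.f q * (if S.Link v b ∧ S.reach v a ∧ S.reach a b then
          (if η ≤ S.pot (S.rd q) b - S.pot (S.rd q) a then S.ψ q a * S.ψ q b else 0)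
            else 0) := by
        intro b
        by_cases hb : S.Link v b
        · simp only [hb, if_true, true_and]
          refine Finset.sum_congr rfl fun a _ => ?_
          split_ifs
          · refine Finset.sum_congr rfl fun q _ => ?_
            split_ifs <;> ring
          · simp
        · simp [hb]
      simp only [this]
      rw [Finset.sum_comm]
      refine Finset.sum_congr rfl fun a _ => ?_
      rw [Finset.sum_comm]
    have e3 : ∀ v, ∑ a, (if S.Link a v then ∑ b, (if S.reach a b ∧ S.reach b v then
          (∑ q, if η ≤ S.pot (S.rd q) b - S.pot (S.rd q) a then
            S.f q * S.ψ q a * S.ψ q b else 0) else 0) else 0)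
        = ∑ q, S.f q * ∑ a, ∑ b, (if S.Link a v ∧ S.reach a b ∧ S.reach b v then
          (if η ≤ S.pot (S.rd q) b - S.pot (S.rd q) a then S.ψ q a * S.ψ q b else 0)
            else 0) := by
      intro v
      simp only [Finset.mul_sum]
      rw [Finset.sum_comm]
      refine Finset.sum_congr rfl fun a _ => ?_
      rw [Finset.sum_comm]
      by_cases hb : S.Link a v
      · simp only [hb, if_true, true_and]
        refine Finset.sum_congr rfl fun b _ => ?_
        split_ifs
        · refine Finset.sum_congr rfl fun q _ => ?_
          split_ifs <;> ring
        · simp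
      · simp [hb]
    simp only [e2, e3]
    have e4 : ∀ g : B → Q → ℝ, ∑ v, S.w v * ∑ q, S.f q * g v q
        = ∑ q, ∑ v, S.f q * S.w v * g v q := fun g => by
      simp only [Finset.mul_sum]
      rw [Finset.sum_comm]
      exact Finset.sum_congr rfl fun q _ => Finset.sum_congr rfl fun v _ => by ring
    rw [e4, e4, ← Finset.sum_add_distrib, ← Finset.sum_add_distrib]
    refine Finset.sum_le_sum fun q _ => ?_
    rw [Finset.mul_sum, ← Finset.sum_add_distrib, ← Finset.sum_add_distrib]
    refine Finset.sum_le_sum fun v _ => ?_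
    have := mul_le_mul_of_nonneg_left (S.farPairs_le hε hη q v)
      (mul_nonneg (S.f_nonneg q) (S.w_nonneg v))
    refine this.trans (le_of_eq ?_)
    simp only [Finset.sum_add_distrib]
    ring
  have h2 : ∑ q, S.f q * ∑ v, (S.w v * if S.Good q ∧ S.Btw q v then 1 else 0) ≤
      3 * S.A * S.total * S.κ := by
    refine le_trans (b := ∑ q, S.f q * S.κ) (Finset.sum_le_sum fun q _ =>
      mul_le_mul_of_nonneg_left ?_ (S.f_nonneg q)) ?_
    · by_cases hg : S.Good q
      · refine le_trans (le_of_eq (Finset.sum_congr rfl fun v _ => ?_)) hg.1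
        simp [hg]
      · simp [hg, hκ.le]
    · rw [← Finset.sum_mul]
      exact mul_le_mul_of_nonneg_right S.flow hκ.le
  set c := 3 * S.ε * S.h * (S.L / η) with hc
  have hc0 : 0 ≤ c := by positivity
  have hfar := fun x y => S.sum_far_le x y hη
  have h3 : ∑ v, S.w v * ∑ b, (if S.Link v b then ∑ a, (if S.reach v a ∧ S.reach a b then
          (∑ q, if η ≤ S.pot (S.rd q) b - S.pot (S.rd q) a then
            S.f q * S.ψ q a * S.ψ q b else 0) else 0) else 0) ≤ Fintype.card B * (c * S.κ) := by
    have : ∀ v b, (if S.Link v b then ∑ a, (if S.reach v a ∧ S.reach a b then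
          (∑ q, if η ≤ S.pot (S.rd q) b - S.pot (S.rd q) a then
            S.f q * S.ψ q a * S.ψ q b else 0) else 0) else 0) ≤ c * S.κ := by
      intro v b
      by_cases hvb : S.Link v b
      · simp only [hvb, if_true]
        refine le_trans ?_ (mul_le_mul_of_nonneg_left hvb.between_le hc0)
        rw [Finset.mul_sum]
        refine Finset.sum_le_sum fun a _ => ?_
        split_ifs
        · exact (hfar a b).trans (mul_le_mul_of_nonneg_left (min_le_left _ _) hc0)
        · simp
      · simp only [hvb, if_false]
        positivity
    calc _ ≤ ∑ v, S.w v * (Fintype.card B * (c * S.κ)) := by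
          refine Finset.sum_le_sum fun v _ => mul_le_mul_of_nonneg_left ?_ (S.w_nonneg v)
          refine (Finset.sum_le_sum fun b _ => this v b).trans (le_of_eq ?_)
          simp
      _ ≤ _ := by
          rw [← Finset.sum_mul]
          exact mul_le_of_le_one_left (by positivity) S.w_sum
  have h4 : ∑ v, S.w v * ∑ a, (if S.Link a v then ∑ b, (if S.reach a b ∧ S.reach b v then
          (∑ q, if η ≤ S.pot (S.rd q) b - S.pot (S.rd q) a then
            S.f q * S.ψ q a * S.ψ q b else 0) else 0) else 0) ≤ Fintype.card B * (c * S.κ) := by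
    have : ∀ v a, (if S.Link a v then ∑ b, (if S.reach a b ∧ S.reach b v then
          (∑ q, if η ≤ S.pot (S.rd q) b - S.pot (S.rd q) a then
            S.f q * S.ψ q a * S.ψ q b else 0) else 0) else 0) ≤ c * S.κ := by
      intro v a
      by_cases hvb : S.Link a v
      · simp only [hvb, if_true]
        refine le_trans ?_ (mul_le_mul_of_nonneg_left hvb.between_le hc0)
        rw [Finset.mul_sum]
        refine Finset.sum_le_sum fun b _ => ?_
        split_ifs
        · exact (hfar a b).trans (mul_le_mul_of_nonneg_left (min_le_right _ _) hc0)
        · simp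
      · simp only [hvb, if_false]
        positivity
    calc _ ≤ ∑ v, S.w v * (Fintype.card B * (c * S.κ)) := by
          refine Finset.sum_le_sum fun v _ => mul_le_mul_of_nonneg_left ?_ (S.w_nonneg v)
          refine (Finset.sum_le_sum fun b _ => this v b).trans (le_of_eq ?_)
          simp
      _ ≤ _ := by
          rw [← Finset.sum_mul]
          exact mul_le_of_le_one_left (by positivity) S.w_sum
  have e : 3 * S.A * S.total * S.κ + 6 * Fintype.card B * S.κ * S.ε * S.h * (S.L / η)
      = 3 * S.A * S.total * S.κ + (Fintype.card B * (c * S.κ) + Fintype.card B * (c * S.κ)) := by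
    rw [hc]; ring
  rw [e]
  linarith

theorem total_lt [Nonempty B] {α η : ℝ} (hα : 0 < α) (hε : S.ε ≤ 1 / (600 * S.A)) (hη : S.ε < η)
    (hwin : 2 * η + 3 * S.ε ≤ S.ϑ * α / (384 * S.A * Fintype.card B))
    (hX : 294912 * S.A ^ 2 * Fintype.card B ^ 2 * S.κ < S.ϑ ^ 2 * α ^ 2)
    (hY : 589824 * S.A * Fintype.card B ^ 3 * S.κ * S.ε * S.h * (S.L / η) < S.ϑ ^ 2 * α ^ 3) :
    S.total < α := by
  by_contra hcon
  have hC : α ≤ S.total := not_lt.1 hcon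
  have hC0 : 0 < S.total := hα.trans_le hC
  have hA := S.A_pos
  have hϑ := S.ϑ_pos
  have hκ := S.κ_pos
  have hN : (0 : ℝ) < Fintype.card B := by exact_mod_cast Fintype.card_pos
  set n : ℝ := (Fintype.card B : ℝ) with hn
  set C := S.total with hCd
  set T := S.firstMoment with hT
  have t1 : S.ϑ * C ^ 2 / (64 * n) ≤ T := S.le_firstMoment hε
  have t1pos : 0 < S.ϑ * C ^ 2 / (64 * n) := by positivity
  have hT0 : 0 < T := t1pos.trans_le t1
  have hF := S.sum_farPairs_le hε hη
  set F := ∑ q, ∑ v, S.f q * S.w v * S.farPairs η q v with hFd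
  have hT2 : S.secondMoment ≤ (2 * η + 3 * S.ε) * T + 2 * F := by
    rw [hT, hFd, firstMoment, secondMoment, Finset.mul_sum, Finset.mul_sum,
      ← Finset.sum_add_distrib]
    refine Finset.sum_le_sum fun q _ => ?_
    rw [Finset.mul_sum, Finset.mul_sum, ← Finset.sum_add_distrib]
    refine Finset.sum_le_sum fun v _ => ?_
    refine (mul_le_mul_of_nonneg_left (S.adjMass_sq_le (S.ε_pos.trans hη) q v)
      (mul_nonneg (S.f_nonneg q) (S.w_nonneg v))).trans (le_of_eq ?_)
    ring
  have hCS := S.firstMoment_sq_le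
  have hAC : 0 < 3 * S.A * C := by positivity
  have hw2 : (2 * η + 3 * S.ε) * (6 * S.A * C) ≤ T := by
    refine le_trans ?_ t1
    calc _ ≤ S.ϑ * α / (384 * S.A * n) * (6 * S.A * C) :=
          mul_le_mul_of_nonneg_right hwin (by positivity)
      _ = S.ϑ * C * α / (64 * n) := by field_simp; norm_num
      _ ≤ _ := by
          refine div_le_div_of_nonneg_right ?_ (by positivity)
          rw [pow_two, ← mul_assoc]
          exact mul_le_mul_of_nonneg_left hC (mul_pos hϑ hC0).le
  have h5 : T ^ 2 ≤ 12 * S.A * C * F := by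
    have a1 : T ^ 2 ≤ ((2 * η + 3 * S.ε) * T + 2 * F) * (3 * S.A * C) :=
      hCS.trans (mul_le_mul_of_nonneg_right hT2 hAC.le)
    have a2 := mul_le_mul_of_nonneg_left hw2 hT0.le
    nlinarith
  have h6 : (S.ϑ * C ^ 2 / (64 * n)) ^ 2 ≤ T ^ 2 := pow_le_pow_left₀ t1pos.le t1 2
  have h7 : (S.ϑ * C ^ 2 / (64 * n)) ^ 2 ≤ 12 * S.A * C * (3 * S.A * C * S.κ +
      6 * n * S.κ * S.ε * S.h * (S.L / η)) :=
    h6.trans (h5.trans (mul_le_mul_of_nonneg_left hF (by positivity)))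
  have e : (S.ϑ * C ^ 2 / (64 * n)) ^ 2 = S.ϑ ^ 2 * C ^ 4 / (4096 * n ^ 2) := by
    field_simp; norm_num
  rw [e, div_le_iff₀ (by positivity)] at h7
  have h8 : S.ϑ ^ 2 * C ^ 3 ≤ 147456 * S.A ^ 2 * n ^ 2 * S.κ * C +
      294912 * S.A * n ^ 3 * S.κ * S.ε * S.h * (S.L / η) := by
    refine le_of_mul_le_mul_left ?_ hC0
    linarith
  have h9 : S.ϑ ^ 2 * α ^ 3 ≤ S.ϑ ^ 2 * C ^ 3 := by gcongr
  have h10 : 294912 * S.A ^ 2 * n ^ 2 * S.κ * C < S.ϑ ^ 2 * C ^ 3 := by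
    calc _ < S.ϑ ^ 2 * α ^ 2 * C := mul_lt_mul_of_pos_right hX hC0
      _ ≤ S.ϑ ^ 2 * C ^ 2 * C := by gcongr
      _ = _ := by ring
  linarith

end ThinSystem

/-- A directed graph whose arcs are partitioned into blocks; the arcs of an `isOut` block all leave
the node of the block, those of the other blocks all enter it.  Each block carries a polymatroid. -/
structure ArcNet (X H B : Type*) [Fintype H] [Fintype B] where
  src : H → X
  dst : H → X
  own : H → B
  node : B → X
  isOut : B → Prop
  src_own : ∀ h, isOut (own h) → src h = node (own h)
  dst_own : ∀ h, ¬ isOut (own h) → dst h = node (own h)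
  cost : B → Finset H → ℝ
  cost_poly : ∀ b, IsPolymatroid (cost b)
  cost_local : ∀ b S, cost b S = cost b (S.filter fun h => own h = b)

namespace ArcNet

variable {X H B : Type*} [Fintype H] [Fintype B] (M : ArcNet X H B)

def tot (S : Finset H) : ℝ := ∑ b, M.cost b S

theorem tot_poly : IsPolymatroid M.tot := IsPolymatroid.sum _ fun b _ => M.cost_poly b

theorem lov_tot (y : H → ℝ) : lov M.tot y = ∑ b, lov (M.cost b) y :=
  lov_sum _ (fun b _ => M.cost_poly b) y

/-- `M.Walk G s t p`: the arcs `p` form a walk from `s` to `t` inside `G`. -/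
def Walk (G : Finset H) : X → X → List H → Prop
  | s, t, [] => s = t
  | s, t, h :: p => h ∈ G ∧ M.src h = s ∧ Walk G (M.dst h) t p

variable {M} {G G' : Finset H}

theorem Walk.append {s t u : X} {p q : List H} (h1 : M.Walk G s t p) (h2 : M.Walk G t u q) :
    M.Walk G s u (p ++ q) := by
  induction p generalizing s with
  | nil => cases h1; exact h2
  | cons h p ih => exact ⟨h1.1, h1.2.1, ih h1.2.2⟩

theorem Walk.of_append {s u : X} {p q : List H} (h : M.Walk G s u (p ++ q)) :
    ∃ t, M.Walk G s t p ∧ M.Walk G t u q := by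
  induction p generalizing s with
  | nil => exact ⟨s, rfl, h⟩
  | cons a p ih =>
    obtain ⟨t, h1, h2⟩ := ih h.2.2
    exact ⟨t, ⟨h.1, h.2.1, h1⟩, h2⟩

theorem Walk.mono (hG : G ⊆ G') {s t : X} {p : List H} (h : M.Walk G s t p) :
    M.Walk G' s t p := by
  induction p generalizing s with
  | nil => exact h
  | cons a p ih => exact ⟨hG h.1, h.2.1, ih h.2.2⟩

theorem Walk.mem {s t : X} {p : List H} (h : M.Walk G s t p) : ∀ a ∈ p, a ∈ G := by
  induction p generalizing s with
  | nil => simp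
  | cons a p ih =>
    intro b hb
    rcases List.mem_cons.1 hb with rfl | hb
    · exact h.1
    · exact ih h.2.2 b hb

theorem Walk.restrict {s t : X} {p : List H} (h : M.Walk G s t p) (hp : ∀ a ∈ p, a ∈ G') :
    M.Walk G' s t p := by
  induction p generalizing s with
  | nil => exact h
  | cons a p ih =>
    exact ⟨hp a (by simp), h.2.1, ih h.2.2 fun b hb => hp b (by simp [hb])⟩

/-- Any walk contains one that uses every block at most once. -/
theorem Walk.exists_nodup {s t : X} {p : List H} (h : M.Walk G s t p) :
    ∃ q, M.Walk G s t q ∧ (q.map M.own).Nodup ∧ q.Sublist p := by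
  induction p generalizing s with
  | nil => exact ⟨[], h, by simp, by simp⟩
  | cons a p ih =>
    obtain ⟨q, hq, hn, hs⟩ := ih h.2.2
    by_cases ha : M.own a ∈ q.map M.own
    · obtain ⟨b, hb, hab⟩ := List.mem_map.1 ha
      obtain ⟨q1, q2, rfl⟩ := List.append_of_mem hb
      obtain ⟨u, -, hu⟩ := hq.of_append
      have hn2 : ((b :: q2).map M.own).Nodup :=
        hn.sublist ((List.sublist_append_right q1 (b :: q2)).map _)
      by_cases ho : M.isOut (M.own a)
      · refine ⟨b :: q2, ⟨hu.1, ?_, hu.2.2⟩, hn2,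
          ((List.sublist_append_right _ _).trans hs).cons a⟩
        rw [M.src_own b (hab ▸ ho), hab, ← M.src_own a ho, h.2.1]
      · refine ⟨a :: q2, ⟨h.1, h.2.1, ?_⟩, ?_, ?_⟩
        · rw [M.dst_own a ho, ← hab, ← M.dst_own b (hab ▸ ho)]
          exact hu.2.2
        · rw [List.map_cons, hab] at *
          simpa using hn2
        · exact List.Sublist.cons_cons a
            (((List.sublist_cons_self b q2).trans (List.sublist_append_right _ _)).trans hs)
    · exact ⟨a :: q, ⟨h.1, h.2.1, hq⟩, by simpa using ⟨by simpa using ha, hn⟩, hs.cons_cons a⟩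

/-- Length of a walk. -/
def len (y : H → ℝ) (p : List H) : ℝ := (p.map y).sum

omit [Fintype H] in
theorem len_nonneg {y : H → ℝ} (hy : 0 ≤ y) (p : List H) : 0 ≤ len y p :=
  List.sum_nonneg (by simpa using fun a _ => hy a)

omit [Fintype H] in
theorem len_sublist {y : H → ℝ} (hy : 0 ≤ y) {p q : List H} (h : p.Sublist q) :
    len y p ≤ len y q :=
  (h.map y).sum_le_sum (by simpa using fun a _ => hy a)

omit [Fintype H] in
theorem len_cons (y : H → ℝ) (a : H) (q : List H) : len y (a :: q) = y a + len y q := by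
  simp [len]

variable (M)

/-- All walks from `s` to `t` in `G` have `y`-length at least `c`. -/
def Far (G : Finset H) (y : H → ℝ) (s t : X) (c : ℝ) : Prop := ∀ p, M.Walk G s t p → c ≤ len y p

def Reach (G : Finset H) (s t : X) : Prop := ∃ p, M.Walk G s t p

variable {M}

theorem Reach.trans {s t u : X} (h1 : M.Reach G s t) (h2 : M.Reach G t u) : M.Reach G s u := by
  obtain ⟨p, hp⟩ := h1
  obtain ⟨q, hq⟩ := h2
  exact ⟨_, hp.append hq⟩

theorem Reach.mono (hG : G ⊆ G') {s t : X} (h : M.Reach G s t) : M.Reach G' s t :=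
  h.imp fun _ hp => hp.mono hG

theorem Far.anti (hG : G ⊆ G') {y : H → ℝ} {s t : X} {c : ℝ} (h : M.Far G' y s t c) :
    M.Far G y s t c := fun p hp => h p (hp.mono hG)

theorem Far.exists_potential {y : H → ℝ} (hy : 0 ≤ y) {s t : X} (h : M.Far G y s t 1) :
    ∃ π : X → ℝ, (∀ u, 0 ≤ π u) ∧ (∀ u, π u ≤ 1) ∧ π s = 0 ∧ π t = 1 ∧
      ∀ a ∈ G, π (M.dst a) ≤ π (M.src a) + y a := by
  let Z : X → Set ℝ := fun u => insert 1 {r | ∃ p, M.Walk G s u p ∧ r = len y p}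
  have hne : ∀ u, (Z u).Nonempty := fun u => ⟨1, Or.inl rfl⟩
  have hz : ∀ u, ∀ r ∈ Z u, 0 ≤ r := by
    rintro u r (rfl | ⟨p, -, rfl⟩)
    · exact zero_le_one
    · exact len_nonneg hy p
  have hb : ∀ u, BddBelow (Z u) := fun u => ⟨0, hz u⟩
  have h0 : ∀ u, 0 ≤ sInf (Z u) := fun u => le_csInf (hne u) (hz u)
  have h1 : ∀ u, sInf (Z u) ≤ 1 := fun u => csInf_le (hb u) (Or.inl rfl)
  refine ⟨fun u => sInf (Z u), h0, h1, ?_, ?_, ?_⟩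
  · exact le_antisymm (csInf_le (hb s) (Or.inr ⟨[], rfl, by simp [len]⟩)) (h0 s)
  · refine le_antisymm (h1 t) (le_csInf (hne t) ?_)
    rintro r (rfl | ⟨p, hp, rfl⟩)
    · exact le_rfl
    · exact h p hp
  · intro a ha
    rw [← sub_le_iff_le_add]
    refine le_csInf (hne _) ?_
    rintro r (rfl | ⟨p, hp, rfl⟩)
    · have := h1 (M.dst a)
      have := hy a
      simp only [Pi.zero_apply] at *
      linarith
    · rw [sub_le_iff_le_add]
      refine csInf_le (hb _) (Or.inr ⟨p ++ [a], hp.append ⟨ha, rfl, rfl⟩, ?_⟩)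
      simp [len]

variable (M)

/-- The arcs of `G` crossing level `r` upwards. -/
noncomputable def cutAt (π : X → ℝ) (G : Finset H) (r : ℝ) : Finset H :=
  G.filter fun h => π (M.src h) ≤ r ∧ r < π (M.dst h)

variable {M}

theorem Walk.le_of_cutAt {π : X → ℝ} {r : ℝ} {s t : X} {p : List H}
    (h : M.Walk (G \ M.cutAt π G r) s t p) (hs : π s ≤ r) : π t ≤ r := by
  induction p generalizing s with
  | nil => cases h; exact hs
  | cons a p ih =>
    refine ih h.2.2 ?_
    obtain ⟨h1, h2, -⟩ := h
    subst h2
    by_contra hc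
    rw [not_le] at hc
    simp only [cutAt, mem_sdiff, mem_filter, not_and] at h1
    exact h1.2 h1.1 hs hc

theorem not_reach_of_cutAt {π : X → ℝ} {r : ℝ} {s t : X} (hs : π s ≤ r) (ht : r < π t) :
    ¬ M.Reach (G \ M.cutAt π G r) s t := fun ⟨_, hp⟩ => ht.not_ge (hp.le_of_cutAt hs)

variable (M)

/-- Upper bound for the cost of the level cut inside one block. -/
noncomputable def bnd (y : H → ℝ) (π : X → ℝ) (b : B) (r : ℝ) : ℝ :=
  if M.isOut b then
    (Set.Ici (π (M.node b))).indicator (fun r => M.cost b (lev y (r - π (M.node b)))) r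
  else
    (Set.Iio (π (M.node b))).indicator (fun r => M.cost b (lev y (π (M.node b) - r))) r

variable {M}

theorem cost_cutAt_le {y : H → ℝ} {π : X → ℝ}
    (hG : ∀ a ∈ G, π (M.dst a) ≤ π (M.src a) + y a) (b : B) (r : ℝ) :
    M.cost b (M.cutAt π G r) ≤ M.bnd y π b r := by
  rw [M.cost_local b]
  unfold bnd
  split_ifs with ho
  · by_cases hr : π (M.node b) ≤ r
    · rw [Set.indicator_of_mem (show r ∈ Set.Ici _ from hr)]
      refine (M.cost_poly b).mono _ _ fun h hh => ?_
      simp only [cutAt, mem_filter] at hh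
      obtain ⟨⟨h1, h2, h3⟩, rfl⟩ := hh
      rw [mem_lev, ← M.src_own h ho]
      linarith [hG h h1]
    · rw [Set.indicator_of_notMem (show r ∉ Set.Ici _ from hr)]
      refine le_of_eq ?_
      rw [← (M.cost_poly b).empty]
      congr 1
      rw [Finset.filter_eq_empty_iff]
      rintro h hh rfl
      simp only [cutAt, mem_filter] at hh
      exact hr (M.src_own h ho ▸ hh.2.1)
  · by_cases hr : r < π (M.node b)
    · rw [Set.indicator_of_mem (show r ∈ Set.Iio _ from hr)]
      refine (M.cost_poly b).mono _ _ fun h hh => ?_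
      simp only [cutAt, mem_filter] at hh
      obtain ⟨⟨h1, h2, h3⟩, rfl⟩ := hh
      rw [mem_lev, ← M.dst_own h ho]
      linarith [hG h h1]
    · rw [Set.indicator_of_notMem (show r ∉ Set.Iio _ from hr)]
      refine le_of_eq ?_
      rw [← (M.cost_poly b).empty]
      congr 1
      rw [Finset.filter_eq_empty_iff]
      rintro h hh rfl
      simp only [cutAt, mem_filter] at hh
      exact hr (M.dst_own h ho ▸ hh.2.2)

theorem integrable_bnd (y : H → ℝ) (π : X → ℝ) (b : B) :
    IntegrableOn (M.bnd y π b) (Set.Ioc 0 1) := by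
  unfold bnd
  split_ifs
  · refine Integrable.indicator ?_ measurableSet_Ici
    have : Antitone fun r => M.cost b (lev y (r - π (M.node b))) := fun r r' h =>
      antitone_lev (M.cost_poly b) y (by linarith)
    exact (this.intervalIntegrable (a := 0) (b := 1)).1
  · refine Integrable.indicator ?_ measurableSet_Iio
    have : Monotone fun r => M.cost b (lev y (π (M.node b) - r)) := fun r r' h =>
      antitone_lev (M.cost_poly b) y (by linarith)
    exact (this.intervalIntegrable (a := 0) (b := 1)).1

theorem integral_bnd_le (y : H → ℝ) {π : X → ℝ} (h0 : ∀ u, 0 ≤ π u) (h1 : ∀ u, π u ≤ 1) (b : B) :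
    ∫ r in Set.Ioc 0 1, M.bnd y π b r ≤ lov (M.cost b) y := by
  unfold bnd
  split_ifs
  · have hm : Antitone fun r => M.cost b (lev y (r - π (M.node b))) := fun r r' h =>
      antitone_lev (M.cost_poly b) y (by linarith)
    rw [setIntegral_indicator measurableSet_Ici]
    calc _ ≤ ∫ r in Set.Icc (π (M.node b)) 1, M.cost b (lev y (r - π (M.node b))) := by
          refine setIntegral_mono_set ?_ ?_ ?_
          · exact (intervalIntegrable_iff_integrableOn_Icc_of_le (h1 _)).1 hm.intervalIntegrable
          · exact Filter.Eventually.of_forall fun r => (M.cost_poly b).nonneg _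
          · exact Filter.Eventually.of_forall fun r hr => ⟨hr.2, hr.1.2⟩
      _ = ∫ r in (π (M.node b))..1, M.cost b (lev y (r - π (M.node b))) := by
          rw [integral_Icc_eq_integral_Ioc, intervalIntegral.integral_of_le (h1 _)]
      _ = ∫ r in (0 : ℝ)..(1 - π (M.node b)), M.cost b (lev y r) := by
          rw [intervalIntegral.integral_comp_sub_right (fun r => M.cost b (lev y r)), sub_self]
      _ ≤ _ := integral_lev_le_lov (M.cost_poly b) y _
  · have hm : Monotone fun r => M.cost b (lev y (π (M.node b) - r)) := fun r r' h =>
      antitone_lev (M.cost_poly b) y (by linarith)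
    rw [setIntegral_indicator measurableSet_Iio]
    calc _ ≤ ∫ r in Set.Ioc 0 (π (M.node b)), M.cost b (lev y (π (M.node b) - r)) := by
          refine setIntegral_mono_set ?_ ?_ ?_
          · exact hm.intervalIntegrable.1
          · exact Filter.Eventually.of_forall fun r => (M.cost_poly b).nonneg _
          · exact Filter.Eventually.of_forall fun r hr => ⟨hr.1.1, le_of_lt hr.2⟩
      _ = ∫ r in (0 : ℝ)..(π (M.node b)), M.cost b (lev y (π (M.node b) - r)) := by
          rw [intervalIntegral.integral_of_le (h0 _)]
      _ = ∫ r in (0 : ℝ)..(π (M.node b)), M.cost b (lev y r) := by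
          rw [intervalIntegral.integral_comp_sub_left (fun r => M.cost b (lev y r)), sub_self,
            sub_zero]
      _ ≤ _ := integral_lev_le_lov (M.cost_poly b) y _

theorem sub_le_integral_indicator {a b : ℝ} (ha : 0 ≤ a) (hb : b ≤ 1) :
    max (b - a) 0 ≤ ∫ r in Set.Ioc (0 : ℝ) 1, (Set.Ico a b).indicator (fun _ => (1 : ℝ)) r := by
  rw [setIntegral_indicator measurableSet_Ico, ← Real.volume_real_Ioo, setIntegral_const,
    smul_eq_mul, mul_one]
  refine measureReal_mono (fun r hr => ⟨⟨ha.trans_lt hr.1, hr.2.le.trans hb⟩, hr.1.le, hr.2⟩) ?_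
  exact ((measure_mono Set.inter_subset_left).trans_lt (by simp)).ne

/-- Averaging over the level `r`: some level cut is as good as the mean. -/
theorem exists_level {y : H → ℝ} {π : X → ℝ} (h0 : ∀ u, 0 ≤ π u) (h1 : ∀ u, π u ≤ 1)
    (hG : ∀ a ∈ G, π (M.dst a) ≤ π (M.src a) + y a) {γ : ℝ} (hγ : 0 ≤ γ) {m : B → B → ℝ}
    (hm : ∀ a b, 0 ≤ m a b) :
    ∃ r ∈ Set.Ioo (0 : ℝ) 1, γ * M.tot (M.cutAt π G r) +
        ∑ a, ∑ b, m a b * max (π (M.node b) - π (M.node a)) 0 ≤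
      γ * lov M.tot y +
        ∑ a, ∑ b, m a b * (if π (M.node a) ≤ r ∧ r < π (M.node b) then 1 else 0) := by
  let I : B → B → ℝ → ℝ := fun a b =>
    (Set.Ico (π (M.node a)) (π (M.node b))).indicator fun _ => (1 : ℝ)
  let f : ℝ → ℝ := fun r => γ * ∑ b, M.bnd y π b r - ∑ a, ∑ b, m a b * I a b r
  have hI : ∀ a b, IntegrableOn (I a b) (Set.Ioc 0 1) := fun a b =>
    (integrable_const (1 : ℝ)).indicator measurableSet_Ico
  have hf1 : IntegrableOn (fun r => γ * ∑ b, M.bnd y π b r) (Set.Ioc 0 1) :=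
    (integrable_finsetSum _ fun b _ => integrable_bnd y π b).const_mul γ
  have hf2 : IntegrableOn (fun r => ∑ a, ∑ b, m a b * I a b r) (Set.Ioc 0 1) :=
    integrable_finsetSum _ fun a _ => integrable_finsetSum _ fun b _ => (hI a b).const_mul _
  have hprob : IsProbabilityMeasure (volume.restrict (Set.Ioc (0 : ℝ) 1)) :=
    ⟨by simp⟩
  obtain ⟨r, hr, hle⟩ := exists_notMem_null_le_integral (μ := volume.restrict (Set.Ioc (0 : ℝ) 1))
    (N := (Set.Ioo 0 1)ᶜ) (f := f) (hf1.sub hf2) (by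
      rw [Measure.restrict_apply measurableSet_Ioo.compl]
      refine measure_mono_null (t := {1}) (fun x hx => ?_) (by simp)
      by_contra hne
      exact hx.1 ⟨hx.2.1, lt_of_le_of_ne hx.2.2 hne⟩)
  refine ⟨r, by simpa using hr, ?_⟩
  have e : ∫ r in Set.Ioc 0 1, f r = γ * ∑ b, (∫ r in Set.Ioc 0 1, M.bnd y π b r) -
      ∑ a, ∑ b, m a b * ∫ r in Set.Ioc 0 1, I a b r := by
    rw [integral_sub hf1 hf2, integral_const_mul,
      integral_finsetSum _ fun b _ => integrable_bnd y π b,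
      integral_finsetSum _ fun a _ => integrable_finsetSum _ fun b _ => (hI a b).const_mul _]
    congr 1
    refine Finset.sum_congr rfl fun a _ => ?_
    rw [integral_finsetSum _ fun b _ => (hI a b).const_mul _]
    exact Finset.sum_congr rfl fun b _ => integral_const_mul _ _
  rw [e] at hle
  have b1 : γ * ∑ b, (∫ r in Set.Ioc 0 1, M.bnd y π b r) ≤ γ * lov M.tot y := by
    rw [lov_tot]
    exact mul_le_mul_of_nonneg_left (Finset.sum_le_sum fun b _ => integral_bnd_le y h0 h1 b) hγ
  have b2 : γ * M.tot (M.cutAt π G r) ≤ γ * ∑ b, M.bnd y π b r :=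
    mul_le_mul_of_nonneg_left (Finset.sum_le_sum fun b _ => cost_cutAt_le hG b r) hγ
  have b3 : ∑ a, ∑ b, m a b * max (π (M.node b) - π (M.node a)) 0 ≤
      ∑ a, ∑ b, m a b * ∫ r in Set.Ioc 0 1, I a b r :=
    Finset.sum_le_sum fun a _ => Finset.sum_le_sum fun b _ =>
      mul_le_mul_of_nonneg_left (sub_le_integral_indicator (h0 _) (h1 _)) (hm a b)
  have e2 : ∑ a, ∑ b, m a b * I a b r = ∑ a, ∑ b, m a b *
      (if π (M.node a) ≤ r ∧ r < π (M.node b) then 1 else 0) := by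
    simp only [I, Set.indicator_apply, Set.mem_Ico]
  simp only [f, e2] at hle
  linarith

variable (M)

/-- Walks from `s` to `t` in `G` using every block at most once. -/
noncomputable def paths (G : Finset H) (s t : X) : Finset (List H) :=
  Set.Finite.toFinset (s := {p | M.Walk G s t p ∧ (p.map M.own).Nodup})
    ((Set.finite_coe_iff.1 (Finite.of_fintype {p : List H // p.Nodup})).subset
      fun _ hp => hp.2.of_map)

variable {M}

theorem mem_paths {s t : X} {p : List H} :
    p ∈ M.paths G s t ↔ M.Walk G s t p ∧ (p.map M.own).Nodup := by simp [paths]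

theorem paths_mono (hG : G ⊆ G') (s t : X) : M.paths G s t ⊆ M.paths G' s t := fun p hp => by
  rw [mem_paths] at *
  exact ⟨hp.1.mono hG, hp.2⟩

theorem far_of_paths {y : H → ℝ} (hy : 0 ≤ y) {s t : X} {c : ℝ}
    (h : ∀ p ∈ M.paths G s t, c ≤ len y p) : M.Far G y s t c := fun p hp => by
  obtain ⟨q, hq, hn, hs⟩ := hp.exists_nodup
  exact (h q (mem_paths.2 ⟨hq, hn⟩)).trans (len_sublist hy hs)

end ArcNet

namespace ArcNet

variable {X H B : Type*} [Fintype H] [Fintype B] (M : ArcNet X H B)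

/-! ### Recovered lengths along a walk -/

/-- The least potential of the vertices visited by the walk `p` from `s`. -/
noncomputable def futureMin (π : X → ℝ) : X → List H → ℝ
  | s, [] => π s
  | s, h :: p => min (π s) (futureMin π (M.dst h) p)

/-- The increase of the future minimum along each arc of a walk. -/
noncomputable def rise (π : X → ℝ) : X → List H → H → ℝ
  | _, [] => 0
  | s, h :: p => Pi.single h (M.futureMin π (M.dst h) p - min (π s) (M.futureMin π (M.dst h) p)) +
      rise π (M.dst h) p

variable {M} {G : Finset H} {π : X → ℝ} {s t : X} {p : List H}

theorem futureMin_le (π : X → ℝ) (s : X) (p : List H) : M.futureMin π s p ≤ π s := by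
  cases p with
  | nil => exact le_rfl
  | cons h p => exact min_le_left _ _

theorem futureMin_nonneg (h0 : ∀ u, 0 ≤ π u) (s : X) (p : List H) : 0 ≤ M.futureMin π s p := by
  induction p generalizing s with
  | nil => exact h0 s
  | cons h p ih => exact le_min (h0 s) (ih _)

theorem rise_nonneg (π : X → ℝ) (s : X) (p : List H) (a : H) : 0 ≤ M.rise π s p a := by
  induction p generalizing s with
  | nil => exact le_rfl
  | cons h p ih =>
    refine add_nonneg ?_ (ih _)
    rw [Pi.single_apply]
    split_ifs
    · linarith [min_le_right (π s) (M.futureMin π (M.dst h) p)]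
    · exact le_rfl

theorem rise_eq_zero (π : X → ℝ) (s : X) {p : List H} {a : H} (ha : a ∉ p) :
    M.rise π s p a = 0 := by
  induction p generalizing s with
  | nil => rfl
  | cons h p ih =>
    simp only [List.mem_cons, not_or] at ha
    simp [rise, ha.1, ih _ ha.2]

theorem rise_cons_pos {h a : H} (hp : 0 < M.rise π s (h :: p) a) :
    (a = h ∧ π s < M.futureMin π (M.dst h) p) ∨ 0 < M.rise π (M.dst h) p a := by
  simp only [rise, Pi.add_apply, Pi.single_apply] at hp
  split_ifs at hp with e
  · by_cases h1 : π s < M.futureMin π (M.dst h) p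
    · exact Or.inl ⟨e, h1⟩
    · rw [min_eq_right (not_lt.1 h1)] at hp
      exact Or.inr (by linarith)
  · exact Or.inr (by linarith)

theorem Walk.rise_le {y : H → ℝ} (hy : 0 ≤ y) (hG : ∀ a ∈ G, π (M.dst a) ≤ π (M.src a) + y a)
    (hp : M.Walk G s t p) (hn : p.Nodup) (a : H) : M.rise π s p a ≤ y a := by
  induction p generalizing s with
  | nil => exact hy a
  | cons h p ih =>
    obtain ⟨h1, rfl, h3⟩ := hp
    rw [List.nodup_cons] at hn
    simp only [rise, Pi.add_apply, Pi.single_apply]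
    split_ifs with e
    · subst e
      rw [rise_eq_zero π _ hn.1, add_zero]
      have h4 := M.futureMin_le π (M.dst a) p
      have h5 := hG a h1
      have h6 := hy a
      simp only [Pi.zero_apply] at h6
      rcases min_choice (π (M.src a)) (M.futureMin π (M.dst a) p) with e | e <;> rw [e] <;> linarith
    · rw [zero_add]
      exact ih h3 hn.2

theorem Walk.sum_rise (hp : M.Walk G s t p) :
    ∑ a, M.rise π s p a = π t - M.futureMin π s p := by
  induction p generalizing s with
  | nil => cases hp; simp [rise, futureMin]
  | cons h p ih =>
    simp only [rise, Pi.add_apply, Finset.sum_add_distrib, ih hp.2.2, futureMin]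
    simp

theorem reach_node_dst {a : H} (ha : a ∈ G) : M.Reach G (M.node (M.own a)) (M.dst a) := by
  by_cases ho : M.isOut (M.own a)
  · exact ⟨[a], ha, M.src_own a ho, rfl⟩
  · exact ⟨[], (M.dst_own a ho).symm⟩

theorem reach_src_node {a : H} (ha : a ∈ G) : M.Reach G (M.src a) (M.node (M.own a)) := by
  by_cases ho : M.isOut (M.own a)
  · exact ⟨[], M.src_own a ho⟩
  · exact ⟨[a], ha, rfl, M.dst_own a ho⟩

theorem Walk.reach_node (hp : M.Walk G s t p) {a : H} (ha : a ∈ p) :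
    M.Reach G s (M.node (M.own a)) := by
  induction p generalizing s with
  | nil => simp at ha
  | cons h p ih =>
    obtain ⟨h1, rfl, h3⟩ := hp
    rcases List.mem_cons.1 ha with rfl | ha
    · exact reach_src_node h1
    · exact Reach.trans ⟨[h], h1, rfl, rfl⟩ (ih h3 ha)

theorem mem_of_rise_pos {a : H} (h : 0 < M.rise π s p a) : a ∈ p := by
  by_contra hc
  exact h.ne' (rise_eq_zero π s hc)

section

variable {y : H → ℝ} {ε : ℝ} (hy : 0 ≤ y) (hε : ∀ a, y a ≤ ε)
  (hG : ∀ a ∈ G, π (M.dst a) ≤ π (M.src a) + y a)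

include hy hε hG in
theorem node_window {h : H} {p : List H} (hh : h ∈ G)
    (h2 : π (M.src h) < M.futureMin π (M.dst h) p) :
    π (M.src h) ≤ π (M.node (M.own h)) ∧ π (M.node (M.own h)) ≤ π (M.src h) + ε := by
  have h3 := hε h
  have h4 : 0 ≤ y h := hy h
  by_cases ho : M.isOut (M.own h)
  · rw [← M.src_own h ho]
    constructor <;> linarith
  · rw [← M.dst_own h ho]
    have := M.futureMin_le π (M.dst h) p
    have := hG h hh
    constructor <;> linarith

include hy hε hG in
theorem Walk.futureMin_le_node (hp : M.Walk G s t p) {a : H} (ha : 0 < M.rise π s p a) :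
    M.futureMin π s p ≤ π (M.node (M.own a)) := by
  induction p generalizing s with
  | nil => simp [rise] at ha
  | cons h p ih =>
    obtain ⟨h1, rfl, h3⟩ := hp
    rcases rise_cons_pos ha with ⟨rfl, h2⟩ | h2
    · exact (min_le_left _ _).trans (node_window hy hε hG h1 h2).1
    · exact (min_le_right _ _).trans (ih h3 h2)

include hy hε hG in
theorem Walk.reach_of_rise (hp : M.Walk G s t p) {a b : H} (ha : 0 < M.rise π s p a)
    (hb : 0 < M.rise π s p b) (hab : ε < π (M.node (M.own b)) - π (M.node (M.own a))) :
    M.Reach G (M.node (M.own a)) (M.node (M.own b)) := by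
  induction p generalizing s with
  | nil => simp [rise] at ha
  | cons h p ih =>
    obtain ⟨h1, rfl, h3⟩ := hp
    rcases rise_cons_pos hb with ⟨rfl, h4⟩ | h4
    · have h5 := node_window hy hε hG h1 h4
      rcases rise_cons_pos ha with ⟨rfl, h2⟩ | h2
      · have h6 : 0 ≤ y a := hy a
        linarith [hε a]
      · linarith [h3.futureMin_le_node hy hε hG h2]
    · rcases rise_cons_pos ha with ⟨rfl, h2⟩ | h2
      · exact (reach_node_dst h1).trans (h3.reach_node (mem_of_rise_pos h4))
      · exact ih h3 h2 h4

include hy hε hG in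
theorem Walk.sum_rise_window (hp : M.Walk G s t p) (lo hi : ℝ) :
    ∑ a, (if lo ≤ π (M.node (M.own a)) ∧ π (M.node (M.own a)) ≤ hi then M.rise π s p a else 0) ≤
      max (lo - ε) (min (hi + ε) (π t)) - max (lo - ε) (min (hi + ε) (M.futureMin π s p)) := by
  induction p generalizing s with
  | nil => cases hp; simp [rise, futureMin]
  | cons h p ih =>
    obtain ⟨h1, rfl, h3⟩ := hp
    have h4 := ih h3
    have hε0 : 0 ≤ ε := le_trans (hy h) (hε h)
    set m := M.futureMin π (M.dst h) p with hm
    have h5 : ∑ a, (if lo ≤ π (M.node (M.own a)) ∧ π (M.node (M.own a)) ≤ hi then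
        M.rise π (M.src h) (h :: p) a else 0) =
        (if lo ≤ π (M.node (M.own h)) ∧ π (M.node (M.own h)) ≤ hi then m - min (π (M.src h)) m
          else 0) +
        ∑ a, (if lo ≤ π (M.node (M.own a)) ∧ π (M.node (M.own a)) ≤ hi then
          M.rise π (M.dst h) p a else 0) := by
      simp only [← Finset.sum_filter, rise, Pi.add_apply, Finset.sum_add_distrib, ← hm]
      congr 1
      simp
    rw [h5]
    have hmono : max (lo - ε) (min (hi + ε) (min (π (M.src h)) m)) ≤
        max (lo - ε) (min (hi + ε) m) :=
      max_le_max le_rfl (min_le_min le_rfl (min_le_right _ _))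
    rw [show M.futureMin π (M.src h) (h :: p) = min (π (M.src h)) m from rfl]
    rcases lt_or_ge (π (M.src h)) m with h6 | h6
    · have h7 := node_window hy hε hG h1 h6
      split_ifs with hc
      · have h8 : m ≤ π (M.src h) + ε :=
          (M.futureMin_le π _ p).trans ((hG h h1).trans (by linarith [hε h]))
        rw [min_eq_left h6.le]
        rw [min_eq_right (show m ≤ hi + ε by linarith), max_eq_right (show lo - ε ≤ m by linarith)]
          at h4
        rw [min_eq_right (show π (M.src h) ≤ hi + ε by linarith),
          max_eq_right (show lo - ε ≤ π (M.src h) by linarith)]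
        linarith
      · linarith
    · rw [min_eq_right h6]
      simp only [sub_self, ite_self]
      linarith

end

/-! ### The capped single-pair linear program -/

variable (M)

noncomputable def load (G : Finset H) (s t : X) (f : List H → ℝ) (a : H) : ℝ :=
  ∑ p ∈ M.paths G s t, f p * (if a ∈ p then 1 else 0)

/-- Path flow `f` together with an amount `o` of overload on every arc. -/
structure Overflow (G : Finset H) (s t : X) (f : List H → ℝ) (o : H → ℝ) : Prop where
  flow_nonneg : ∀ p, 0 ≤ f p
  over_nonneg : ∀ a, 0 ≤ o a
  cap : ∀ S : Finset H, ∑ a ∈ S, (M.load G s t f a - o a) ≤ M.tot S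

noncomputable def gain (x : H → ℝ) (κ : ℝ) (G : Finset H) (s t : X) (f : List H → ℝ) (o : H → ℝ) :
    ℝ :=
  ∑ p ∈ M.paths G s t, f p - κ * ∑ a, x a * o a

/-- The optimal value when overload is charged `κ * x`. -/
noncomputable def opt (x : H → ℝ) (κ : ℝ) (G : Finset H) (s t : X) : ℝ :=
  sSup {v | ∃ f o, M.Overflow G s t f o ∧ v = M.gain x κ G s t f o}

variable {M} {x : H → ℝ} {κ : ℝ}

omit [Fintype H] in
theorem len_eq_sum [Fintype H] {p : List H} (hp : p.Nodup) (y : H → ℝ) :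
    len y p = ∑ a, (if a ∈ p then 1 else 0) * y a := by
  simp only [ite_mul, one_mul, zero_mul]
  rw [← Finset.sum_filter, len, ← List.sum_toFinset _ hp]
  congr 1
  ext a
  simp

theorem sum_load_mul (f : List H → ℝ) (y : H → ℝ) :
    ∑ a, M.load G s t f a * y a = ∑ p ∈ M.paths G s t, f p * len y p := by
  simp only [load, Finset.sum_mul]
  rw [Finset.sum_comm]
  refine Finset.sum_congr rfl fun p hp => ?_
  rw [len_eq_sum (mem_paths.1 hp).2.of_map, Finset.mul_sum]
  exact Finset.sum_congr rfl fun a _ => by ring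

theorem Overflow.gain_le {f : List H → ℝ} {o : H → ℝ} (h : M.Overflow G s t f o) (hx : 0 ≤ x)
    (hκ : 1 ≤ κ) (hfar : M.Far G x s t 1) : M.gain x κ G s t f o ≤ lov M.tot x := by
  have h1 := sum_mul_le_lov M.tot_poly h.cap hx
  have h2 : ∑ p ∈ M.paths G s t, f p ≤ ∑ a, M.load G s t f a * x a := by
    rw [sum_load_mul]
    exact Finset.sum_le_sum fun p hp =>
      le_mul_of_one_le_right (h.flow_nonneg p) (hfar p (mem_paths.1 hp).1)
  have h3 : 0 ≤ ∑ a, x a * o a := Finset.sum_nonneg fun a _ => mul_nonneg (hx a) (h.over_nonneg a)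
  have h4 : ∑ a, (M.load G s t f a - o a) * x a =
      ∑ a, M.load G s t f a * x a - ∑ a, x a * o a := by
    rw [← Finset.sum_sub_distrib]
    exact Finset.sum_congr rfl fun a _ => by ring
  unfold gain
  nlinarith

theorem overflow_zero : M.Overflow G s t 0 0 := by
  refine ⟨fun _ => le_rfl, fun _ => le_rfl, fun S => ?_⟩
  simpa [load] using M.tot_poly.nonneg S

theorem bddAbove_gain (hx : 0 ≤ x) (hκ : 1 ≤ κ) (hfar : M.Far G x s t 1) :
    BddAbove {v | ∃ f o, M.Overflow G s t f o ∧ v = M.gain x κ G s t f o} :=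
  ⟨lov M.tot x, by rintro v ⟨f, o, h, rfl⟩; exact h.gain_le hx hκ hfar⟩

theorem gain_zero_mem : (0 : ℝ) ∈ {v | ∃ f o, M.Overflow G s t f o ∧ v = M.gain x κ G s t f o} :=
  ⟨0, 0, overflow_zero, by simp [gain]⟩

theorem Overflow.gain_le_opt {f : List H → ℝ} {o : H → ℝ} (h : M.Overflow G s t f o) (hx : 0 ≤ x)
    (hκ : 1 ≤ κ) (hfar : M.Far G x s t 1) : M.gain x κ G s t f o ≤ M.opt x κ G s t :=
  le_csSup (bddAbove_gain hx hκ hfar) ⟨f, o, h, rfl⟩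

theorem opt_nonneg (hx : 0 ≤ x) (hκ : 1 ≤ κ) (hfar : M.Far G x s t 1) : 0 ≤ M.opt x κ G s t :=
  le_csSup (bddAbove_gain hx hκ hfar) gain_zero_mem

theorem opt_le_lov (hx : 0 ≤ x) (hκ : 1 ≤ κ) (hfar : M.Far G x s t 1) :
    M.opt x κ G s t ≤ lov M.tot x := by
  refine csSup_le ⟨0, gain_zero_mem⟩ ?_
  rintro v ⟨f, o, h, rfl⟩
  exact h.gain_le hx hκ hfar

theorem opt_mono {G' : Finset H} (hG : G ⊆ G') (hx : 0 ≤ x) (hκ : 1 ≤ κ)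
    (hfar : M.Far G' x s t 1) : M.opt x κ G s t ≤ M.opt x κ G' s t := by
  refine csSup_le ⟨0, gain_zero_mem⟩ ?_
  rintro v ⟨f, o, h, rfl⟩
  have key : ∀ g : List H → ℝ, ∑ p ∈ M.paths G' s t,
      (if p ∈ M.paths G s t then f p else 0) * g p = ∑ p ∈ M.paths G s t, f p * g p := fun g => by
    simp only [ite_mul, zero_mul]
    rw [← Finset.sum_filter, Finset.filter_mem_eq_inter,
      Finset.inter_eq_right.2 (paths_mono hG s t)]
  have h' : M.Overflow G' s t (fun p => if p ∈ M.paths G s t then f p else 0) o := by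
    refine ⟨fun p => ?_, h.over_nonneg, fun S => ?_⟩
    · split_ifs
      exacts [h.flow_nonneg p, le_rfl]
    · refine le_trans (le_of_eq (Finset.sum_congr rfl fun a _ => ?_)) (h.cap S)
      rw [load, key, load]
  refine le_trans (le_of_eq ?_) (h'.gain_le_opt hx hκ hfar)
  have := key fun _ => 1
  simp only [mul_one] at this
  rw [gain, gain, this]

theorem exists_dual (hx : 0 ≤ x) (hκ : 1 ≤ κ) (hfar : M.Far G x s t 1) :
    ∃ y : H → ℝ, 0 ≤ y ∧ (∀ a, y a ≤ κ * x a) ∧ M.Far G y s t 1 ∧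
      lov M.tot y ≤ M.opt x κ G s t := by
  let A : Finset H → (M.paths G s t) ⊕ H → ℝ := fun S => Sum.elim
    (fun p => ∑ a ∈ S, if a ∈ p.1 then 1 else 0) (fun a => -(if a ∈ S then 1 else 0))
  let c : (M.paths G s t) ⊕ H → ℝ := Sum.elim (fun _ => 1) (fun a => -(κ * x a))
  obtain ⟨z, hz, hc, hb⟩ := exists_dual_of_bounded A M.tot c (M.opt x κ G s t) 0 (fun _ => le_rfl)
    (fun S => by simpa using M.tot_poly.nonneg S) (fun u hu hcap => by
      let f : List H → ℝ := fun p => if hp : p ∈ M.paths G s t then u (Sum.inl ⟨p, hp⟩) else 0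
      let o : H → ℝ := fun a => u (Sum.inr a)
      have hsum : ∀ g : List H → ℝ, ∑ p ∈ M.paths G s t, f p * g p =
          ∑ p : M.paths G s t, u (Sum.inl p) * g p := fun g => by
        rw [← Finset.sum_attach]
        refine Finset.sum_congr rfl fun p _ => ?_
        simp only [f]
        rw [dif_pos p.2]
      have h : M.Overflow G s t f o := by
        refine ⟨fun p => ?_, fun a => hu _, fun S => le_trans (le_of_eq ?_) (hcap S)⟩
        · simp only [f]
          split_ifs
          exacts [hu _, le_rfl]
        · simp only [A, Fintype.sum_sum_type, Sum.elim_inl, Sum.elim_inr, load, hsum,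
            Finset.sum_sub_distrib, Finset.sum_mul]
          rw [Finset.sum_comm, sub_eq_add_neg]
          congr 1
          · exact Finset.sum_congr rfl fun p _ => Finset.sum_congr rfl fun a _ => mul_comm _ _
          · simp [o, Finset.sum_ite_mem]
      refine le_trans (le_of_eq ?_) (h.gain_le_opt hx hκ hfar)
      have := hsum fun _ => 1
      simp only [mul_one] at this
      simp only [c, Fintype.sum_sum_type, Sum.elim_inl, Sum.elim_inr, gain, this, one_mul, o,
        Finset.mul_sum, neg_mul, Finset.sum_neg_distrib, mul_assoc]
      ring)
  refine ⟨fun a => ∑ S, z S * (if a ∈ S then 1 else 0), fun a => ?_, fun a => ?_, ?_, ?_⟩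
  · exact Finset.sum_nonneg fun S _ => mul_nonneg (hz S) (by split_ifs <;> norm_num)
  · have := hc (Sum.inr a)
    simp only [c, A, Sum.elim_inr, mul_neg, Finset.sum_neg_distrib, neg_le_neg_iff] at this
    exact this
  · refine far_of_paths (fun a => Finset.sum_nonneg fun S _ =>
      mul_nonneg (hz S) (by split_ifs <;> norm_num)) fun p hp => ?_
    have := hc (Sum.inl ⟨p, hp⟩)
    simp only [c, A, Sum.elim_inl] at this
    refine this.trans (le_of_eq ?_)
    rw [len_eq_sum (mem_paths.1 hp).2.of_map]
    simp only [Finset.mul_sum]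
    rw [Finset.sum_comm]
    refine Finset.sum_congr rfl fun S _ => ?_
    rw [← Finset.sum_subset (Finset.subset_univ S) fun a _ ha => by rw [if_neg ha]; ring]
    exact Finset.sum_congr rfl fun a ha => by rw [if_pos ha]; ring
  · exact (lov_sum_indicator_le M.tot_poly (fun S => hz S) univ).trans hb

end ArcNet

namespace ArcNet

variable {X H B : Type*} [Fintype H] [Fintype B] (M : ArcNet X H B)

/-- The part of the increase along `p` that is charged to the arc `a` when the arc is used at
rate `g a` out of `load a`. -/
noncomputable def charge (π : X → ℝ) (s : X) (y g ld : H → ℝ) (p : List H) (a : H) : ℝ :=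
  max (y a * (g a / ld a) - (y a - M.rise π s p a)) 0

noncomputable def blockCharge (π : X → ℝ) (s : X) (y g ld : H → ℝ) (p : List H) (b : B) : ℝ :=
  ∑ a, if M.own a = b then M.charge π s y g ld p a else 0

variable {M} {G : Finset H} {π : X → ℝ} {s t : X} {p : List H} {y g ld : H → ℝ}

theorem charge_nonneg (a : H) : 0 ≤ M.charge π s y g ld p a := le_max_right _ _

theorem charge_le (hy : 0 ≤ y) (hg : 0 ≤ g) (hgl : g ≤ ld) (a : H) :
    M.charge π s y g ld p a ≤ M.rise π s p a := by
  have h1 : g a / ld a ≤ 1 := div_le_one_of_le₀ (hgl a) ((hg a).trans (hgl a))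
  have h2 := mul_le_mul_of_nonneg_left h1 (hy a)
  refine max_le ?_ (rise_nonneg _ _ _ _)
  linarith

theorem charge_le_mul (h : M.rise π s p a ≤ y a) (hy : 0 ≤ y a) (hq : 0 ≤ g a / ld a) :
    M.charge π s y g ld p a ≤ y a * (g a / ld a) :=
  max_le (by linarith) (mul_nonneg hy hq)

theorem blockCharge_nonneg (b : B) : 0 ≤ M.blockCharge π s y g ld p b :=
  Finset.sum_nonneg fun a _ => by split_ifs; exacts [charge_nonneg a, le_rfl]

theorem sum_blockCharge : ∑ b, M.blockCharge π s y g ld p b = ∑ a, M.charge π s y g ld p a := by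
  unfold blockCharge
  rw [Finset.sum_comm]
  exact Finset.sum_congr rfl fun a _ => by simp

theorem exists_of_blockCharge_pos (hy : 0 ≤ y) (hg : 0 ≤ g) (hgl : g ≤ ld) {b : B}
    (h : 0 < M.blockCharge π s y g ld p b) : ∃ a, M.own a = b ∧ 0 < M.rise π s p a := by
  by_contra hc
  push Not at hc
  refine h.not_ge (Finset.sum_nonpos fun a _ => ?_)
  split_ifs with e
  · exact (charge_le hy hg hgl a).trans (hc a e)
  · exact le_rfl

/-- A near-optimal flow for the capped program, with its charges, relative to a potential. -/
theorem exists_round {x : H → ℝ} {κ A ε : ℝ} (hx : 0 ≤ x) (hκ : 2 ≤ κ)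
    (hfar : M.Far G x s t 1) (hpos : 0 < M.opt x κ G s t)
    (hhalf : M.opt x (κ / 2) G s t ≤ A * M.opt x κ G s t)
    (hy : 0 ≤ y) (hyx : ∀ a, y a ≤ κ * x a) (hε : ∀ a, y a ≤ ε) (h0 : ∀ u, 0 ≤ π u)
    (hs : π s = 0) (hπ : ∀ a ∈ G, π (M.dst a) ≤ π (M.src a) + y a)
    (ht : π t = 1) :
    ∃ (f : List H → ℝ) (ψ : List H → B → ℝ),
      (∀ p, 0 ≤ f p) ∧ (∀ p b, 0 ≤ ψ p b) ∧
      (∀ p ∈ M.paths G s t, ∀ a b, 0 < ψ p a → 0 < ψ p b →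
        ε < π (M.node b) - π (M.node a) → M.Reach G (M.node a) (M.node b)) ∧
      (∀ p ∈ M.paths G s t, ∀ r τ, 0 ≤ τ →
        ∑ a, (if r ≤ π (M.node a) ∧ π (M.node a) ≤ r + τ then ψ p a else 0) ≤ τ + 3 * ε) ∧
      (∀ p ∈ M.paths G s t, ∑ a, ψ p a ≤ 1) ∧
      (∀ a, ∑ p ∈ M.paths G s t, f p * ψ p a ≤ κ * lov (M.cost a) x) ∧
      M.opt x κ G s t / 2 ≤ ∑ p ∈ M.paths G s t, f p * ∑ a, ψ p a ∧
      ∑ p ∈ M.paths G s t, f p ≤ 3 * A * M.opt x κ G s t := by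
  have hκ1 : 1 ≤ κ := by linarith
  have hκ2 : 1 ≤ κ / 2 := by linarith
  obtain ⟨v, ⟨f, o, hfo, rfl⟩, hv⟩ := exists_lt_of_lt_csSup
    (⟨0, gain_zero_mem⟩ : {v | ∃ f o, M.Overflow G s t f o ∧ v = M.gain x κ G s t f o}.Nonempty)
    (show M.opt x κ G s t / 2 < M.opt x κ G s t by linarith)
  set P := M.paths G s t with hP
  set ld := M.load G s t f with hld
  let g : H → ℝ := fun a => max (ld a - o a) 0
  have hld0 : ∀ a, 0 ≤ ld a := fun a => Finset.sum_nonneg fun p _ =>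
    mul_nonneg (hfo.flow_nonneg p) (by split_ifs <;> norm_num)
  have hg : 0 ≤ g := fun a => le_max_right _ _
  have hgl : g ≤ ld := fun a => max_le (by linarith [hfo.over_nonneg a]) (hld0 a)
  have hgo : ∀ a, ld a - g a ≤ o a := fun a => by
    have : ld a - o a ≤ g a := le_max_left _ _
    linarith
  have hcap : ∀ S, ∑ a ∈ S, g a ≤ M.tot S := fun S => by
    have e : ∑ a ∈ S, g a = ∑ a ∈ S.filter (fun a => 0 ≤ ld a - o a), (ld a - o a) := by
      rw [Finset.sum_filter]
      refine Finset.sum_congr rfl fun a _ => ?_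
      simp only [g]
      split_ifs with h
      · exact max_eq_left h
      · exact max_eq_right (not_le.1 h).le
    rw [e]
    exact (hfo.cap _).trans (M.tot_poly.mono _ _ (Finset.filter_subset _ _))
  have hcapb : ∀ b S, ∑ a ∈ S, (if M.own a = b then g a else 0) ≤ M.cost b S := fun b S => by
    rw [← Finset.sum_filter, M.cost_local b]
    refine (hcap _).trans (le_of_eq (Finset.sum_eq_single b (fun b' _ hb' => ?_) (by simp)))
    rw [M.cost_local b', Finset.filter_filter, ← (M.cost_poly b').empty]
    congr 1
    refine Finset.filter_eq_empty_iff.2 fun a _ h => hb' (h.2.symm.trans h.1)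
  have hrise : ∀ p ∈ P, ∀ a, M.rise π s p a ≤ y a := fun p hp a =>
    (mem_paths.1 hp).1.rise_le hy hπ (mem_paths.1 hp).2.of_map a
  have hsum1 : ∀ p ∈ P, ∑ a, M.rise π s p a = 1 := fun p hp => by
    rw [(mem_paths.1 hp).1.sum_rise, ht, le_antisymm ((M.futureMin_le π s p).trans hs.le)
      (futureMin_nonneg h0 s p), sub_zero]
  have hq : ∀ a, 0 ≤ g a / ld a := fun a => div_nonneg (hg a) (hld0 a)
  have hxo : 0 ≤ ∑ a, x a * o a :=
    Finset.sum_nonneg fun a _ => mul_nonneg (hx a) (hfo.over_nonneg a)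
  have hyo : ∑ a, (ld a - g a) * y a ≤ κ * ∑ a, x a * o a := by
    rw [Finset.mul_sum]
    refine Finset.sum_le_sum fun a _ => ?_
    calc _ ≤ o a * (κ * x a) := mul_le_mul (hgo a) (hyx a) (hy a) (hfo.over_nonneg a)
      _ = _ := by ring
  have hldg : ∀ a, ld a * (y a * (g a / ld a)) = g a * y a := fun a => by
    rcases (hld0 a).eq_or_lt with h | h
    · have : g a = 0 := le_antisymm ((hgl a).trans h.symm.le) (hg a)
      rw [this, ← h]; simp
    · field_simp
  refine ⟨f, fun p => M.blockCharge π s y g ld p, hfo.flow_nonneg, fun p b => blockCharge_nonneg b,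
    ?_, ?_, ?_, ?_, ?_, ?_⟩
  · intro p hp a b ha hb hab
    obtain ⟨a', rfl, ha'⟩ := exists_of_blockCharge_pos hy hg hgl ha
    obtain ⟨b', rfl, hb'⟩ := exists_of_blockCharge_pos hy hg hgl hb
    exact (mem_paths.1 hp).1.reach_of_rise hy hε hπ ha' hb' hab
  · intro p hp r τ hτ
    have hw := (mem_paths.1 hp).1.sum_rise_window hy hε hπ r (r + τ)
    have e : ∑ b, (if r ≤ π (M.node b) ∧ π (M.node b) ≤ r + τ then M.blockCharge π s y g ld p b
        else 0) = ∑ a, (if r ≤ π (M.node (M.own a)) ∧ π (M.node (M.own a)) ≤ r + τ then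
          M.charge π s y g ld p a else 0) := by
      unfold blockCharge
      simp only [← Finset.sum_filter]
      rw [Finset.sum_comm' (t' := univ.filter fun a => r ≤ π (M.node (M.own a)) ∧
        π (M.node (M.own a)) ≤ r + τ) (s' := fun a => {M.own a})]
      · simp
      · intro b a
        simp only [mem_filter, mem_univ, true_and, mem_singleton]
        constructor
        · rintro ⟨h, rfl⟩; exact ⟨rfl, h⟩
        · rintro ⟨rfl, h⟩; exact ⟨h, rfl⟩
    rw [e]
    have e2 : ∑ a, (if r ≤ π (M.node (M.own a)) ∧ π (M.node (M.own a)) ≤ r + τ then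
          M.charge π s y g ld p a else 0) ≤
        ∑ a, (if r ≤ π (M.node (M.own a)) ∧ π (M.node (M.own a)) ≤ r + τ then
          M.rise π s p a else 0) := Finset.sum_le_sum fun a _ => by
      split_ifs
      exacts [charge_le hy hg hgl a, le_rfl]
    have e3 : ∀ u, max (r - ε) (min (r + τ + ε) u) ≤ max (r - ε) (r + τ + ε) := fun u =>
      max_le_max le_rfl (min_le_left _ _)
    by_cases hε0 : 0 ≤ ε
    · have e4 : max (r - ε) (r + τ + ε) = r + τ + ε := max_eq_right (by linarith)
      have := e3 (π t)
      have := le_max_left (r - ε) (min (r + τ + ε) (M.futureMin π s p))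
      linarith
    · have hem : IsEmpty H := ⟨fun a => hε0 ((hy a).trans (hε a))⟩
      exfalso
      rw [hP, mem_paths] at hp
      cases p with
      | nil => exact absurd (hs.symm.trans ((congrArg π hp.1).trans ht)) zero_ne_one
      | cons a p => exact hem.elim a
  · intro p hp
    rw [sum_blockCharge, ← hsum1 p hp]
    exact Finset.sum_le_sum fun a _ => charge_le hy hg hgl a
  · intro b
    have k1 := sum_mul_le_lov (M.cost_poly b) (hcapb b) hy
    have k2 : lov (M.cost b) y ≤ κ * lov (M.cost b) x := by
      rw [← lov_smul x (by linarith : 0 < κ)]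
      exact lov_mono (M.cost_poly b) hyx
    refine le_trans ?_ (k1.trans k2)
    calc ∑ p ∈ P, f p * M.blockCharge π s y g ld p b
        ≤ ∑ p ∈ P, f p * ∑ a, (if M.own a = b then (if a ∈ p then 1 else 0) *
            (y a * (g a / ld a)) else 0) := by
          refine Finset.sum_le_sum fun p hp => mul_le_mul_of_nonneg_left ?_ (hfo.flow_nonneg p)
          refine Finset.sum_le_sum fun a _ => ?_
          split_ifs with e1 e2
          · rw [one_mul]; exact charge_le_mul (hrise p hp a) (hy a) (hq a)
          · rw [zero_mul]
            exact (charge_le hy hg hgl a).trans (rise_eq_zero _ _ e2).le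
          · exact le_rfl
      _ = ∑ a, (if M.own a = b then ld a * (y a * (g a / ld a)) else 0) := by
          simp only [Finset.mul_sum]
          rw [Finset.sum_comm]
          refine Finset.sum_congr rfl fun a _ => ?_
          split_ifs
          · rw [hld, load, Finset.sum_mul]
            exact Finset.sum_congr rfl fun p _ => by ring
          · simp
      _ = _ := by
          refine Finset.sum_congr rfl fun a _ => ?_
          rw [hldg]
          split_ifs <;> simp
  · refine le_trans hv.le ?_
    calc M.gain x κ G s t f o ≤ ∑ p ∈ P, f p - ∑ a, (ld a - g a) * y a := by
          unfold gain; linarith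
      _ = ∑ p ∈ P, f p * ∑ a, (if a ∈ p then (y a * (g a / ld a) - (y a - M.rise π s p a))
            else 0) := by
          have i1 : ∑ p ∈ P, f p * ∑ a, (if a ∈ p then (y a * (g a / ld a) -
              (y a - M.rise π s p a)) else 0) =
              ∑ p ∈ P, (f p * ∑ a, M.rise π s p a + ∑ a, f p * (if a ∈ p then 1 else 0) *
                (y a * (g a / ld a) - y a)) := by
            refine Finset.sum_congr rfl fun p _ => ?_
            rw [Finset.mul_sum, Finset.mul_sum, ← Finset.sum_add_distrib]
            refine Finset.sum_congr rfl fun a _ => ?_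
            split_ifs with e
            · ring
            · rw [rise_eq_zero _ _ e]; ring
          rw [i1, Finset.sum_add_distrib, Finset.sum_comm (s := P), sub_eq_add_neg,
            ← Finset.sum_neg_distrib]
          congr 1
          · exact Finset.sum_congr rfl fun p hp => by rw [hsum1 p hp, mul_one]
          · refine Finset.sum_congr rfl fun a _ => ?_
            rw [← Finset.sum_mul]
            have := hldg a
            rw [show ∑ p ∈ P, f p * (if a ∈ p then (1 : ℝ) else 0) = ld a from rfl, mul_sub, this]
            ring
      _ ≤ _ := by
          refine Finset.sum_le_sum fun p _ => mul_le_mul_of_nonneg_left ?_ (hfo.flow_nonneg p)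
          rw [sum_blockCharge]
          refine Finset.sum_le_sum fun a _ => ?_
          split_ifs
          exacts [le_max_left _ _, charge_nonneg a]
  · have j1 := hfo.gain_le_opt hx hκ2 hfar
    have j2 := hfo.gain_le_opt hx hκ1 hfar
    unfold gain at j1 j2 hv
    nlinarith

end ArcNet

namespace ArcNet
variable {X H B : Type*} [Fintype H] [Fintype B] (M : ArcNet X H B)

/-- The total weight `m` of the pairs of blocks still connected in `G`. -/
noncomputable def pairSum (m : B → B → ℝ) (G : Finset H) : ℝ :=
  ∑ a, ∑ b, if M.Reach G (M.node a) (M.node b) then m a b else 0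

/-- The forward potential difference between two blocks. -/
noncomputable def gap (π : X → ℝ) (a b : B) : ℝ := max (π (M.node b) - π (M.node a)) 0

variable {M} {G G' : Finset H}

theorem gap_nonneg (π : X → ℝ) (a b : B) : 0 ≤ M.gap π a b := le_max_right _ _

theorem gap_le_one {π : X → ℝ} (h0 : ∀ u, 0 ≤ π u) (h1 : ∀ u, π u ≤ 1) (a b : B) :
    M.gap π a b ≤ 1 := max_le (by linarith [h0 (M.node a), h1 (M.node b)]) zero_le_one

theorem pairSum_mono {m m' : B → B → ℝ} (h : ∀ a b, m a b ≤ m' a b) :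
    M.pairSum m G ≤ M.pairSum m' G :=
  Finset.sum_le_sum fun a _ => Finset.sum_le_sum fun b _ => by
    split_ifs
    exacts [h a b, le_rfl]

theorem pairSum_nonneg {m : B → B → ℝ} (h : ∀ a b, 0 ≤ m a b) : 0 ≤ M.pairSum m G :=
  Finset.sum_nonneg fun a _ => Finset.sum_nonneg fun b _ => by
    split_ifs
    exacts [h a b, le_rfl]

theorem le_pairSum {m : B → B → ℝ} (h : ∀ a b, 0 ≤ m a b) {a b : B}
    (hr : M.Reach G (M.node a) (M.node b)) : m a b ≤ M.pairSum m G := by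
  have key : ∀ a b, 0 ≤ if M.Reach G (M.node a) (M.node b) then m a b else 0 := fun a b => by
    split_ifs
    exacts [h a b, le_rfl]
  calc m a b = if M.Reach G (M.node a) (M.node b) then m a b else 0 := by rw [if_pos hr]
    _ ≤ ∑ b, if M.Reach G (M.node a) (M.node b) then m a b else 0 :=
        Finset.single_le_sum (f := fun b => if M.Reach G (M.node a) (M.node b) then m a b else 0)
          (fun b _ => key a b) (Finset.mem_univ b)
    _ ≤ _ := Finset.single_le_sum
        (f := fun a => ∑ b, if M.Reach G (M.node a) (M.node b) then m a b else 0)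
        (fun a _ => Finset.sum_nonneg fun b _ => key a b) (Finset.mem_univ a)

theorem pairSum_add (m m' : B → B → ℝ) :
    M.pairSum (fun a b => m a b + m' a b) G = M.pairSum m G + M.pairSum m' G := by
  simp only [pairSum, ← Finset.sum_add_distrib]
  refine Finset.sum_congr rfl fun a _ => Finset.sum_congr rfl fun b _ => ?_
  split_ifs <;> simp

/-- A level cut that separates at least the average amount of weight. -/
theorem exists_cut {y : H → ℝ} {π : X → ℝ} (h0 : ∀ u, 0 ≤ π u) (h1 : ∀ u, π u ≤ 1)
    (hG : ∀ a ∈ G, π (M.dst a) ≤ π (M.src a) + y a) {γ : ℝ} (hγ : 0 ≤ γ) {m : B → B → ℝ}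
    (hm : ∀ a b, 0 ≤ m a b) :
    ∃ C ⊆ G, γ * M.tot C + M.pairSum m (G \ C) + M.pairSum (fun a b => m a b * M.gap π a b) G ≤
        γ * lov M.tot y + M.pairSum m G ∧
      ∀ u v, π u = 0 → π v = 1 → ¬ M.Reach (G \ C) u v := by
  obtain ⟨r, ⟨hr0, hr1⟩, hr⟩ := exists_level (M := M) h0 h1 hG hγ
    (m := fun a b => if M.Reach G (M.node a) (M.node b) then m a b else 0) (fun a b => by
      split_ifs
      exacts [hm a b, le_rfl])
  refine ⟨M.cutAt π G r, Finset.filter_subset _ _, ?_, fun u v hu hv =>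
    not_reach_of_cutAt (by rw [hu]; exact hr0.le) (by rw [hv]; exact hr1)⟩
  have e1 : M.pairSum (fun a b => m a b * M.gap π a b) G =
      ∑ a, ∑ b, (if M.Reach G (M.node a) (M.node b) then m a b else 0) *
        max (π (M.node b) - π (M.node a)) 0 := by
    refine Finset.sum_congr rfl fun a _ => Finset.sum_congr rfl fun b _ => ?_
    split_ifs <;> simp [gap]
  have e2 : M.pairSum m (G \ M.cutAt π G r) +
      ∑ a, ∑ b, (if M.Reach G (M.node a) (M.node b) then m a b else 0) *
        (if π (M.node a) ≤ r ∧ r < π (M.node b) then 1 else 0) ≤ M.pairSum m G := by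
    simp only [pairSum, ← Finset.sum_add_distrib]
    refine Finset.sum_le_sum fun a _ => Finset.sum_le_sum fun b _ => ?_
    by_cases hc : π (M.node a) ≤ r ∧ r < π (M.node b)
    · rw [if_neg (not_reach_of_cutAt hc.1 hc.2), if_pos hc]
      simp
    · rw [if_neg hc, mul_zero, add_zero]
      by_cases h' : M.Reach (G \ M.cutAt π G r) (M.node a) (M.node b)
      · rw [if_pos h', if_pos (h'.mono Finset.sdiff_subset)]
      · rw [if_neg h']
        split_ifs
        exacts [hm a b, le_rfl]
  linarith

theorem tot_sdiff_le (C G G' : Finset H) :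
    M.tot (G \ G') ≤ M.tot ((G \ C) \ G') + M.tot C :=
  (M.tot_poly.mono _ ((G \ C) \ G' ∪ C) fun a ha => by
    simp only [mem_sdiff, mem_union] at *
    tauto).trans (M.tot_poly.union_le _ _)

variable (M) in
/-- No feasible potential on `G` separates more than `Θ` times its cost of the weight `w`. -/
def NonFat (w : B → ℝ) (Θ : ℝ) (G : Finset H) : Prop :=
  ∀ (y : H → ℝ) (π : X → ℝ), (∀ u, 0 ≤ π u) → (∀ u, π u ≤ 1) →
    (∀ a ∈ G, π (M.dst a) ≤ π (M.src a) + y a) →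
    M.pairSum (fun a b => w a * w b * M.gap π a b) G ≤ Θ * lov M.tot y

theorem exists_nonFat {w : B → ℝ} (hw : ∀ a, 0 ≤ w a) {Θ : ℝ} (hΘ : 0 ≤ Θ) (G : Finset H) :
    ∃ G' ⊆ G, M.NonFat w Θ G' ∧
      Θ * M.tot (G \ G') + M.pairSum (fun a b => w a * w b) G' ≤
        M.pairSum (fun a b => w a * w b) G := by
  induction G using Finset.strongInduction with
  | H G ih =>
    by_cases hG : M.NonFat w Θ G
    · exact ⟨G, Finset.Subset.refl _, hG, by simp [M.tot_poly.empty]⟩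
    simp only [NonFat, not_forall, not_le] at hG
    obtain ⟨y, π, h0, h1, hp, hlt⟩ := hG
    obtain ⟨C, hC, hcut, -⟩ := exists_cut h0 h1 hp hΘ (m := fun a b => w a * w b)
      fun a b => mul_nonneg (hw a) (hw b)
    have hne : G \ C ⊂ G := by
      refine Finset.sdiff_ssubset hC (Finset.nonempty_iff_ne_empty.2 fun h => ?_)
      rw [h, M.tot_poly.empty, Finset.sdiff_empty] at hcut
      linarith
    obtain ⟨G', hG', hn, hb⟩ := ih _ hne
    refine ⟨G', hG'.trans Finset.sdiff_subset, hn, ?_⟩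
    have h3 := mul_le_mul_of_nonneg_left (tot_sdiff_le (M := M) C G G') hΘ
    linarith

theorem opt_le_zero {x : H → ℝ} {κ : ℝ} (hx : 0 ≤ x) (hκ : 0 ≤ κ) {s t : X}
    (h : ¬ M.Reach G s t) : M.opt x κ G s t ≤ 0 := by
  refine csSup_le ⟨0, gain_zero_mem⟩ ?_
  rintro v ⟨f, o, hfo, rfl⟩
  have he : M.paths G s t = ∅ := Finset.eq_empty_of_forall_notMem fun p hp =>
    h ⟨p, (mem_paths.1 hp).1⟩
  rw [gain, he, Finset.sum_empty, zero_sub, neg_nonpos]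
  exact mul_nonneg hκ (Finset.sum_nonneg fun a _ => mul_nonneg (hx a) (hfo.over_nonneg a))

variable (M) in
/-- Numerical data under which the rounds of routing have total value less than `α`. -/
structure Regime where
  x : H → ℝ
  s : ℕ
  A : ℝ
  ε : ℝ
  α : ℝ
  Λ : ℝ
  η : ℝ
  x_nonneg : 0 ≤ x
  x_le : ∀ a, 2 ^ s * x a ≤ ε
  lov_le : lov M.tot x ≤ 1
  one_le_A : 1 ≤ A
  ε_pos : 0 < ε
  α_pos : 0 < α
  Λ_pos : 0 < Λ
  A_pow : (Fintype.card B : ℝ) ^ 2 ≤ A ^ s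
  ε_le : ε ≤ 1 / (600 * A)
  ε_lt : ε < η
  win : 2 * η + 3 * ε ≤
    (1 / (400 * A) / (576 * A * ε * 2 ^ s * Λ)) * α / (384 * A * Fintype.card B)
  moment : 294912 * A ^ 2 * (Fintype.card B : ℝ) ^ 2 *
      (64 * 2 ^ s * (1 / α) / (1 / (128 * A) * (1 / (128 * A)))) <
    (1 / (400 * A) / (576 * A * ε * 2 ^ s * Λ)) ^ 2 * α ^ 2
  spread : 589824 * A * (Fintype.card B : ℝ) ^ 3 *
      (64 * 2 ^ s * (1 / α) / (1 / (128 * A) * (1 / (128 * A)))) * ε * 2 ^ s * (Λ / η) <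
    (1 / (400 * A) / (576 * A * ε * 2 ^ s * Λ)) ^ 2 * α ^ 3
  le_Λ : Real.logb 2 ((Fintype.card B : ℝ) ^ 2 * (1 + 2 * α)) + 1 ≤ Λ

/-- One round: a pair of nodes in a graph, a scale and a potential. -/
structure Step (X H : Type*) where
  gr : Finset H
  s : X
  t : X
  i : ℕ
  y : H → ℝ
  π : X → ℝ

namespace Regime
variable (P : M.Regime) (G₀ : Finset H)

noncomputable def val (R : Step X H) : ℝ := M.opt P.x (2 ^ R.i) R.gr R.s R.t

/-- The round `R` takes place inside `G₀`. -/
structure OK (R : Step X H) : Prop where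
  sub : R.gr ⊆ G₀
  far : M.Far R.gr P.x R.s R.t 1
  one_le : 1 ≤ R.i
  le_s : R.i ≤ P.s
  pos : 0 < P.val R
  half : M.opt P.x (2 ^ R.i / 2) R.gr R.s R.t ≤ P.A * P.val R
  y_nonneg : 0 ≤ R.y
  y_le : ∀ a, R.y a ≤ 2 ^ R.i * P.x a
  lov_le : lov M.tot R.y ≤ 2 * P.val R
  π_nonneg : ∀ u, 0 ≤ R.π u
  π_le : ∀ u, R.π u ≤ 1
  π_s : R.π R.s = 0
  π_t : R.π R.t = 1
  pot : ∀ a ∈ G₀, R.π (M.dst a) ≤ R.π (M.src a) + R.y a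

variable {P G₀}

theorem sum_val_lt [Nonempty B] {K : Type} [Fintype K] {R : K → Step X H}
    (hR : ∀ k, P.OK G₀ (R k)) (hfat : M.NonFat (fun b => lov (M.cost b) P.x) (1 / P.α) G₀)
    (hlife : ∀ a b, ∑ k, (if M.Reach (R k).gr (M.node a) (M.node b) then M.gap (R k).π a b else 0)
      ≤ P.Λ) : ∑ k, P.val (R k) < P.α := by
  have hpow : ∀ k, (2 : ℝ) ≤ 2 ^ (R k).i := fun k => by
    simpa using pow_le_pow_right₀ (by norm_num : (1 : ℝ) ≤ 2) (hR k).one_le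
  have hpow' : ∀ k, (2 : ℝ) ^ (R k).i ≤ 2 ^ P.s := fun k =>
    pow_le_pow_right₀ (by norm_num : (1 : ℝ) ≤ 2) (hR k).le_s
  have hround := fun k => exists_round (M := M) P.x_nonneg (hpow k) (hR k).far (hR k).pos
    (hR k).half (hR k).y_nonneg (hR k).y_le (ε := P.ε)
    (fun a => ((hR k).y_le a).trans ((mul_le_mul_of_nonneg_right (hpow' k) (P.x_nonneg a)).trans
      (P.x_le a))) (hR k).π_nonneg (hR k).π_s (fun a ha => (hR k).pot a ((hR k).sub ha)) (hR k).π_t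
  choose f ψ hf hψ hord hwin hψs hload hmass hflow using hround
  let S : ThinSystem B K (Σ k, {p // p ∈ M.paths (R k).gr (R k).s (R k).t}) :=
    { w := fun b => lov (M.cost b) P.x
      reach := fun a b => M.Reach G₀ (M.node a) (M.node b)
      pot := fun k b => (R k).π (M.node b)
      alive := fun k a b => M.Reach (R k).gr (M.node a) (M.node b)
      val := fun k => P.val (R k)
      rd := fun q => q.1
      f := fun q => f q.1 q.2
      ψ := fun q => ψ q.1 q.2
      ε := P.ε
      h := 2 ^ P.s
      A := P.A
      Θ := 1 / P.α
      L := P.Λ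
      ε_pos := P.ε_pos
      h_pos := by positivity
      one_le_A := P.one_le_A
      Θ_pos := by have := P.α_pos; positivity
      L_pos := P.Λ_pos
      w_nonneg := fun b => lov_nonneg (M.cost_poly b) _
      w_sum := by rw [← M.lov_tot]; exact P.lov_le
      reach_trans := fun a b c => Reach.trans
      alive_reach := fun k a b h => h.mono (hR k).sub
      val_nonneg := fun k => (hR k).pos.le
      f_nonneg := fun q => hf _ _
      ψ_nonneg := fun q a => hψ _ _ _
      ordered := fun q a b => hord q.1 q.2 q.2.2 a b
      window := fun q => hwin q.1 q.2 q.2.2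
      ψ_sum := fun q => hψs q.1 q.2 q.2.2
      load := fun k a => by
        rw [Fintype.sum_sigma, Finset.sum_eq_single k]
        · simp only [if_true]
          rw [Finset.sum_coe_sort (M.paths (R k).gr (R k).s (R k).t)
            (fun p => f k p * ψ k p a)]
          exact (hload k a).trans (mul_le_mul_of_nonneg_right (hpow' k)
            (lov_nonneg (M.cost_poly a) _))
        · intro k' _ hk
          simp [hk]
        · simp
      mass := by
        rw [Fintype.sum_sigma, Finset.sum_div]
        refine Finset.sum_le_sum fun k _ => (hmass k).trans (le_of_eq ?_)
        rw [Finset.sum_coe_sort (M.paths (R k).gr (R k).s (R k).t)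
            (fun p => f k p * ∑ a, ψ k p a)]
      flow := by
        rw [Fintype.sum_sigma, Finset.mul_sum]
        refine Finset.sum_le_sum fun k _ => le_trans (le_of_eq ?_) (hflow k)
        rw [Finset.sum_coe_sort (M.paths (R k).gr (R k).s (R k).t) (fun p => f k p)]
      thin := fun k => by
        refine (hfat (R k).y (R k).π (hR k).π_nonneg (hR k).π_le (hR k).pot).trans ?_
        have := mul_le_mul_of_nonneg_left (hR k).lov_le (one_div_nonneg.2 P.α_pos.le)
        linarith
      life := hlife }
  exact S.total_lt P.α_pos P.ε_le P.ε_lt P.win P.moment P.spread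

end Regime
end ArcNet

namespace ArcNet
variable {X H B : Type*} [Fintype H] [Fintype B] {M : ArcNet X H B}

theorem sum_le_logb_prod {n : ℕ} {d : Fin n → ℝ} (h0 : ∀ k, 0 ≤ d k) (h1 : ∀ k, d k ≤ 1) {z : ℝ}
    (hz : ∏ k, (1 + d k) ≤ z) : ∑ k, d k ≤ Real.logb 2 z := by
  have hpos : 0 < ∏ k, (1 + d k) := Finset.prod_pos fun k _ => by linarith [h0 k]
  rw [Real.le_logb_iff_rpow_le one_lt_two (hpos.trans_le hz), Real.rpow_sum_of_pos two_pos]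
  refine le_trans (Finset.prod_le_prod (fun k _ => (Real.rpow_pos_of_pos two_pos _).le)
    fun k _ => ?_) hz
  have := rpow_one_add_le_one_add_mul_self (s := 1) (by norm_num) (h0 k) (h1 k)
  norm_num at this
  exact this

namespace Regime
variable (P : M.Regime) (G : Finset H) (s t : X)

/-- The best value over all scales, larger scales being favoured. -/
noncomputable def score : ℝ :=
  (Finset.range (P.s + 1)).sup' Finset.nonempty_range_add_one
    fun i => M.opt P.x (2 ^ i) G s t * P.A ^ i

/-- The pair can be separated in `G` by a cut of negligible cost. -/
def Cheap : Prop := M.opt P.x (2 ^ P.s) G s t ≤ 1 / (Fintype.card B : ℝ) ^ 2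

variable {P G s t}

theorem le_score {i : ℕ} (hi : i ≤ P.s) : M.opt P.x (2 ^ i) G s t * P.A ^ i ≤ P.score G s t :=
  Finset.le_sup' (fun i => M.opt P.x (2 ^ i) G s t * P.A ^ i)
    (Finset.mem_range.2 (Nat.lt_succ_of_le hi))

theorem one_le_pow_two (i : ℕ) : (1 : ℝ) ≤ 2 ^ i := one_le_pow₀ one_le_two

theorem score_mono {G' : Finset H} (hG : G ⊆ G') (hfar : M.Far G' P.x s t 1) :
    P.score G s t ≤ P.score G' s t := by
  refine Finset.sup'_le _ _ fun i hi => le_trans ?_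
    (le_score (Nat.lt_succ_iff.1 (Finset.mem_range.1 hi)))
  exact mul_le_mul_of_nonneg_right (opt_mono hG P.x_nonneg (one_le_pow_two i) hfar)
    (pow_nonneg (zero_le_one.trans P.one_le_A) i)

theorem Cheap.anti {G' : Finset H} (hG : G ⊆ G') (hfar : M.Far G' P.x s t 1)
    (h : P.Cheap G' s t) : P.Cheap G s t :=
  (opt_mono hG P.x_nonneg (one_le_pow_two _) hfar).trans h

theorem score_le (hfar : M.Far G P.x s t 1) : P.score G s t ≤ P.A ^ P.s := by
  refine Finset.sup'_le _ _ fun i hi => ?_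
  have h1 := (opt_le_lov P.x_nonneg (one_le_pow_two i) hfar).trans P.lov_le
  have h2 := pow_le_pow_right₀ P.one_le_A (Nat.lt_succ_iff.1 (Finset.mem_range.1 hi))
  have h3 := opt_nonneg P.x_nonneg (one_le_pow_two i) hfar
  have h4 : (0 : ℝ) ≤ P.A ^ i := pow_nonneg (zero_le_one.trans P.one_le_A) i
  nlinarith

theorem lt_score [Nonempty B] (h : ¬ P.Cheap G s t) :
    1 / (Fintype.card B : ℝ) ^ 2 * P.A ^ P.s < P.score G s t := by
  rw [Cheap, not_le] at h
  exact (mul_lt_mul_of_pos_right h (pow_pos (zero_lt_one.trans_le P.one_le_A) _)).trans_le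
    (le_score le_rfl)

theorem one_lt_score [Nonempty B] (h : ¬ P.Cheap G s t) : 1 < P.score G s t := by
  have hN : (0 : ℝ) < (Fintype.card B : ℝ) ^ 2 := by
    have : 0 < Fintype.card B := Fintype.card_pos
    positivity
  refine lt_of_le_of_lt ?_ (lt_score h)
  rw [one_div, ← div_eq_inv_mul, le_div_iff₀ hN, one_mul]
  exact P.A_pow

/-- At the scale realising the score, halving the cap costs at most a factor `A`. -/
theorem exists_scale [Nonempty B] (hfar : M.Far G P.x s t 1) (h : ¬ P.Cheap G s t) :
    ∃ i, 1 ≤ i ∧ i ≤ P.s ∧ 0 < M.opt P.x (2 ^ i) G s t ∧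
      M.opt P.x (2 ^ i / 2) G s t ≤ P.A * M.opt P.x (2 ^ i) G s t ∧
      M.opt P.x (2 ^ i) G s t * P.A ^ i = P.score G s t := by
  obtain ⟨i, hi, he⟩ := Finset.exists_mem_eq_sup' (s := Finset.range (P.s + 1))
    Finset.nonempty_range_add_one fun i => M.opt P.x (2 ^ i) G s t * P.A ^ i
  change P.score G s t = _ at he
  have his := Nat.lt_succ_iff.1 (Finset.mem_range.1 hi)
  have h1 := one_lt_score h
  have hA : 0 < P.A := zero_lt_one.trans_le P.one_le_A
  have hpos : 0 < M.opt P.x (2 ^ i) G s t := by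
    by_contra hc
    have := mul_nonpos_of_nonpos_of_nonneg (not_lt.1 hc) (pow_pos hA i).le
    linarith
  have hi1 : 1 ≤ i := by
    by_contra hc
    have hi0 : i = 0 := by omega
    subst hi0
    have := (opt_le_lov P.x_nonneg (one_le_pow_two 0) hfar).trans P.lov_le
    rw [he, pow_zero, pow_zero, mul_one] at h1
    rw [pow_zero] at this
    linarith
  refine ⟨i, hi1, his, hpos, ?_, he.symm⟩
  obtain ⟨j, rfl⟩ : ∃ j, i = j + 1 := ⟨i - 1, by omega⟩
  have h2 := le_score (P := P) (G := G) (s := s) (t := t) (i := j) (by omega)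
  rw [he, pow_succ P.A] at h2
  have e : (2 : ℝ) ^ (j + 1) / 2 = 2 ^ j := by rw [pow_succ]; ring
  rw [e]
  have hj := pow_pos hA j
  exact le_of_mul_le_mul_right (h2.trans (le_of_eq (by ring))) hj

theorem exists_phase_aux [Nonempty B] {G₀ : Finset H}
    (hfat : M.NonFat (fun b => lov (M.cost b) P.x) (1 / P.α) G₀) (G : Finset H) :
    ∀ (n : ℕ) (R : Fin n → Step X H), (∀ k, P.OK G₀ (R k)) → G ⊆ G₀ →
      (∀ a b, ∑ k, (if M.Reach (R k).gr (M.node a) (M.node b) then M.gap (R k).π a b else 0)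
        ≤ P.Λ) →
      M.pairSum (fun a b => ∏ k, (1 + M.gap (R k).π a b)) G +
          (Fintype.card B : ℝ) ^ 2 * M.tot (G₀ \ G) ≤
        (Fintype.card B : ℝ) ^ 2 * (1 + 2 * ∑ k, P.val (R k)) →
      ∃ G' ⊆ G, M.tot (G₀ \ G') ≤ 1 + 2 * P.α ∧
        ∀ s t, M.Far G₀ P.x s t 1 → P.Cheap G' s t ∨ P.score G' s t < P.score G₀ s t / 2 := by
  have hN : (0 : ℝ) < (Fintype.card B : ℝ) ^ 2 := by
    have : 0 < Fintype.card B := Fintype.card_pos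
    positivity
  induction G using Finset.strongInduction with
  | H G ih =>
  intro n R hR hG hlife hpot
  set N2 : ℝ := (Fintype.card B : ℝ) ^ 2 with hN2
  have hval := sum_val_lt hR hfat hlife
  have hprod : ∀ a b, 0 ≤ ∏ k, (1 + M.gap (R k).π a b) := fun a b =>
    Finset.prod_nonneg fun k _ => by linarith [gap_nonneg (M := M) (R k).π a b]
  have hps := pairSum_nonneg (M := M) (G := G) hprod
  have htot := M.tot_poly.nonneg (G₀ \ G)
  by_cases hdone : ∀ s t, M.Far G₀ P.x s t 1 → P.Cheap G s t ∨ P.score G s t < P.score G₀ s t / 2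
  · refine ⟨G, Finset.Subset.refl _, ?_, hdone⟩
    refine le_of_mul_le_mul_left (le_trans ?_ (mul_le_mul_of_nonneg_left
      (show 1 + 2 * ∑ k, P.val (R k) ≤ 1 + 2 * P.α by linarith) hN.le)) hN
    linarith
  push Not at hdone
  obtain ⟨s, t, hfar, hch, hsc⟩ := hdone
  obtain ⟨i, hi1, his, hpos, hhalf, hscore⟩ := exists_scale (hfar.anti hG) hch
  obtain ⟨y, hy0, hyx, hyfar, hylov⟩ := exists_dual (M := M) P.x_nonneg (one_le_pow_two i) hfar
  obtain ⟨π, hπ0, hπ1, hπs, hπt, hπ⟩ := hyfar.exists_potential hy0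
  have hA : 0 < P.A := zero_lt_one.trans_le P.one_le_A
  have hV : M.opt P.x (2 ^ i) G₀ s t ≤ 2 * M.opt P.x (2 ^ i) G s t := by
    have h1 := le_score (P := P) (G := G₀) (s := s) (t := t) his
    refine le_of_mul_le_mul_right (h1.trans ?_) (pow_pos hA i)
    rw [mul_assoc, hscore]
    linarith
  let r : Step X H := ⟨G, s, t, i, y, π⟩
  have hr : P.OK G₀ r :=
    { sub := hG
      far := hfar.anti hG
      one_le := hi1
      le_s := his
      pos := hpos
      half := hhalf
      y_nonneg := hy0
      y_le := hyx
      lov_le := hylov.trans hV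
      π_nonneg := hπ0
      π_le := hπ1
      π_s := hπs
      π_t := hπt
      pot := hπ }
  have hm : ∀ a b, 0 ≤ (∏ k, (1 + M.gap (R k).π a b)) * (1 + M.gap π a b) := fun a b =>
    mul_nonneg (hprod a b) (by linarith [gap_nonneg (M := M) π a b])
  obtain ⟨C, hC, hcut, hsep⟩ := exists_cut (M := M) (G := G) hπ0 hπ1 (fun a ha => hπ a (hG ha))
    hN.le hm
  have hss : G \ C ⊂ G := by
    refine Finset.sdiff_ssubset hC (Finset.nonempty_iff_ne_empty.2 fun h => ?_)
    have := hsep s t hπs hπt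
    rw [h, Finset.sdiff_empty] at this
    linarith [opt_le_zero (M := M) (κ := 2 ^ i) P.x_nonneg (by positivity) this]
  have hdrop : M.pairSum (fun a b => (∏ k, (1 + M.gap (R k).π a b)) * (1 + M.gap π a b)) G ≤
      M.pairSum (fun a b => ∏ k, (1 + M.gap (R k).π a b)) G +
      M.pairSum (fun a b => (∏ k, (1 + M.gap (R k).π a b)) * (1 + M.gap π a b) * M.gap π a b)
        G := by
    rw [← pairSum_add]
    refine pairSum_mono fun a b => ?_
    have := mul_nonneg (hprod a b) (sq_nonneg (M.gap π a b))
    nlinarith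
  obtain ⟨G', hG', hb, hres⟩ := ih _ hss (n + 1) (Fin.cons r R)
    (fun k => by refine Fin.cases ?_ (fun k => ?_) k <;> simp [hr, hR])
    (Finset.sdiff_subset.trans hG) (fun a b => by
      rw [Fin.sum_univ_succ]
      simp only [Fin.cons_zero, Fin.cons_succ]
      have h1 := hlife a b
      by_cases hab : M.Reach G (M.node a) (M.node b)
      · have h2 : ∑ k, M.gap (R k).π a b ≤ Real.logb 2 (N2 * (1 + 2 * P.α)) := by
          refine sum_le_logb_prod (fun k => gap_nonneg _ _ _)
            (fun k => gap_le_one (hR k).π_nonneg (hR k).π_le a b)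
            ((le_pairSum (M := M) (m := fun a b => ∏ k, (1 + M.gap (R k).π a b)) hprod hab).trans ?_)
          have := mul_le_mul_of_nonneg_left
            (show 1 + 2 * ∑ k, P.val (R k) ≤ 1 + 2 * P.α by linarith) hN.le
          have := mul_nonneg hN.le htot
          linarith
        have h3 : ∑ k, (if M.Reach (R k).gr (M.node a) (M.node b) then M.gap (R k).π a b else 0) ≤
            ∑ k, M.gap (R k).π a b := Finset.sum_le_sum fun k _ => by
          split_ifs
          exacts [le_rfl, gap_nonneg _ _ _]
        have h4 := gap_le_one (M := M) hπ0 hπ1 a b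
        have h5 := P.le_Λ
        rw [if_pos hab]
        change M.gap π a b + _ ≤ _
        linarith
      · rw [if_neg hab, zero_add]
        exact h1) (by
      rw [Fin.sum_univ_succ]
      simp only [Fin.prod_univ_succ, Fin.cons_zero, Fin.cons_succ]
      have h1 : M.pairSum (fun a b => (1 + M.gap r.π a b) * ∏ k, (1 + M.gap (R k).π a b)) (G \ C) =
          M.pairSum (fun a b => (∏ k, (1 + M.gap (R k).π a b)) * (1 + M.gap π a b)) (G \ C) := by
        congr 1
        funext a b
        exact mul_comm _ _
      have h2 : M.tot (G₀ \ (G \ C)) ≤ M.tot (G₀ \ G) + M.tot C :=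
        (M.tot_poly.mono _ (G₀ \ G ∪ C) fun a ha => by
          simp only [mem_sdiff, mem_union] at *
          tauto).trans (M.tot_poly.union_le _ _)
      have h3 := mul_le_mul_of_nonneg_left h2 hN.le
      have h4 := mul_le_mul_of_nonneg_left (hylov.trans hV) hN.le
      rw [h1]
      change _ ≤ N2 * (1 + 2 * (M.opt P.x (2 ^ i) G s t + _))
      linarith)
  exact ⟨G', hG'.trans Finset.sdiff_subset, hb, hres⟩

theorem exists_phase [Nonempty B] (P : M.Regime) (G : Finset H) :
    ∃ G' ⊆ G, M.tot (G \ G') ≤ 1 + 3 * P.α ∧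
      ∀ s t, M.Far G P.x s t 1 → P.Cheap G' s t ∨ P.score G' s t < P.score G s t / 2 := by
  have hw : ∀ b, 0 ≤ lov (M.cost b) P.x := fun b => lov_nonneg (M.cost_poly b) _
  obtain ⟨G₀, hG₀, hfat, hb⟩ := exists_nonFat (M := M) hw (one_div_nonneg.2 P.α_pos.le) G
  have hone : M.pairSum (fun a b => lov (M.cost a) P.x * lov (M.cost b) P.x) G ≤ 1 := by
    have h1 : M.pairSum (fun a b => lov (M.cost a) P.x * lov (M.cost b) P.x) G ≤
        ∑ a, ∑ b, lov (M.cost a) P.x * lov (M.cost b) P.x :=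
      Finset.sum_le_sum fun a _ => Finset.sum_le_sum fun b _ => by
        split_ifs
        exacts [le_rfl, mul_nonneg (hw a) (hw b)]
    rw [← Finset.sum_mul_sum, ← M.lov_tot] at h1
    have := P.lov_le
    have := lov_nonneg M.tot_poly P.x
    nlinarith
  have h0 : M.tot (G \ G₀) ≤ P.α := by
    have := pairSum_nonneg (M := M) (G := G₀) fun a b => mul_nonneg (hw a) (hw b)
    have h2 : 1 / P.α * M.tot (G \ G₀) ≤ 1 := by linarith
    rwa [one_div, ← div_eq_inv_mul, div_le_one P.α_pos] at h2
  have hN : (Fintype.card B : ℝ) ^ 2 = ∑ a : B, ∑ b : B, (1 : ℝ) := by simp [sq]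
  obtain ⟨G', hG', hc, hres⟩ := exists_phase_aux (P := P) hfat G₀ 0 (fun k => k.elim0)
    (fun k => k.elim0) (Finset.Subset.refl _) (fun a b => by simpa using P.Λ_pos.le) (by
      simp only [Finset.univ_eq_empty, Finset.prod_empty, Finset.sum_empty, Finset.sdiff_self,
        M.tot_poly.empty, mul_zero, add_zero, mul_one]
      rw [hN]
      exact Finset.sum_le_sum fun a _ => Finset.sum_le_sum fun b _ => by
        split_ifs <;> norm_num)
  refine ⟨G', hG'.trans hG₀, ?_, fun s t hf => (hres s t (hf.anti hG₀)).imp id fun h =>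
    h.trans_le (by linarith [score_mono hG₀ hf])⟩
  have : M.tot (G \ G') ≤ M.tot (G \ G₀) + M.tot (G₀ \ G') :=
    (M.tot_poly.mono _ ((G \ G₀) ∪ (G₀ \ G')) fun a ha => by
      simp only [mem_sdiff, mem_union] at *
      tauto).trans (M.tot_poly.union_le _ _)
  linarith

theorem exists_phases [Nonempty B] (P : M.Regime) (G₀ : Finset H) (T : ℕ) :
    ∃ G' ⊆ G₀, M.tot (G₀ \ G') ≤ T * (1 + 3 * P.α) ∧
      ∀ s t, M.Far G₀ P.x s t 1 → P.Cheap G' s t ∨ P.score G' s t ≤ P.A ^ P.s / 2 ^ T := by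
  induction T with
  | zero =>
    refine ⟨G₀, Finset.Subset.refl _, by simp [M.tot_poly.empty], fun s t h => Or.inr ?_⟩
    simpa using score_le h
  | succ T ih =>
    obtain ⟨G, hGG, hG, hres⟩ := ih
    obtain ⟨G', hG', hb, hres'⟩ := exists_phase P G
    refine ⟨G', hG'.trans hGG, ?_, fun s t h => ?_⟩
    · have : M.tot (G₀ \ G') ≤ M.tot (G₀ \ G) + M.tot (G \ G') :=
        (M.tot_poly.mono _ (G₀ \ G ∪ (G \ G')) fun a ha => by
          simp only [mem_sdiff, mem_union] at *
          tauto).trans (M.tot_poly.union_le _ _)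
      push_cast
      linarith
    · have hf : M.Far G P.x s t 1 := h.anti hGG
      rcases hres' s t hf with h1 | h1
      · exact Or.inl h1
      rcases hres s t h with h2 | h2
      · exact Or.inl (h2.anti hG' hf)
      · refine Or.inr (h1.le.trans ?_)
        rw [pow_succ, ← div_div]
        linarith

/-- Separating pairs of blocks at distance at least `1`. -/
theorem exists_multicut [Nonempty B] (P : M.Regime) (G₀ : Finset H) {T : ℕ}
    (hT : (Fintype.card B : ℝ) ^ 2 ≤ 2 ^ T) :
    ∃ D : Finset H, M.tot D ≤ T * (1 + 3 * P.α) + 1 ∧ ∀ a b,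
      M.Far G₀ P.x (M.node a) (M.node b) 1 → ¬ M.Reach (G₀ \ D) (M.node a) (M.node b) := by
  have hN : (0 : ℝ) < (Fintype.card B : ℝ) ^ 2 := by
    have : 0 < Fintype.card B := Fintype.card_pos
    positivity
  obtain ⟨G, hGG, hG, hres⟩ := exists_phases P G₀ T
  have hcheap : ∀ s t, M.Far G₀ P.x s t 1 → P.Cheap G s t := fun s t h => by
    by_contra hc
    have h1 := lt_score hc
    have h2 := (hres s t h).resolve_left hc
    have h3 : P.A ^ P.s / 2 ^ T ≤ P.A ^ P.s / (Fintype.card B : ℝ) ^ 2 :=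
      div_le_div_of_nonneg_left (pow_nonneg (zero_le_one.trans P.one_le_A) _) hN hT
    rw [one_div, ← div_eq_inv_mul] at h1
    linarith
  have hcut : ∀ q : B × B, ∃ C : Finset H, M.tot C ≤ 1 / (Fintype.card B : ℝ) ^ 2 ∧
      (M.Far G₀ P.x (M.node q.1) (M.node q.2) 1 →
        ¬ M.Reach (G \ C) (M.node q.1) (M.node q.2)) := fun q => by
    by_cases hf : M.Far G₀ P.x (M.node q.1) (M.node q.2) 1
    · obtain ⟨y, hy0, -, hyfar, hylov⟩ := exists_dual (M := M) (G := G) P.x_nonneg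
        (one_le_pow_two P.s) (hf.anti hGG)
      obtain ⟨π, hπ0, hπ1, hπs, hπt, hπ⟩ := hyfar.exists_potential hy0
      obtain ⟨C, -, hc, hsep⟩ := exists_cut (M := M) (G := G) hπ0 hπ1 hπ zero_le_one
        (m := fun _ _ => 0) fun _ _ => le_rfl
      refine ⟨C, ?_, fun _ => hsep _ _ hπs hπt⟩
      have : P.Cheap G _ _ := hcheap _ _ hf
      simp only [pairSum, zero_mul, ite_self, Finset.sum_const_zero] at hc
      exact (show M.tot C ≤ lov M.tot y by linarith).trans (hylov.trans this)
    · exact ⟨∅, by rw [M.tot_poly.empty]; positivity, fun h => absurd h hf⟩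
  choose C hC hsep using hcut
  refine ⟨G₀ \ G ∪ univ.biUnion C, ?_, fun a b hab hr => hsep (a, b) hab (hr.mono fun h hh => ?_)⟩
  · have h1 : ∀ S : Finset (B × B), M.tot (S.biUnion C) ≤ ∑ q ∈ S, M.tot (C q) := fun S => by
      induction S using Finset.induction_on with
      | empty => simp [M.tot_poly.empty]
      | insert q S hq ih =>
        rw [Finset.biUnion_insert, Finset.sum_insert hq]
        exact (M.tot_poly.union_le _ _).trans (by linarith)
    have h2 : ∑ q : B × B, M.tot (C q) ≤ 1 := by
      refine (Finset.sum_le_sum fun q _ => hC q).trans (le_of_eq ?_)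
      simp only [Finset.sum_const, Finset.card_univ, Fintype.card_prod, nsmul_eq_mul]
      push_cast
      field_simp
    have := M.tot_poly.union_le (G₀ \ G) (univ.biUnion C)
    linarith [h1 univ]
  · simp only [mem_sdiff, mem_union, mem_biUnion, mem_univ, true_and, not_or, not_and, not_not,
      not_exists] at hh
    exact Finset.mem_sdiff.2 ⟨hh.2.1 hh.1, hh.2.2 (a, b)⟩

end Regime
end ArcNet

theorem logb_two_le {u C : ℝ} (hu : 1 ≤ u) (hC : 1 ≤ C) :
    Real.logb 2 ((u ^ 1150) ^ 2 * (1 + 2 * (C * u ^ 550))) + 1 ≤ 6000 * (C * u) := by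
  have hu0 : 0 < u := by linarith
  have hC0 : 0 < C := by linarith
  have h550 : 1 ≤ u ^ 550 := one_le_pow₀ hu
  have h1 : (u ^ 1150) ^ 2 * (1 + 2 * (C * u ^ 550)) ≤ 3 * C * u ^ 2850 := by
    have : (1 : ℝ) ≤ C * u ^ 550 := one_le_mul_of_one_le_of_one_le hC h550
    calc (u ^ 1150) ^ 2 * (1 + 2 * (C * u ^ 550)) ≤ (u ^ 1150) ^ 2 * (3 * (C * u ^ 550)) := by
          gcongr
          linarith
      _ = _ := by ring
  have h2 : Real.log ((u ^ 1150) ^ 2 * (1 + 2 * (C * u ^ 550))) ≤ 3 * C + 2850 * u := by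
    refine (Real.log_le_log (by positivity) h1).trans ?_
    rw [Real.log_mul (by positivity) (by positivity), Real.log_pow]
    have e1 := Real.log_le_self (show 0 ≤ 3 * C by positivity)
    have e2 := Real.log_le_self hu0.le
    push_cast
    linarith
  have hl := Real.log_two_gt_d9
  have h3 : Real.logb 2 ((u ^ 1150) ^ 2 * (1 + 2 * (C * u ^ 550))) ≤ 2 * (3 * C + 2850 * u) := by
    rw [Real.logb, div_le_iff₀ (by linarith)]
    nlinarith
  nlinarith [mul_nonneg (sub_nonneg.2 hu) (sub_nonneg.2 hC)]

section
variable {A N h Λ a : ℝ}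

theorem regime_win (hA : 0 < A) (hN : 0 < N) (hh : 0 < h) (hΛ : 0 < Λ) (ha : 0 < a)
    (hc : 530841600 * h ^ 3 * A ^ 3 * Λ * N ≤ a ^ 3) :
    2 * (a ^ 2 / (353894400 * A ^ 3 * h ^ 2 * Λ * N)) + 3 * (h / a) ≤
      (1 / (400 * A) / (576 * A * (h / a) * h * Λ)) * a / (384 * A * N) := by
  have e : (1 / (400 * A) / (576 * A * (h / a) * h * Λ)) * a / (384 * A * N) =
      4 * (a ^ 2 / (353894400 * A ^ 3 * h ^ 2 * Λ * N)) := by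
    field_simp
    norm_num
  have e2 : h / a * 3 ≤ 2 * (a ^ 2 / (353894400 * A ^ 3 * h ^ 2 * Λ * N)) := by
    rw [div_mul_eq_mul_div, mul_div_assoc', div_le_div_iff₀ ha (by positivity)]
    linarith
  linarith

theorem regime_moment (hA : 0 < A) (hh : 0 < h) (hΛ : 0 < Λ) (ha : 0 < a)
    (hc : 294912 * 64 * 16384 * 230400 ^ 2 * A ^ 8 * N ^ 2 * h ^ 5 * Λ ^ 2 < a ^ 5) :
    294912 * A ^ 2 * N ^ 2 * (64 * h * (1 / a) / (1 / (128 * A) * (1 / (128 * A)))) <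
      (1 / (400 * A) / (576 * A * (h / a) * h * Λ)) ^ 2 * a ^ 2 := by
  have e1 : 294912 * A ^ 2 * N ^ 2 * (64 * h * (1 / a) / (1 / (128 * A) * (1 / (128 * A)))) =
      294912 * 64 * 16384 * A ^ 4 * N ^ 2 * h / a := by
    field_simp
    ring
  have e2 : (1 / (400 * A) / (576 * A * (h / a) * h * Λ)) ^ 2 * a ^ 2 =
      a ^ 4 / (230400 ^ 2 * A ^ 4 * h ^ 4 * Λ ^ 2) := by
    field_simp
    ring
  rw [e1, e2, div_lt_div_iff₀ ha (by positivity)]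
  linarith

theorem regime_spread (hA : 0 < A) (hN : 0 < N) (hh : 0 < h) (hΛ : 0 < Λ) (ha : 0 < a)
    (hc : 589824 * 64 * 16384 * 353894400 * 230400 ^ 2 * A ^ 10 * N ^ 4 * h ^ 9 * Λ ^ 4 < a ^ 9) :
    589824 * A * N ^ 3 * (64 * h * (1 / a) / (1 / (128 * A) * (1 / (128 * A)))) * (h / a) * h *
        (Λ / (a ^ 2 / (353894400 * A ^ 3 * h ^ 2 * Λ * N))) <
      (1 / (400 * A) / (576 * A * (h / a) * h * Λ)) ^ 2 * a ^ 3 := by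
  have e1 : 589824 * A * N ^ 3 * (64 * h * (1 / a) / (1 / (128 * A) * (1 / (128 * A)))) * (h / a) * h *
        (Λ / (a ^ 2 / (353894400 * A ^ 3 * h ^ 2 * Λ * N))) =
      589824 * 64 * 16384 * 353894400 * A ^ 6 * N ^ 4 * h ^ 5 * Λ ^ 2 / a ^ 4 := by
    field_simp
    ring
  have e2 : (1 / (400 * A) / (576 * A * (h / a) * h * Λ)) ^ 2 * a ^ 3 =
      a ^ 5 / (230400 ^ 2 * A ^ 4 * h ^ 4 * Λ ^ 2) := by
    field_simp
    ring
  rw [e1, e2, div_lt_div_iff₀ (by positivity) (by positivity)]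
  linarith

end

section
variable {u h Λ C : ℝ}

theorem scale_win (hu : 1 ≤ u) (hh : 1 ≤ h) (hC : 10 ^ 50 * h ^ 9 ≤ C)
    (hΛ : Λ ≤ 6000 * (C * u)) :
    530841600 * h ^ 3 * (u ^ 23) ^ 3 * Λ * u ^ 1150 ≤ (C * u ^ 550) ^ 3 := by
  have hu0 : 0 < u := by linarith
  have hh3 : h ^ 3 ≤ h ^ 9 := pow_le_pow_right₀ hh (by norm_num)
  have hh9 : 1 ≤ h ^ 9 := one_le_pow₀ hh
  have hC1 : 1 ≤ C := by linarith
  have hk : 530841600 * 6000 * h ^ 3 ≤ C ^ 2 := by nlinarith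
  calc 530841600 * h ^ 3 * (u ^ 23) ^ 3 * Λ * u ^ 1150 ≤
      530841600 * h ^ 3 * (u ^ 23) ^ 3 * (6000 * (C * u)) * u ^ 1150 := by gcongr
    _ = (530841600 * 6000 * h ^ 3) * (C * u ^ 1220) := by ring
    _ ≤ C ^ 2 * (C * u ^ 1650) := by gcongr; norm_num
    _ = _ := by ring

theorem scale_moment (hu : 1 ≤ u) (hh : 1 ≤ h) (hC : 10 ^ 50 * h ^ 9 ≤ C) (hΛ0 : 0 ≤ Λ)
    (hΛ : Λ ≤ 6000 * (C * u)) :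
    294912 * 64 * 16384 * 230400 ^ 2 * (u ^ 23) ^ 8 * (u ^ 1150) ^ 2 * h ^ 5 * Λ ^ 2 <
      (C * u ^ 550) ^ 5 := by
  have hu0 : 0 < u := by linarith
  have hh5 : h ^ 5 ≤ h ^ 9 := pow_le_pow_right₀ hh (by norm_num)
  have hh9 : 1 ≤ h ^ 9 := one_le_pow₀ hh
  have hC1 : 1 ≤ C := by linarith
  have hC3 : C ≤ C ^ 3 := le_self_pow₀ hC1 (by norm_num)
  have hk : 294912 * 64 * 16384 * 230400 ^ 2 * 6000 ^ 2 * h ^ 5 < C ^ 3 := by linarith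
  calc 294912 * 64 * 16384 * 230400 ^ 2 * (u ^ 23) ^ 8 * (u ^ 1150) ^ 2 * h ^ 5 * Λ ^ 2 ≤
      294912 * 64 * 16384 * 230400 ^ 2 * (u ^ 23) ^ 8 * (u ^ 1150) ^ 2 * h ^ 5 *
        (6000 * (C * u)) ^ 2 := by gcongr
    _ = (294912 * 64 * 16384 * 230400 ^ 2 * 6000 ^ 2 * h ^ 5) * (C ^ 2 * u ^ 2486) := by ring
    _ < C ^ 3 * (C ^ 2 * u ^ 2486) := by gcongr
    _ ≤ C ^ 3 * (C ^ 2 * u ^ 2750) := by gcongr; norm_num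
    _ = _ := by ring

theorem scale_spread (hu : 1 ≤ u) (hh : 1 ≤ h) (hC : 10 ^ 50 * h ^ 9 ≤ C) (hΛ0 : 0 ≤ Λ)
    (hΛ : Λ ≤ 6000 * (C * u)) :
    589824 * 64 * 16384 * 353894400 * 230400 ^ 2 * (u ^ 23) ^ 10 * (u ^ 1150) ^ 4 * h ^ 9 * Λ ^ 4 <
      (C * u ^ 550) ^ 9 := by
  have hu0 : 0 < u := by linarith
  have hh9 : 1 ≤ h ^ 9 := one_le_pow₀ hh
  have hC1 : 1 ≤ C := by linarith
  have hC5 : C ≤ C ^ 5 := le_self_pow₀ hC1 (by norm_num)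
  have hk : 589824 * 64 * 16384 * 353894400 * 230400 ^ 2 * 6000 ^ 4 * h ^ 9 < C ^ 5 := by linarith
  calc 589824 * 64 * 16384 * 353894400 * 230400 ^ 2 * (u ^ 23) ^ 10 * (u ^ 1150) ^ 4 * h ^ 9 *
        Λ ^ 4 ≤
      589824 * 64 * 16384 * 353894400 * 230400 ^ 2 * (u ^ 23) ^ 10 * (u ^ 1150) ^ 4 * h ^ 9 *
        (6000 * (C * u)) ^ 4 := by gcongr
    _ = (589824 * 64 * 16384 * 353894400 * 230400 ^ 2 * 6000 ^ 4 * h ^ 9) *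
        (C ^ 4 * u ^ 4834) := by ring
    _ < C ^ 5 * (C ^ 4 * u ^ 4834) := by gcongr
    _ ≤ C ^ 5 * (C ^ 4 * u ^ 4950) := by gcongr; norm_num
    _ = _ := by ring

end

namespace ArcNet
variable {X H B : Type*} [Fintype H] [Fintype B] {M : ArcNet X H B}

theorem exists_regime [Nonempty B] {u C : ℝ} (hu : 1 ≤ u) (hN : (Fintype.card B : ℝ) = u ^ 1150)
    (hC : 10 ^ 50 * (2 ^ 100) ^ 9 ≤ C) {x : H → ℝ} (hx : 0 ≤ x)
    (hxa : ∀ a, x a ≤ 1 / (C * u ^ 550)) (hlov : lov M.tot x ≤ 1) :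
    ∃ P : M.Regime, P.x = x ∧ P.α = C * u ^ 550 := by
  have hu0 : 0 < u := by linarith
  have hC1 : 1 ≤ C := le_trans (by norm_num) hC
  have hC0 : 0 < C := by linarith
  have hh : (1 : ℝ) ≤ 2 ^ 100 := one_le_pow₀ one_le_two
  have hC' : 600 * 2 ^ 100 ≤ C := le_trans (by norm_num) hC
  have hA : 0 < u ^ 23 := by positivity
  have hN0 : 0 < u ^ 1150 := by positivity
  have ha : 0 < C * u ^ 550 := by positivity
  set Λ := Real.logb 2 ((u ^ 1150) ^ 2 * (1 + 2 * (C * u ^ 550))) + 1 with hΛd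
  have hΛ : Λ ≤ 6000 * (C * u) := logb_two_le hu hC1
  have hΛ1 : 1 ≤ Λ := by
    have : 0 ≤ Real.logb 2 ((u ^ 1150) ^ 2 * (1 + 2 * (C * u ^ 550))) := by
      refine Real.logb_nonneg one_lt_two (one_le_mul_of_one_le_of_one_le ?_ (by linarith))
      exact one_le_pow₀ (one_le_pow₀ hu)
    linarith
  have hΛ0 : 0 < Λ := by linarith
  have hh0 : (0 : ℝ) < 2 ^ 100 := by positivity
  generalize hhd : (2 : ℝ) ^ 100 = h at *
  have hwin := scale_win hu hh hC hΛ
  refine ⟨{ x := x, s := 100, A := u ^ 23, ε := h / (C * u ^ 550), α := C * u ^ 550, Λ := Λ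
            η := (C * u ^ 550) ^ 2 / (353894400 * (u ^ 23) ^ 3 * h ^ 2 * Λ * u ^ 1150)
            x_nonneg := hx
            x_le := fun a => ?_
            lov_le := hlov
            one_le_A := one_le_pow₀ hu
            ε_pos := by positivity
            α_pos := ha
            Λ_pos := hΛ0
            A_pow := ?_
            ε_le := ?_
            ε_lt := ?_
            win := ?_
            moment := ?_
            spread := ?_
            le_Λ := ?_ }, rfl, rfl⟩
  · rw [hhd, div_eq_mul_one_div]
    exact mul_le_mul_of_nonneg_left (hxa a) hh0.le
  · rw [hN]
    exact le_of_eq (by ring)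
  · rw [div_le_div_iff₀ ha (by positivity), one_mul]
    calc h * (600 * u ^ 23) = 600 * h * u ^ 23 := by ring
      _ ≤ C * u ^ 550 := by gcongr; norm_num
  · rw [div_lt_div_iff₀ ha (by positivity)]
    have : 0 < h ^ 3 * (u ^ 23) ^ 3 * Λ * u ^ 1150 := by positivity
    nlinarith
  · rw [hN, hhd]
    exact regime_win hA hN0 hh0 hΛ0 ha hwin
  · rw [hN, hhd]
    exact regime_moment hA hh0 hΛ0 ha (scale_moment hu hh hC hΛ0.le hΛ)
  · rw [hN, hhd]
    exact regime_spread hA hN0 hh0 hΛ0 ha (scale_spread hu hh hC hΛ0.le hΛ)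
  · rw [hN]

end ArcNet

namespace ArcNet
variable {X H B : Type*} [Fintype H] [Fintype B] {M : ArcNet X H B}

theorem Far.congr {G : Finset H} {x y : H → ℝ} {s t : X} {c : ℝ} (h : M.Far G x s t c)
    (hxy : ∀ a ∈ G, y a = x a) : M.Far G y s t c := fun p hp => by
  rw [len, List.map_congr_left fun a ha => hxy a (hp.mem a ha)]
  exact h p hp

/-- A fractional cut of cost at most one can be rounded to an integral one separating all pairs
of blocks at distance at least one. -/
theorem exists_separator [Nonempty B] {C : ℝ} (hC : 10 ^ 50 * (2 ^ 100) ^ 9 ≤ C) {x : H → ℝ}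
    (hx : 0 ≤ x) (hlov : lov M.tot x ≤ 1) :
    ∃ D : Finset H, M.tot D ≤ 12 * C * (Fintype.card B : ℝ) ^ ((11 : ℝ) / 23) *
        (1 + Real.log (Fintype.card B)) ∧
      ∀ a b, M.Far univ x (M.node a) (M.node b) 1 → ¬ M.Reach Dᶜ (M.node a) (M.node b) := by
  have hC1 : 1 ≤ C := le_trans (by norm_num) hC
  set N : ℝ := (Fintype.card B : ℝ) with hNd
  have hN1 : 1 ≤ N := Nat.one_le_cast.2 Fintype.card_pos
  have hN0 : 0 < N := by linarith
  obtain ⟨u, hu, hNu, hu'⟩ : ∃ u : ℝ, 1 ≤ u ∧ N = u ^ 1150 ∧ u ^ 550 = N ^ ((11 : ℝ) / 23) := by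
    refine ⟨N ^ ((1 : ℝ) / 1150), Real.one_le_rpow hN1 (by norm_num), ?_, ?_⟩
    · rw [← Real.rpow_natCast, ← Real.rpow_mul hN0.le]
      norm_num
    · rw [← Real.rpow_natCast, ← Real.rpow_mul hN0.le]
      norm_num
  have hu0 : 0 < u := by linarith
  set α := C * u ^ 550 with hα
  have hα1 : 1 ≤ α := one_le_mul_of_one_le_of_one_le hC1 (one_le_pow₀ hu)
  have hα0 : 0 < α := by linarith
  set G₀ := (lev x (1 / α))ᶜ with hG₀
  let x' : H → ℝ := fun a => if a ∈ G₀ then x a else 0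
  have hx'x : ∀ a, x' a ≤ x a := fun a => by
    simp only [x']
    split_ifs
    exacts [le_rfl, hx a]
  obtain ⟨P, hPx, hPα⟩ := exists_regime (M := M) hu hNu hC (x := x')
    (fun a => by
      simp only [x', Pi.zero_apply]
      split_ifs
      exacts [hx a, le_rfl])
    (fun a => by
      simp only [x']
      split_ifs with h
      · simp only [hG₀, mem_compl, mem_lev, not_le] at h
        exact h.le
      · positivity) ((lov_mono M.tot_poly hx'x).trans hlov)
  have hlog : 0 ≤ Real.log N := Real.log_nonneg hN1
  have hl2 := Real.log_two_gt_d9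
  obtain ⟨T, hT, hT'⟩ : ∃ T : ℕ, N ^ 2 ≤ 2 ^ T ∧ (T : ℝ) ≤ 3 * Real.log N + 1 := by
    have h0 : 0 ≤ 2 * Real.logb 2 N := mul_nonneg zero_le_two (Real.logb_nonneg one_lt_two hN1)
    refine ⟨⌈2 * Real.logb 2 N⌉₊, ?_, ?_⟩
    · rw [← Real.rpow_natCast 2]
      refine le_trans (le_of_eq ?_)
        (Real.rpow_le_rpow_of_exponent_le one_le_two (Nat.le_ceil (2 * Real.logb 2 N)))
      rw [mul_comm, Real.rpow_mul zero_le_two, Real.rpow_logb two_pos (by norm_num) hN0]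
      norm_num
    · refine (Nat.ceil_lt_add_one h0).le.trans ?_
      have : 2 * Real.logb 2 N ≤ 3 * Real.log N := by
        rw [Real.logb, mul_div_assoc', div_le_iff₀ (by linarith)]
        nlinarith
      linarith
  obtain ⟨D, hD, hsep⟩ := P.exists_multicut G₀ hT
  rw [hPα, ← hα] at hD
  rw [hPx] at hsep
  refine ⟨lev x (1 / α) ∪ D, ?_, fun a b hab hr => ?_⟩
  · have h1 := mul_lev_le_lov M.tot_poly x (τ := 1 / α) (by positivity)
    have h2 : M.tot (lev x (1 / α)) ≤ α := by
      have := h1.trans hlov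
      rwa [one_div_mul_eq_div, div_le_one hα0] at this
    have h3 := M.tot_poly.union_le (lev x (1 / α)) D
    have h4 : (T : ℝ) * (1 + 3 * α) ≤ (3 * Real.log N + 1) * (4 * α) :=
      mul_le_mul hT' (by linarith) (by linarith) (by positivity)
    rw [← hu', show 12 * C * u ^ 550 = 12 * α by rw [hα]; ring]
    nlinarith [mul_nonneg hlog hα0.le]
  · refine hsep a b ((hab.anti (Finset.subset_univ G₀)).congr fun h hh => if_pos hh)
      (hr.mono fun h hh => ?_)
    simp only [mem_compl, mem_union, not_or, mem_sdiff, hG₀] at *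
    exact hh

end ArcNet

namespace ArcNet
variable {X H B : Type*} [Fintype H] [Fintype B]

/-- The same network with all costs multiplied by `c`. -/
def scale (M : ArcNet X H B) (c : ℝ) (hc : 0 ≤ c) : ArcNet X H B where
  src := M.src
  dst := M.dst
  own := M.own
  node := M.node
  isOut := M.isOut
  src_own := M.src_own
  dst_own := M.dst_own
  cost b S := c * M.cost b S
  cost_poly b :=
    { empty := by rw [(M.cost_poly b).empty, mul_zero]
      mono := fun A A' h => mul_le_mul_of_nonneg_left ((M.cost_poly b).mono A A' h) hc
      submod := fun A A' => by
        rw [← mul_add, ← mul_add]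
        exact mul_le_mul_of_nonneg_left ((M.cost_poly b).submod A A') hc }
  cost_local b S := by rw [← M.cost_local b S]

variable {M : ArcNet X H B}

theorem scale_tot {c : ℝ} {hc : 0 ≤ c} (S : Finset H) : (M.scale c hc).tot S = c * M.tot S :=
  (Finset.mul_sum _ _ _).symm

theorem lov_scale_tot {c : ℝ} {hc : 0 ≤ c} (y : H → ℝ) :
    lov (M.scale c hc).tot y = c * lov M.tot y := by
  unfold lov
  simp only [scale_tot]
  exact intervalIntegral.integral_const_mul _ _

theorem walk_scale {c : ℝ} {hc : 0 ≤ c} {G : Finset H} {s t : X} {p : List H} :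
    (M.scale c hc).Walk G s t p ↔ M.Walk G s t p := by
  induction p generalizing s with
  | nil => rfl
  | cons a p ih => exact and_congr Iff.rfl (and_congr Iff.rfl ih)

/-- The approximation ratio achieved by `exists_separator`. -/
noncomputable def ratio (C N : ℝ) : ℝ := 12 * C * N ^ ((11 : ℝ) / 23) * (1 + Real.log N)

theorem ratio_nonneg {C N : ℝ} (hC : 0 ≤ C) (hN : 1 ≤ N) : 0 ≤ ratio C N := by
  have := Real.log_nonneg hN
  unfold ratio
  positivity

theorem exists_separator_mul_lov [Nonempty B] {C : ℝ} (hC : 10 ^ 50 * (2 ^ 100) ^ 9 ≤ C)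
    {x : H → ℝ} (hx : 0 ≤ x) :
    ∃ D : Finset H, M.tot D ≤ ratio C (Fintype.card B) * lov M.tot x ∧
      ∀ a b, M.Far univ x (M.node a) (M.node b) 1 → ¬ M.Reach Dᶜ (M.node a) (M.node b) := by
  set K := ratio C (Fintype.card B)
  have hK : 0 ≤ K :=
    ratio_nonneg (le_trans (by norm_num) hC) (Nat.one_le_cast.2 Fintype.card_pos)
  have key : ∀ c : ℝ, 0 < c → c * lov M.tot x ≤ 1 → ∃ D : Finset H, c * M.tot D ≤ K ∧
      ∀ a b, M.Far univ x (M.node a) (M.node b) 1 → ¬ M.Reach Dᶜ (M.node a) (M.node b) := by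
    intro c hc hle
    obtain ⟨D, hD, hs⟩ := exists_separator (M := M.scale c hc.le) hC hx
      (by rw [lov_scale_tot]; exact hle)
    rw [scale_tot] at hD
    refine ⟨D, hD, fun a b hab hr => hs a b (fun p hp => hab p (walk_scale.1 hp)) ?_⟩
    obtain ⟨p, hp⟩ := hr
    exact ⟨p, walk_scale.2 hp⟩
  rcases (lov_nonneg M.tot_poly x).lt_or_eq with h | h
  · obtain ⟨D, hD, hs⟩ := key (lov M.tot x)⁻¹ (inv_pos.2 h) (inv_mul_cancel₀ h.ne').le
    refine ⟨D, ?_, hs⟩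
    rwa [inv_mul_le_iff₀ h, mul_comm] at hD
  · rw [← h]
    let 𝒮 : Finset (Finset H) := univ.filter fun D =>
      ∀ a b, M.Far univ x (M.node a) (M.node b) 1 → ¬ M.Reach Dᶜ (M.node a) (M.node b)
    have hne : 𝒮.Nonempty := by
      obtain ⟨D, -, hs⟩ := key 1 one_pos (by rw [← h]; norm_num)
      exact ⟨D, mem_filter.2 ⟨mem_univ _, hs⟩⟩
    obtain ⟨D, hD, hmin⟩ := exists_min_image 𝒮 M.tot hne
    refine ⟨D, ?_, (mem_filter.1 hD).2⟩
    by_contra hc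
    rw [mul_zero, not_le] at hc
    obtain ⟨D', hD', hs'⟩ := key ((K + 1) / M.tot D) (by positivity) (by rw [← h]; simp)
    have h1 := hmin D' (mem_filter.2 ⟨mem_univ _, hs'⟩)
    have h2 := mul_le_mul_of_nonneg_left h1 (show 0 ≤ (K + 1) / M.tot D by positivity)
    rw [div_mul_cancel₀ _ hc.ne'] at h2
    linarith

theorem le_sum_min {p : List ℝ} (hp : ∀ a ∈ p, 0 ≤ a) {L : ℝ} (hL : 0 ≤ L) (h : L ≤ p.sum) :
    L ≤ (p.map fun a => min a L).sum := by
  have h0 : ∀ q : List ℝ, (∀ a ∈ q, 0 ≤ a) → 0 ≤ (q.map fun a => min a L).sum := fun q hq =>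
    List.sum_nonneg (by simpa using fun a ha => ⟨hq a ha, hL⟩)
  suffices min p.sum L ≤ (p.map fun a => min a L).sum by rwa [min_eq_right h] at this
  clear h
  induction p with
  | nil => simp
  | cons a p ih =>
    have ha := hp a (by simp)
    have hp' : ∀ b ∈ p, 0 ≤ b := fun b hb => hp b (by simp [hb])
    have ih := ih hp'
    have hs := List.sum_nonneg hp'
    have h1 := h0 p hp'
    rw [List.map_cons, List.sum_cons, List.sum_cons]
    rcases le_total a L with h | h
    · rw [min_eq_left h]
      rcases min_le_iff.1 ih with h2 | h2
      · exact (min_le_left _ _).trans (by linarith)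
      · exact (min_le_right _ _).trans (by linarith)
    · rw [min_eq_right h]
      exact (min_le_right _ _).trans (by linarith)

/-- The part of `x` between `L / 2 ^ m` and `L` suffices to separate the pairs at distance `L`. -/
theorem exists_separator_at_scale [Nonempty B] {C : ℝ} (hC : 10 ^ 50 * (2 ^ 100) ^ 9 ≤ C)
    {x : H → ℝ} (hx : 0 ≤ x) {L : ℝ} (hL : 0 < L) {m : ℕ} (hm : 2 * Fintype.card B ≤ 2 ^ m) :
    ∃ D : Finset H, M.tot D ≤ ratio C (Fintype.card B) *
        (2 / L * ∫ θ in (L / 2 ^ m)..L, M.tot (lev x θ)) ∧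
      ∀ a b, M.Far univ x (M.node a) (M.node b) L → ¬ M.Reach Dᶜ (M.node a) (M.node b) := by
  set d := L / 2 ^ m with hd
  have hd0 : 0 < d := by positivity
  have hdL : d ≤ L := div_le_self hL.le (one_le_pow₀ one_le_two)
  have hdB : (Fintype.card B : ℝ) * d ≤ L / 2 := by
    have : (2 * Fintype.card B : ℝ) ≤ 2 ^ m := by exact_mod_cast hm
    rw [hd, mul_div_assoc', div_le_iff₀ (by positivity)]
    nlinarith
  let y : H → ℝ := fun h => max (min (x h) L - d) 0
  have hy : lov M.tot y ≤ ∫ θ in d..L, M.tot (lev x θ) := by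
    rw [lov_eq M.tot_poly (T := L - d) fun h => max_le
      (sub_le_sub_right (min_le_right _ _) _) (sub_nonneg.2 hdL)]
    have e := intervalIntegral.integral_comp_add_right (a := 0) (b := L - d)
      (fun θ => M.tot (lev x θ)) d
    rw [zero_add, sub_add_cancel] at e
    rw [← e]
    refine intervalIntegral.integral_mono_on_of_le_Ioo (sub_nonneg.2 hdL)
      (intervalIntegrable_lev M.tot_poly y _ _) ?_ fun θ hθ => ?_
    · have : Antitone fun θ => M.tot (lev x (θ + d)) := fun a b hab =>
        antitone_lev M.tot_poly x (add_le_add_left hab d)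
      exact this.intervalIntegrable
    · refine M.tot_poly.mono _ _ fun h hh => ?_
      rw [mem_lev] at *
      rcases le_max_iff.1 hh with h1 | h1
      · linarith [min_le_left (x h) L]
      · linarith [hθ.1]
  obtain ⟨D, hD, hs⟩ := exists_separator_mul_lov (M := M) hC (x := fun h => 2 / L * y h)
    (fun h => mul_nonneg (by positivity) (le_max_right _ _))
  rw [lov_smul y (by positivity)] at hD
  refine ⟨D, hD.trans ?_, fun a b hab => hs a b ?_⟩
  · exact mul_le_mul_of_nonneg_left (mul_le_mul_of_nonneg_left hy (by positivity))
      (ratio_nonneg (le_trans (by norm_num) hC) (Nat.one_le_cast.2 Fintype.card_pos))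
  · refine far_of_paths (fun h => mul_nonneg (by positivity) (le_max_right _ _)) fun p hp => ?_
    rw [mem_paths] at hp
    have hlen : p.length ≤ Fintype.card B := by simpa using hp.2.length_le_card
    have h1 := hab p hp.1
    have h2 := le_sum_min (p := p.map x) (by simpa using fun a _ => hx a) hL.le h1
    have h3 : ∀ q : List H, ((q.map x).map fun a => min a L).sum - q.length * d ≤
        (q.map y).sum := fun q => by
      induction q with
      | nil => simp
      | cons a q ih =>
        simp only [List.map_cons, List.sum_cons, List.length_cons, Nat.cast_add, Nat.cast_one]
        have : min (x a) L - d ≤ y a := le_max_left _ _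
        linarith
    have h4 := h3 p
    have h5 : (p.length : ℝ) * d ≤ Fintype.card B * d :=
      mul_le_mul_of_nonneg_right (by exact_mod_cast hlen) hd0.le
    have h6 : L / 2 ≤ (p.map y).sum := by linarith
    rw [len, List.sum_map_mul_left]
    calc (1 : ℝ) = 2 / L * (L / 2) := by field_simp
      _ ≤ _ := mul_le_mul_of_nonneg_left h6 (by positivity)

theorem sum_integral_dyadic_le (x : H → ℝ) {l : ℝ} (hl : 0 ≤ l) (J m : ℕ) :
    ∑ j ∈ range J, ∫ θ in (2 ^ j * l / 2 ^ m)..(2 ^ j * l), M.tot (lev x θ) ≤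
      m * lov M.tot x := by
  have hi := intervalIntegrable_lev M.tot_poly x
  induction m with
  | zero => simp
  | succ m ih =>
    have e : ∀ j : ℕ, ∫ θ in (2 ^ j * l / 2 ^ (m + 1))..(2 ^ j * l), M.tot (lev x θ) =
        (∫ θ in (2 ^ j * (l / 2 ^ (m + 1)))..(2 ^ (j + 1) * (l / 2 ^ (m + 1))),
          M.tot (lev x θ)) + ∫ θ in (2 ^ j * l / 2 ^ m)..(2 ^ j * l), M.tot (lev x θ) := fun j => by
      rw [← intervalIntegral.integral_add_adjacent_intervals (hi _ (2 ^ j * l / 2 ^ m)) (hi _ _)]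
      congr 2
      · ring
      · rw [pow_succ, pow_succ]; field_simp
    rw [Finset.sum_congr rfl fun j _ => e j, Finset.sum_add_distrib,
      intervalIntegral.sum_integral_adjacent_intervals
        (a := fun j : ℕ => 2 ^ j * (l / 2 ^ (m + 1))) fun j _ => hi _ _]
    have h1 := integral_lev_le_lov M.tot_poly x (2 ^ J * (l / 2 ^ (m + 1)))
    rw [← intervalIntegral.integral_add_adjacent_intervals
      (hi 0 (2 ^ 0 * (l / 2 ^ (m + 1)))) (hi _ _)] at h1
    have h2 : 0 ≤ ∫ θ in (0 : ℝ)..(2 ^ 0 * (l / 2 ^ (m + 1))), M.tot (lev x θ) :=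
      intervalIntegral.integral_nonneg (by positivity) fun _ _ => M.tot_poly.nonneg _
    push_cast
    linarith

theorem min_sub_le_sum_dyadic (a l : ℝ) (J : ℕ) :
    min a (2 ^ J * l) - l ≤ ∑ j ∈ range J, 2 ^ j * l * (if 2 ^ j * l ≤ a then 1 else 0) := by
  induction J with
  | zero => simp
  | succ J ih =>
    rw [sum_range_succ]
    split_ifs with h
    · rw [min_eq_right h] at ih
      have := min_le_right a (2 ^ (J + 1) * l)
      rw [pow_succ] at *
      linarith
    · rw [min_eq_left (not_le.1 h).le] at ih
      have := min_le_left a (2 ^ (J + 1) * l)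
      linarith

/-- Rounding of a fractional sparsest cut. -/
theorem exists_sparse_cut [Nonempty B] {C : ℝ} (hC : 10 ^ 50 * (2 ^ 100) ^ 9 ≤ C)
    {x : H → ℝ} (hx : 0 ≤ x) {m : ℕ} (hm : 2 * Fintype.card B ≤ 2 ^ m)
    {ι : Type*} [Fintype ι] (s t : ι → B) {d l : ι → ℝ} (hd : ∀ i, 0 ≤ d i) (hl : ∀ i, 0 ≤ l i)
    (hsum : 1 ≤ ∑ i, d i * l i) (hfar : ∀ i, M.Far univ x (M.node (s i)) (M.node (t i)) (l i)) :
    ∃ D : Finset H,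
      0 < ∑ i, (if M.Reach Dᶜ (M.node (s i)) (M.node (t i)) then 0 else d i) ∧
      M.tot D ≤ 4 * ratio C (Fintype.card B) * m * lov M.tot x *
        ∑ i, (if M.Reach Dᶜ (M.node (s i)) (M.node (t i)) then 0 else d i) := by
  set K := ratio C (Fintype.card B)
  have hK : 0 ≤ K :=
    ratio_nonneg (le_trans (by norm_num) hC) (Nat.one_le_cast.2 Fintype.card_pos)
  have hS : 0 < ∑ i, d i := by
    refine (Finset.sum_nonneg fun i _ => hd i).lt_of_ne fun h => ?_
    have h0 := (Finset.sum_eq_zero_iff_of_nonneg fun i _ => hd i).1 h.symm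
    rw [Finset.sum_eq_zero fun i hi => by rw [h0 i hi, zero_mul]] at hsum
    linarith
  set w := 1 / (2 * ∑ i, d i) with hw
  have hw0 : 0 < w := by positivity
  obtain ⟨J, hJ⟩ := pow_unbounded_of_one_lt ((∑ i, l i) / w) one_lt_two
  rw [div_lt_iff₀ hw0] at hJ
  choose D hD hs using fun j : ℕ => exists_separator_at_scale (M := M) hC hx
    (L := 2 ^ j * w) (by positivity) hm
  let dem : Finset H → ℝ := fun D =>
    ∑ i, (if M.Reach Dᶜ (M.node (s i)) (M.node (t i)) then 0 else d i)
  have hdem : ∀ D, 0 ≤ dem D := fun D => Finset.sum_nonneg fun i _ => by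
    split_ifs
    exacts [le_rfl, hd i]
  have hdem2 : ∀ j, ∑ i, d i * (if 2 ^ j * w ≤ l i then 1 else 0) ≤ dem (D j) := fun j =>
    Finset.sum_le_sum fun i _ => by
      split_ifs with h1 h2
      · exact absurd h2 (hs j _ _ fun p hp => h1.trans (hfar i p hp))
      · rw [mul_one]
      · rw [mul_zero]
      · rw [mul_zero]; exact hd i
  have h1 : 1 / 2 ≤ ∑ j ∈ range J, 2 ^ j * w * dem (D j) := by
    calc (1 : ℝ) / 2 ≤ ∑ i, d i * (l i - w) := by
          simp only [mul_sub, Finset.sum_sub_distrib, ← Finset.sum_mul]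
          have : (∑ i, d i) * w = 1 / 2 := by rw [hw]; field_simp
          linarith
      _ ≤ ∑ i, d i * ∑ j ∈ range J, 2 ^ j * w * (if 2 ^ j * w ≤ l i then 1 else 0) := by
          refine Finset.sum_le_sum fun i _ => mul_le_mul_of_nonneg_left ?_ (hd i)
          have h := min_sub_le_sum_dyadic (l i) w J
          rwa [min_eq_left ((Finset.single_le_sum (f := l) (fun i _ => hl i)
            (Finset.mem_univ i)).trans hJ.le)] at h
      _ = ∑ j ∈ range J, 2 ^ j * w * ∑ i, d i * (if 2 ^ j * w ≤ l i then 1 else 0) := by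
          simp only [Finset.mul_sum]
          rw [Finset.sum_comm]
          exact Finset.sum_congr rfl fun j _ => Finset.sum_congr rfl fun i _ => by ring
      _ ≤ _ := Finset.sum_le_sum fun j _ => mul_le_mul_of_nonneg_left (hdem2 j) (by positivity)
  have h2 : ∑ j ∈ range J, 2 ^ j * w * M.tot (D j) ≤ 2 * K * (m * lov M.tot x) := by
    refine le_trans (Finset.sum_le_sum fun j _ => ?_)
      (le_trans (Finset.mul_sum _ _ _).symm.le
        (mul_le_mul_of_nonneg_left (sum_integral_dyadic_le (M := M) x hw0.le J m)
          (show 0 ≤ 2 * K by positivity)))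
    refine (mul_le_mul_of_nonneg_left (hD j) (by positivity)).trans (le_of_eq ?_)
    field_simp
    exact mul_comm _ _
  by_contra! hcon
  set R := 4 * K * m * lov M.tot x with hR
  have h3 : ∑ j ∈ range J, 2 ^ j * w * (R * dem (D j)) <
      ∑ j ∈ range J, 2 ^ j * w * M.tot (D j) := by
    obtain ⟨j, hj, hj0⟩ : ∃ j ∈ range J, 0 < 2 ^ j * w * dem (D j) := by
      by_contra! h
      linarith [Finset.sum_nonpos h]
    refine Finset.sum_lt_sum (fun j _ => mul_le_mul_of_nonneg_left ?_ (by positivity))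
      ⟨j, hj, mul_lt_mul_of_pos_left (hcon _ ?_) (by positivity)⟩
    · rcases (hdem (D j)).lt_or_eq with h | h
      · exact (hcon _ h).le
      · rw [← h, mul_zero]
        exact M.tot_poly.nonneg _
    · exact pos_of_mul_pos_right hj0 (by positivity)
  have h4 : ∑ j ∈ range J, 2 ^ j * w * (R * dem (D j)) =
      R * ∑ j ∈ range J, 2 ^ j * w * dem (D j) := by
    rw [Finset.mul_sum]
    exact Finset.sum_congr rfl fun j _ => by ring
  have hR0 : 0 ≤ R := by
    have := lov_nonneg M.tot_poly x
    positivity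
  have h5 := mul_le_mul_of_nonneg_left h1 hR0
  nlinarith

end ArcNet

theorem IsPolymatroid.of_restricted {E H : Type*} [DecidableEq E] [DecidableEq H] {ρ : Finset E → ℝ}
    {G : Finset E} (h0 : ρ ∅ = 0) (hmono : ∀ A B, A ⊆ B → B ⊆ G → ρ A ≤ ρ B)
    (hsub : ∀ A B, A ⊆ G → B ⊆ G → ρ (A ∪ B) + ρ (A ∩ B) ≤ ρ A + ρ B) (φ : E → H) :
    IsPolymatroid fun S : Finset H => ρ (G.filter fun e => φ e ∈ S) where
  empty := by simpa using h0
  mono A B h := hmono _ _ (fun e he => by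
    rw [mem_filter] at *
    exact ⟨he.1, h he.2⟩) (filter_subset _ _)
  submod A B := by
    refine le_trans (le_of_eq ?_) (hsub _ _ (filter_subset _ _) (filter_subset _ _))
    congr 2
    · ext e
      simp only [mem_filter, mem_union]
      tauto
    · ext e
      simp only [mem_filter, mem_inter]
      tauto

namespace DirPolyNet
variable {V E : Type} [Fintype V] [Fintype E] [DecidableEq V] [DecidableEq E] (N : DirPolyNet V E)

/-- The cost of a set of half-edges inside a block. -/
noncomputable def arcCost : V × Bool → Finset (E × Bool) → ℝ
  | (v, true), S => N.rhoP v ((N.outE v).filter fun e => (e, true) ∈ S)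
  | (v, false), S => N.rhoM v ((N.inE v).filter fun e => (e, false) ∈ S)

/-- The initial point of a half-edge. -/
def arcSrc : E × Bool → V ⊕ E
  | (e, true) => Sum.inl (N.tail e)
  | (e, false) => Sum.inr e

/-- The terminal point of a half-edge. -/
def arcDst : E × Bool → V ⊕ E
  | (e, true) => Sum.inr e
  | (e, false) => Sum.inl (N.head e)

/-- The block containing a half-edge. -/
def arcOwn : E × Bool → V × Bool
  | (e, true) => (N.tail e, true)
  | (e, false) => (N.head e, false)

theorem arcCost_poly : ∀ b, IsPolymatroid (N.arcCost b)
  | (v, true) => .of_restricted (N.rhoP_empty v) (N.rhoP_mono v) (N.rhoP_submod v) (·, true)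
  | (v, false) => .of_restricted (N.rhoM_empty v) (N.rhoM_mono v) (N.rhoM_submod v) (·, false)

/-- Subdivide every edge; the two halves are then owned by the two endpoints. -/
noncomputable def arcNet : ArcNet (V ⊕ E) (E × Bool) (V × Bool) where
  src := N.arcSrc
  dst := N.arcDst
  own := N.arcOwn
  node b := Sum.inl b.1
  isOut b := b.2 = true
  src_own := by
    rintro ⟨e, _ | _⟩ h
    · cases h
    · rfl
  dst_own := by
    rintro ⟨e, _ | _⟩ h
    · rfl
    · exact absurd rfl h
  cost := N.arcCost
  cost_poly := N.arcCost_poly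
  cost_local := by
    rintro ⟨v, _ | _⟩ S
    · refine congrArg (N.rhoM v) (Finset.filter_congr fun e he => ?_)
      rw [inE, mem_filter] at he
      rw [@mem_filter _ _ (fun _ => Classical.propDecidable _)]
      exact ⟨fun h => ⟨h, congrArg (·, false) he.2⟩, fun h => h.1⟩
    · refine congrArg (N.rhoP v) (Finset.filter_congr fun e he => ?_)
      rw [outE, mem_filter] at he
      rw [@mem_filter _ _ (fun _ => Classical.propDecidable _)]
      exact ⟨fun h => ⟨h, congrArg (·, true) he.2⟩, fun h => h.1⟩

theorem arcNet_tot (S : Finset (E × Bool)) : N.arcNet.tot S =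
    ∑ v, (N.rhoP v ((N.outE v).filter fun e => (e, true) ∈ S) +
      N.rhoM v ((N.inE v).filter fun e => (e, false) ∈ S)) := by
  rw [ArcNet.tot, Fintype.sum_prod_type]
  refine Finset.sum_congr rfl fun v _ => ?_
  rw [Fintype.sum_bool]
  rfl

/-- The edges (other than loops) one of whose halves lies in `D`. -/
noncomputable def cutOf (D : Finset (E × Bool)) : Finset E :=
  univ.filter fun e => N.tail e ≠ N.head e ∧ ((e, true) ∈ D ∨ (e, false) ∈ D)

variable {N}

theorem mem_cutOf {D : Finset (E × Bool)} {e : E} :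
    e ∈ N.cutOf D ↔ N.tail e ≠ N.head e ∧ ((e, true) ∈ D ∨ (e, false) ∈ D) := by simp [cutOf]

theorem cutCost_cutOf_le (D : Finset (E × Bool)) : N.cutCost (N.cutOf D) ≤ N.arcNet.tot D := by
  let g : E → V := fun e => if (e, true) ∈ D then N.tail e else N.head e
  have hg : N.Valid (N.cutOf D) g := fun e _ => by
    simp only [g]
    split_ifs <;> simp
  unfold cutCost
  refine le_trans (csInf_le ⟨0, ?_⟩ ⟨g, hg, rfl⟩) ?_
  · rintro _ ⟨g, -, rfl⟩
    refine Finset.sum_nonneg fun v _ => add_nonneg (N.rhoM_nonneg v _ ?_) (N.rhoP_nonneg v _ ?_)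
    · exact (filter_subset _ _).trans inter_subset_left
    · exact (filter_subset _ _).trans inter_subset_left
  · rw [arcNet_tot]
    refine Finset.sum_le_sum fun v _ => ?_
    rw [add_comm]
    refine add_le_add (N.rhoP_mono v _ _ (fun e he => ?_) (filter_subset _ _))
      (N.rhoM_mono v _ _ (fun e he => ?_) (filter_subset _ _))
    · simp only [mem_filter, mem_inter, mem_cutOf, outE, mem_univ, true_and, g] at *
      obtain ⟨⟨rfl, h1, -⟩, h2⟩ := he
      refine ⟨rfl, ?_⟩
      by_contra h
      rw [if_neg h] at h2
      exact h1 h2.symm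
    · simp only [mem_filter, mem_inter, mem_cutOf, inE, mem_univ, true_and, g] at *
      obtain ⟨⟨rfl, h1, h3⟩, h2⟩ := he
      refine ⟨rfl, h3.resolve_left fun h => ?_⟩
      rw [if_pos h] at h2
      exact h1 h2

theorem IsWalk.reach {D S : Finset (E × Bool)} (hS : ∀ h, h ∉ D → h ∈ S) {s t : V} {p : List E}
    (hp : N.IsWalk s t p) (hD : ∀ e ∈ p, e ∉ N.cutOf D) :
    N.arcNet.Reach S (Sum.inl s) (Sum.inl t) := by
  induction p generalizing s with
  | nil =>
    cases hp
    exact ⟨[], rfl⟩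
  | cons e p ih =>
    obtain ⟨rfl, h2⟩ := hp
    obtain ⟨q, hq⟩ := ih h2 fun a ha => hD a (by simp [ha])
    by_cases h : N.tail e = N.head e
    · rw [h]
      exact ⟨q, hq⟩
    · have := hD e (by simp)
      simp only [mem_cutOf, not_and, not_or] at this
      exact ⟨(e, true) :: (e, false) :: q, hS _ (this h).1, rfl, hS _ (this h).2, rfl, hq⟩

/-- The length of a walk when each edge has the total length of its two halves. -/
noncomputable def walkLen (x : E × Bool → ℝ) (p : List E) : ℝ :=
  (p.map fun e => x (e, true) + x (e, false)).sum

theorem exists_walk_of_arcNet (x : E × Bool → ℝ) {G : Finset (E × Bool)} {t : V} :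
    ∀ (p : List (E × Bool)) (s : V), N.arcNet.Walk G (Sum.inl s) (Sum.inl t) p →
      ∃ q, N.IsWalk s t q ∧ ArcNet.len x p = walkLen x q
  | [], s, h => ⟨[], Sum.inl.inj h, by simp [ArcNet.len, walkLen]⟩
  | (e, false) :: p, s, h => by
    have := h.2.1
    simp [arcNet, arcSrc] at this
  | [(e, true)], s, h => by
    have := h.2.2
    simp [arcNet, arcDst, ArcNet.Walk] at this
  | (e, true) :: (e', true) :: p, s, h => by
    have := h.2.2.2.1
    simp [arcNet, arcDst, arcSrc] at this
  | (e, true) :: (e', false) :: p, s, h => by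
    have h1 : e' = e := by simpa [arcNet, arcDst, arcSrc] using h.2.2.2.1
    have h2 : N.tail e = s := by simpa [arcNet, arcSrc] using h.2.1
    subst h1
    obtain ⟨q, hq, hl⟩ := exists_walk_of_arcNet x p (N.head e') h.2.2.2.2
    refine ⟨e' :: q, ⟨h2, hq⟩, ?_⟩
    rw [ArcNet.len_cons, ArcNet.len_cons, hl]
    simp [walkLen, add_assoc]

theorem IsWalk.exists_suffix {s t u : V} {p : List E} (hp : N.IsWalk s t p)
    (hu : u ∈ N.walkVerts s p) :
    ∃ q, N.IsWalk u t q ∧ q.Sublist p ∧ (N.walkVerts u q).Sublist (N.walkVerts s p) := by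
  induction p generalizing s with
  | nil =>
    obtain rfl : u = s := by simpa [walkVerts] using hu
    exact ⟨[], hp, .refl _, .refl _⟩
  | cons e p ih =>
    rcases List.mem_cons.1 hu with rfl | hu
    · exact ⟨e :: p, hp, .refl _, .refl _⟩
    · obtain ⟨q, hq, h1, h2⟩ := ih hp.2 hu
      exact ⟨q, hq, h1.cons _, h2.cons _⟩

theorem IsWalk.exists_isPath {s t : V} {p : List E} (hp : N.IsWalk s t p) :
    ∃ q, N.IsPath s t q ∧ q.Sublist p := by
  induction p generalizing s with
  | nil => exact ⟨[], ⟨hp, by simp [walkVerts]⟩, .refl _⟩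
  | cons e p ih =>
    obtain ⟨q, ⟨hq, hn⟩, hs⟩ := ih hp.2
    by_cases h : s ∈ N.walkVerts (N.head e) q
    · obtain ⟨r, hr, h1, h2⟩ := hq.exists_suffix h
      exact ⟨r, ⟨hr, hn.sublist h2⟩, (h1.trans hs).cons _⟩
    · exact ⟨e :: q, ⟨⟨hp.1, hq⟩, List.nodup_cons.2 ⟨h, hn⟩⟩, hs.cons_cons _⟩

theorem IsWalk.map_tail_sublist {s t : V} {p : List E} (hp : N.IsWalk s t p) :
    (p.map N.tail).Sublist (N.walkVerts s p) := by
  induction p generalizing s with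
  | nil => simp
  | cons e p ih =>
    rw [List.map_cons, hp.1]
    exact (ih hp.2).cons_cons _

theorem IsPath.nodup {s t : V} {p : List E} (hp : N.IsPath s t p) : p.Nodup :=
  (hp.2.sublist hp.1.map_tail_sublist).of_map

variable (N)

/-- The simple paths from `s` to `t`. -/
noncomputable def pathSet (s t : V) : Finset (List E) :=
  Set.Finite.toFinset (s := {p | N.IsPath s t p})
    ((Set.finite_coe_iff.1 (Finite.of_fintype {p : List E // p.Nodup})).subset
      fun _ hp => hp.nodup)

variable {N}

theorem mem_pathSet {s t : V} {p : List E} : p ∈ N.pathSet s t ↔ N.IsPath s t p := by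
  simp [pathSet]

theorem edgeFlow_eq {ι : Type} [Fintype ι] {s t : ι → V} {f : ι → List E → ℝ}
    (hf : ∀ i p, f i p ≠ 0 → N.IsPath (s i) (t i) p) (e : E) :
    N.edgeFlow f e = ∑ i, ∑ p ∈ N.pathSet (s i) (t i), if e ∈ p then f i p else 0 := by
  refine Finset.sum_congr rfl fun i _ => ?_
  rw [finsum_mem_def, finsum_eq_sum_of_support_subset (s := N.pathSet (s i) (t i))]
  · refine Finset.sum_congr rfl fun p _ => ?_
    simp [Set.indicator_apply]
  · intro p hp
    exact mem_pathSet.2 (hf i p fun h => hp (by simp [Set.indicator_apply, h]))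

theorem rate_eq {ι : Type} [Fintype ι] {s t : ι → V} {f : ι → List E → ℝ}
    (hf : ∀ i p, f i p ≠ 0 → N.IsPath (s i) (t i) p) (i : ι) :
    rate f i = ∑ p ∈ N.pathSet (s i) (t i), f i p :=
  finsum_eq_sum_of_support_subset _ fun p hp => mem_pathSet.2 (hf i p hp)

theorem IsFlow.rate_le {ι : Type} [Fintype ι] {s t : ι → V} {f : ι → List E → ℝ}
    (hf : N.IsFlow s t f) {i : ι} (hst : s i ≠ t i) :
    rate f i ≤ N.rhoP (s i) (N.outE (s i)) := by
  refine le_trans ?_ (hf.capP (s i) _ (Finset.Subset.refl _))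
  rw [rate_eq hf.supp]
  calc ∑ p ∈ N.pathSet (s i) (t i), f i p
      ≤ ∑ p ∈ N.pathSet (s i) (t i), ∑ e ∈ N.outE (s i), if e ∈ p then f i p else 0 := by
        refine Finset.sum_le_sum fun p hp => ?_
        rw [mem_pathSet] at hp
        cases p with
        | nil => exact absurd hp.1 hst
        | cons e p =>
          refine le_trans (le_of_eq ?_) (Finset.single_le_sum
            (f := fun a => if a ∈ e :: p then f i (e :: p) else 0) (fun a _ => ?_)
            (show e ∈ N.outE (s i) by simpa [outE] using hp.1.1))
          · simp
          · split_ifs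
            exacts [hf.nonneg _ _, le_rfl]
    _ = ∑ e ∈ N.outE (s i), ∑ p ∈ N.pathSet (s i) (t i), if e ∈ p then f i p else 0 :=
        Finset.sum_comm
    _ ≤ ∑ e ∈ N.outE (s i), N.edgeFlow f e := by
        refine Finset.sum_le_sum fun e _ => ?_
        rw [edgeFlow_eq hf.supp]
        refine Finset.single_le_sum
          (f := fun i => ∑ p ∈ N.pathSet (s i) (t i), if e ∈ p then f i p else 0)
          (fun i _ => Finset.sum_nonneg fun p _ => ?_) (Finset.mem_univ i)
        split_ifs
        exacts [hf.nonneg _ _, le_rfl]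

theorem bddAbove_concurrent {ι : Type} [Fintype ι] {s t : ι → V} {d : ι → ℝ}
    (hst : ∀ i, s i ≠ t i) (hd : ∃ i, 0 < d i) :
    BddAbove {r : ℝ | ∃ f : ι → List E → ℝ, N.IsFlow s t f ∧ ∀ i, rate f i = r * d i} := by
  obtain ⟨i, hi⟩ := hd
  refine ⟨N.rhoP (s i) (N.outE (s i)) / d i, ?_⟩
  rintro r ⟨f, hf, hr⟩
  rw [le_div_iff₀ hi, ← hr i]
  exact hf.rate_le (hst i)

theorem tot_image_false {v : V} {S : Finset E} (hS : S ⊆ N.inE v) :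
    N.arcNet.tot (S.image (·, false)) = N.rhoM v S := by
  rw [arcNet_tot, Finset.sum_eq_single v]
  · have h1 : ((N.outE v).filter fun e =>
        (e, true) ∈ S.image (·, false)) = ∅ := by
      ext e
      simp
    have h2 : ((N.inE v).filter fun e =>
        (e, false) ∈ S.image (·, false)) = S := by
      ext e
      simpa using @hS e
    rw [h1, h2, N.rhoP_empty, zero_add]
  · intro w _ hw
    have h1 : ((N.outE w).filter fun e =>
        (e, true) ∈ S.image (·, false)) = ∅ := by
      ext e
      simp
    have h2 : ((N.inE w).filter fun e =>
        (e, false) ∈ S.image (·, false)) = ∅ := by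
      refine filter_eq_empty_iff.2 fun e he h => hw ?_
      have h3 : e ∈ S := by simpa using h
      have h4 := hS h3
      simp only [inE, mem_filter, mem_univ, true_and] at he h4
      rw [← he, h4]
    rw [h1, h2, N.rhoP_empty, N.rhoM_empty, zero_add]
  · simp

theorem tot_image_true {v : V} {S : Finset E} (hS : S ⊆ N.outE v) :
    N.arcNet.tot (S.image (·, true)) = N.rhoP v S := by
  rw [arcNet_tot, Finset.sum_eq_single v]
  · have h1 : ((N.inE v).filter fun e =>
        (e, false) ∈ S.image (·, true)) = ∅ := by
      ext e
      simp
    have h2 : ((N.outE v).filter fun e =>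
        (e, true) ∈ S.image (·, true)) = S := by
      ext e
      simpa using @hS e
    rw [h1, h2, N.rhoM_empty, add_zero]
  · intro w _ hw
    have h1 : ((N.inE w).filter fun e =>
        (e, false) ∈ S.image (·, true)) = ∅ := by
      ext e
      simp
    have h2 : ((N.outE w).filter fun e =>
        (e, true) ∈ S.image (·, true)) = ∅ := by
      refine filter_eq_empty_iff.2 fun e he h => hw ?_
      have h3 : e ∈ S := by simpa using h
      have h4 := hS h3
      simp only [outE, mem_filter, mem_univ, true_and] at he h4
      rw [← he, h4]
    rw [h1, h2, N.rhoP_empty, N.rhoM_empty, zero_add]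
  · simp

end DirPolyNet

namespace DirPolyNet
variable {V E : Type} [Fintype V] [Fintype E] [DecidableEq V] [DecidableEq E] {N : DirPolyNet V E}

/-- A fractional flow supported on simple paths that satisfies the capacity constraints and whose
rates are at least `r` times the demands witnesses that the maximum concurrent flow is at
least `r`. -/
theorem le_maxConcurrent {ι : Type} [Fintype ι] {s t : ι → V} {d : ι → ℝ}
    (hst : ∀ i, s i ≠ t i) (hd : ∀ i, 0 ≤ d i) (hd' : ∃ i, 0 < d i) {r : ℝ} (hr : 0 ≤ r)
    {u : ι → List E → ℝ} (hu : ∀ i p, 0 ≤ u i p)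
    (hrate : ∀ i, r * d i ≤ ∑ p ∈ N.pathSet (s i) (t i), u i p)
    (hcap : ∀ S : Finset (E × Bool), ∑ h ∈ S, ∑ i, ∑ p ∈ N.pathSet (s i) (t i),
      (if h.1 ∈ p then u i p else 0) ≤ N.arcNet.tot S) :
    r ≤ N.maxConcurrent s t d := by
  let a : ι → ℝ := fun i => r * d i / ∑ p ∈ N.pathSet (s i) (t i), u i p
  have hrd : ∀ i, 0 ≤ r * d i := fun i => mul_nonneg hr (hd i)
  have ha0 : ∀ i, 0 ≤ a i := fun i => div_nonneg (hrd i) ((hrd i).trans (hrate i))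
  have ha1 : ∀ i, a i ≤ 1 := fun i => div_le_one_of_le₀ (hrate i) ((hrd i).trans (hrate i))
  let f : ι → List E → ℝ := fun i p => if p ∈ N.pathSet (s i) (t i) then a i * u i p else 0
  have hsupp : ∀ i p, f i p ≠ 0 → N.IsPath (s i) (t i) p := fun i p h => by
    by_contra hp
    exact h (if_neg fun h' => hp (mem_pathSet.1 h'))
  have hflow : ∀ e, N.edgeFlow f e ≤
      ∑ i, ∑ p ∈ N.pathSet (s i) (t i), (if e ∈ p then u i p else 0) := fun e => by
    rw [edgeFlow_eq hsupp]
    refine Finset.sum_le_sum fun i _ => Finset.sum_le_sum fun p hp => ?_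
    split_ifs
    · simp only [f, if_pos hp]
      exact mul_le_of_le_one_left (hu i p) (ha1 i)
    · exact le_rfl
  refine le_csSup (bddAbove_concurrent hst hd') ⟨f, ⟨fun i p => ?_, hsupp, fun i => ?_,
    fun v S hS => ?_, fun v S hS => ?_⟩, fun i => ?_⟩
  · simp only [f]
    split_ifs
    exacts [mul_nonneg (ha0 i) (hu i p), le_rfl]
  · exact (N.pathSet (s i) (t i)).finite_toSet.subset fun p hp => mem_pathSet.2 (hsupp i p hp)
  · rw [← tot_image_false hS]
    refine le_trans ?_ (hcap _)
    rw [Finset.sum_image fun _ _ _ _ h => (Prod.mk.inj h).1]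
    exact Finset.sum_le_sum fun e _ => hflow e
  · rw [← tot_image_true hS]
    refine le_trans ?_ (hcap _)
    rw [Finset.sum_image fun _ _ _ _ h => (Prod.mk.inj h).1]
    exact Finset.sum_le_sum fun e _ => hflow e
  · rw [rate_eq hsupp, Finset.sum_congr rfl fun p hp => if_pos hp, ← Finset.mul_sum]
    rcases eq_or_ne (∑ p ∈ N.pathSet (s i) (t i), u i p) 0 with h | h
    · rw [h, mul_zero]
      exact le_antisymm (hrd i) (h ▸ hrate i)
    · exact div_mul_cancel₀ _ h

theorem IsPath.sum_eq_walkLen {s t : V} {p : List E} (hp : N.IsPath s t p) (x : E × Bool → ℝ) :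
    ∑ h, (if h.1 ∈ p then x h else 0) = walkLen x p := by
  rw [Fintype.sum_prod_type, walkLen, ← List.sum_toFinset _ hp.nodup]
  simp only [Fintype.sum_bool]
  rw [← Finset.sum_filter_add_sum_filter_not univ (· ∈ p.toFinset)]
  rw [Finset.sum_eq_zero (s := univ.filter fun e => e ∉ p.toFinset) (fun e he => by
    have : e ∉ p := by simpa using he
    simp [this]), add_zero]
  refine Finset.sum_congr (by ext; simp) fun e he => ?_
  have : e ∈ p := by simpa using he
  simp [this]

theorem sum_mul_sum_mem {α : Type*} [Fintype α] [DecidableEq α] (z : Finset α → ℝ) (g : α → ℝ) :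
    ∑ S, z S * ∑ a ∈ S, g a = ∑ a, (∑ S, z S * (if a ∈ S then 1 else 0)) * g a := by
  have h (S : Finset α) : ∑ a ∈ S, g a = ∑ a, (if a ∈ S then 1 else 0) * g a := by simp
  rw [Finset.sum_congr rfl fun S _ => by rw [h, Finset.mul_sum], Finset.sum_comm]
  exact Finset.sum_congr rfl fun a _ => by
    rw [Finset.sum_mul]
    exact Finset.sum_congr rfl fun S _ => (mul_assoc _ _ _).symm

omit [Fintype E] [DecidableEq E] in
theorem walkLen_sublist {x : E × Bool → ℝ} (hx : 0 ≤ x) {p q : List E} (h : p.Sublist q) :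
    walkLen x p ≤ walkLen x q :=
  (h.map _).sum_le_sum (by simpa using fun e _ => add_nonneg (hx (e, true)) (hx (e, false)))

/-- Duality for the maximum concurrent flow. -/
theorem exists_lengths {ι : Type} [Fintype ι] {s t : ι → V} {d : ι → ℝ}
    (hst : ∀ i, s i ≠ t i) (hd : ∀ i, 0 ≤ d i) (hd' : ∃ i, 0 < d i) :
    ∃ (x : E × Bool → ℝ) (l : ι → ℝ), 0 ≤ x ∧ (∀ i, 0 ≤ l i) ∧ 1 ≤ ∑ i, d i * l i ∧
      (∀ i p, N.IsWalk (s i) (t i) p → l i ≤ walkLen x p) ∧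
      lov N.arcNet.tot x ≤ N.maxConcurrent s t d := by
  let P : Type := Σ i, N.pathSet (s i) (t i)
  have hP : ∀ g : P → ℝ, ∑ j, g j = ∑ i, ∑ p : N.pathSet (s i) (t i), g ⟨i, p⟩ := fun g =>
    Fintype.sum_sigma _
  let A : Finset (E × Bool) ⊕ ι → P ⊕ Unit → ℝ := fun a j => match a, j with
    | .inl S, .inl j => ∑ h ∈ S, if h.1 ∈ j.2.1 then 1 else 0
    | .inl _, .inr _ => 0
    | .inr i, .inl j => if i = j.1 then -1 else 0
    | .inr i, .inr _ => d i
  let b : Finset (E × Bool) ⊕ ι → ℝ := Sum.elim N.arcNet.tot fun _ => 0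
  let c : P ⊕ Unit → ℝ := Sum.elim (fun _ => 0) fun _ => 1
  obtain ⟨z, hz0, hz, hzb⟩ := exists_dual_of_bounded A b c (N.maxConcurrent s t d) 0
    (fun _ => le_rfl) (fun a => by
      rcases a with S | i
      · simpa [b] using N.arcNet.tot_poly.nonneg S
      · simp [b]) (fun u hu hub => by
      have e : ∑ j, c j * u j = u (.inr ()) := by simp [c]
      rw [e]
      let f : ι → List E → ℝ := fun i p =>
        if h : p ∈ N.pathSet (s i) (t i) then u (.inl ⟨i, p, h⟩) else 0
      have hf : ∀ i (p : N.pathSet (s i) (t i)), f i p = u (.inl ⟨i, p⟩) := fun i p =>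
        dif_pos p.2
      refine le_maxConcurrent hst hd hd' (hu _) (u := f) (fun i p => ?_) (fun i => ?_) fun S => ?_
      · simp only [f]
        split_ifs
        exacts [hu _, le_rfl]
      · have := hub (.inr i)
        simp only [A, b, Fintype.sum_sum_type, hP, Sum.elim_inr, Finset.univ_unique,
          Finset.sum_singleton] at this
        rw [Finset.sum_eq_single i (fun i' _ h => by simp [h.symm]) (by simp)] at this
        simp only [if_true, neg_mul, one_mul, Finset.sum_neg_distrib, ← hf] at this
        rw [Finset.sum_coe_sort (N.pathSet (s i) (t i)) (f i)] at this
        have e2 : u (.inr default) = u (.inr ()) := rfl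
        rw [mul_comm]
        linarith
      · have := hub (.inl S)
        simp only [A, b, Fintype.sum_sum_type, hP, Sum.elim_inl, zero_mul,
          Finset.sum_const_zero, add_zero, ← hf] at this
        refine le_trans (le_of_eq ?_) this
        rw [Finset.sum_comm]
        refine Finset.sum_congr rfl fun i _ => ?_
        rw [Finset.sum_coe_sort (N.pathSet (s i) (t i))
          (fun p => (∑ h ∈ S, if h.1 ∈ p then (1 : ℝ) else 0) * f i p), Finset.sum_comm]
        refine Finset.sum_congr rfl fun p _ => ?_
        rw [Finset.sum_mul]
        exact Finset.sum_congr rfl fun h _ => by split_ifs <;> simp)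
  let x : E × Bool → ℝ := fun h => ∑ S, z (.inl S) * (if h ∈ S then 1 else 0)
  have hx0 : 0 ≤ x := fun h => Finset.sum_nonneg fun S _ => mul_nonneg (hz0 _) (by
    split_ifs <;> norm_num)
  refine ⟨x, fun i => z (.inr i), hx0, fun i => hz0 _, ?_, fun i p hp => ?_, ?_⟩
  · have := hz (.inr ())
    simpa [A, c, Fintype.sum_sum_type, mul_comm] using this
  · obtain ⟨q, hq, hs⟩ := hp.exists_isPath
    have h1 := hz (.inl ⟨i, q, mem_pathSet.2 hq⟩)
    simp only [A, c, Fintype.sum_sum_type, Sum.elim_inl] at h1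
    rw [Finset.sum_eq_single i (fun i' _ h => by simp [h]) (by simp)] at h1
    simp only [if_true, mul_neg, mul_one] at h1
    refine le_trans ?_ (walkLen_sublist hx0 hs)
    rw [← hq.sum_eq_walkLen]
    refine le_trans (by linarith) (le_of_eq (show ∑ S, z (.inl S) *
      (∑ h ∈ S, if h.1 ∈ q then (1 : ℝ) else 0) = _ from ?_))
    rw [sum_mul_sum_mem]
    exact Finset.sum_congr rfl fun h _ => mul_ite_zero _ _ _ |>.trans (by rw [mul_one])
  · refine (le_trans (le_of_eq ?_) (lov_sum_indicator_le N.arcNet.tot_poly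
      (z := fun S => z (.inl S)) (fun S => hz0 _) univ)).trans ?_
    · congr!
    simpa [b, Fintype.sum_sum_type] using hzb

end DirPolyNet

theorem ratio_mul_le {C : ℝ} (hC : 0 ≤ C) {n : ℕ} (hn : 2 ≤ n) :
    ∃ m : ℕ, 2 * (2 * n) ≤ 2 ^ m ∧
      4 * ArcNet.ratio C (2 * n : ℕ) * m ≤
        2304 * C * (n : ℝ) ^ ((11 : ℝ) / 23) * Real.log n ^ (2 : ℝ) := by
  have hn' : (2 : ℝ) ≤ n := by exact_mod_cast hn
  have hn0 : (0 : ℝ) < n := by linarith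
  have hl2 := Real.log_two_gt_d9
  have hl : Real.log 2 ≤ Real.log n := Real.log_le_log two_pos hn'
  set L := Real.log n
  have hlogb : Real.logb 2 (2 * (2 * n)) ≤ 2 + 3 / 2 * L := by
    rw [Real.logb, div_le_iff₀ (by linarith), Real.log_mul (by norm_num) (by positivity),
      Real.log_mul (by norm_num) (by positivity)]
    nlinarith
  have hlogb0 : 0 ≤ Real.logb 2 (2 * (2 * n)) := Real.logb_nonneg one_lt_two (by linarith)
  refine ⟨⌈Real.logb 2 (2 * (2 * n))⌉₊, ?_, ?_⟩
  · have : (2 * (2 * n) : ℝ) ≤ 2 ^ ⌈Real.logb 2 (2 * (2 * n))⌉₊ := by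
      rw [← Real.rpow_natCast 2]
      refine le_trans (le_of_eq ?_)
        (Real.rpow_le_rpow_of_exponent_le one_le_two (Nat.le_ceil (Real.logb 2 (2 * (2 * n)))))
      rw [Real.rpow_logb two_pos (by norm_num) (by positivity)]
    exact_mod_cast this
  · have hm : (⌈Real.logb 2 (2 * (2 * n))⌉₊ : ℝ) ≤ 6 * L :=
      (Nat.ceil_lt_add_one hlogb0).le.trans (by linarith)
    have h1 : 1 + Real.log (2 * n : ℕ) ≤ 4 * L := by
      rw [Nat.cast_mul, Nat.cast_two, Real.log_mul (by norm_num) hn0.ne']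
      linarith
    have h2 : ((2 * n : ℕ) : ℝ) ^ ((11 : ℝ) / 23) ≤ 2 * (n : ℝ) ^ ((11 : ℝ) / 23) := by
      rw [Nat.cast_mul, Nat.cast_two, Real.mul_rpow two_pos.le hn0.le]
      refine mul_le_mul_of_nonneg_right ?_ (by positivity)
      exact (Real.rpow_le_rpow_of_exponent_le one_le_two (by norm_num)).trans (Real.rpow_one 2).le
    have hlog : 0 ≤ Real.log (2 * n : ℕ) := Real.log_natCast_nonneg _
    have hL : 0 ≤ L := by linarith
    calc 4 * ArcNet.ratio C (2 * n : ℕ) * ⌈Real.logb 2 (2 * (2 * n))⌉₊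
        ≤ 4 * (12 * C * (2 * (n : ℝ) ^ ((11 : ℝ) / 23)) * (4 * L)) * (6 * L) := by
          unfold ArcNet.ratio
          gcongr
      _ = _ := by rw [Real.rpow_two]; ring

/-- There are universal constants `C, c` such that in every directed
polymatroidal network on `n ≥ 2` nodes, for any multicommodity flow instance with `k`
source-sink pairs and demands `D`, there is an edge set `F` whose sparsity
`ν(F)/D(F)` is at most `C · n^(11/23) · (log n)^c · β`, where `β` is the maximum
concurrent flow. -/
theorem sparsest_cut_gap_directed :
    ∃ C c : ℝ, 0 < C ∧ 0 < c ∧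
      ∀ (V E : Type) [Fintype V] [Fintype E] [DecidableEq V] [DecidableEq E]
        (N : DirPolyNet V E) (k : ℕ) (s t : Fin k → V) (D : Fin k → ℝ),
        2 ≤ Fintype.card V →
        (∀ i, s i ≠ t i) →
        (∀ i, 0 ≤ D i) → (∃ i, 0 < D i) →
        ∃ F : Finset E, 0 < N.sepDemand s t D F ∧
          N.cutCost F / N.sepDemand s t D F ≤
            C * (Fintype.card V : ℝ) ^ ((11 : ℝ) / 23) *
              (Real.log (Fintype.card V)) ^ c * N.maxConcurrent s t D := by
  refine ⟨2304 * (10 ^ 50 * (2 ^ 100) ^ 9), 2, by positivity, by norm_num, ?_⟩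
  intro V E _ _ _ _ N k s t D hn hst hD hD'
  obtain ⟨x, l, hx, hl, hsum, hlen, hlov⟩ := exists_lengths (N := N) hst hD hD'
  obtain ⟨m, hm, hR⟩ := ratio_mul_le (C := 10 ^ 50 * (2 ^ 100) ^ 9) (by positivity) hn
  have hcard : Fintype.card (V × Bool) = 2 * Fintype.card V := by
    rw [Fintype.card_prod, Fintype.card_bool, mul_comm]
  have : Nonempty (V × Bool) := Fintype.card_pos_iff.1 (by omega)
  obtain ⟨S, hS0, hS⟩ := ArcNet.exists_sparse_cut (M := N.arcNet) le_rfl hx (hcard ▸ hm)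
    (fun i => (s i, true)) (fun i => (t i, true)) hD hl hsum (fun i p hp => by
      obtain ⟨q, hq, h⟩ := exists_walk_of_arcNet x p (s i) hp
      exact h ▸ hlen i q hq)
  rw [hcard] at hS
  obtain ⟨q, hq0, hSq, hdem⟩ : ∃ q : ℝ, 0 < q ∧ N.arcNet.tot S ≤
      4 * ArcNet.ratio (10 ^ 50 * (2 ^ 100) ^ 9) (2 * Fintype.card V : ℕ) * m *
        lov N.arcNet.tot x * q ∧ q ≤ N.sepDemand s t D (N.cutOf S) := by
    refine ⟨_, hS0, hS, ?_⟩
    refine Finset.sum_le_sum fun i _ => ?_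
    split_ifs with h1 h2 h2
    · exact hD i
    · exact le_rfl
    · exact le_rfl
    · refine absurd ?_ h1
      obtain ⟨p, hp, hpS⟩ := not_not.1 h2
      exact hp.reach (fun h hh => by simpa using hh) hpS
  have hlov0 := lov_nonneg N.arcNet.tot_poly x
  refine ⟨N.cutOf S, hq0.trans_le hdem, (div_le_iff₀ (hq0.trans_le hdem)).2 ?_⟩
  refine (cutCost_cutOf_le S).trans (hSq.trans ?_)
  have hlog : 0 ≤ Real.log (Fintype.card V) := Real.log_natCast_nonneg _
  have hR0 : 0 ≤ 2304 * (10 ^ 50 * (2 ^ 100) ^ 9) * (Fintype.card V : ℝ) ^ ((11 : ℝ) / 23) *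
      Real.log (Fintype.card V) ^ (2 : ℝ) := by positivity
  exact mul_le_mul (mul_le_mul hR hlov hlov0 hR0) hdem hq0.le
    (mul_nonneg hR0 (hlov0.trans hlov))
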